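/- Let γ > 0. There is r0 ∈ (0,1) such that for every r ∈ (0,r0), with q1(t) and q2(t) the contour integrals defined in the context, lim_{t→∞} (2·q2(t) − q1(t)²)/√t = −1/(2√(πγ)). -/

import Mathlib

open Filter

/-- `∮_{|z|=ρ} f(z) dz/(2πiz)`: the normalized contour integral over the counterclockwise
circle of radius `ρ` centered at the origin. -/
noncomputable def cint (ρ : ℝ) (f : ℂ → ℂ) : ℂ :=
  (2 * Real.pi * Complex.I)⁻¹ * (∮ z in C(0, ρ), f z / z)

/-- `c(z) = (z + 1/z)/2`. -/
noncomputable def cfun (z : ℂ) : ℂ := (z + z⁻¹) / 2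

/-- `ε_γ(z) = -z + 1/z - 2γ`. -/
noncomputable def epsfun (γ : ℂ) (z : ℂ) : ℂ := -z + z⁻¹ - 2 * γ

/-- The contour-integral expression for `q1(t)`. -/
noncomputable def q1 (γ r : ℝ) (t : ℝ) : ℂ :=
  cint r fun z1 => cint 1 fun z2 =>
    Complex.exp (t * (epsfun γ z1 + epsfun γ z2)) *
      ((cfun z1 - cfun z2) / (cfun z1 - cfun z2 - 2 * γ)) *
      (z1 * z2 / (1 - z1 * z2) ^ 2)

noncomputable def A1 (γ : ℝ) (z1 z2 z3 z4 : ℂ) : ℂ :=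
  ((cfun z1 - cfun z3) / (cfun z1 - cfun z3 - 2 * γ)) *
    ((cfun z2 - cfun z4) / (cfun z2 - cfun z4 - 2 * γ)) *
    ((cfun z1 - cfun z4 - 4 * γ) / (cfun z1 - cfun z4 - 2 * γ))

noncomputable def A2 (γ : ℝ) (z1 z2 z3 z4 : ℂ) : ℂ :=
  (2 * γ * (cfun z1 + cfun z2 - cfun z3 - cfun z4) /
      ((cfun z2 - cfun z3 - 2 * γ) * (cfun z1 - cfun z4 - 2 * γ))) *
    ((cfun z2 - cfun z4 - 4 * γ) / (cfun z2 - cfun z4 - 2 * γ))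

/-- The contour-integral expression for `q2(t)`. -/
noncomputable def q2 (γ r : ℝ) (t : ℝ) : ℂ :=
  cint (r ^ 3) fun z1 => cint (r ^ 2) fun z2 => cint r fun z3 => cint 1 fun z4 =>
    Complex.exp (t * (epsfun γ z1 + epsfun γ z2 + epsfun γ z3 + epsfun γ z4)) *
      (z1 * z2 * z3 * z4 / (1 - z1 * z2 * z3 * z4) ^ 2) *
      (z1 * z2 / (1 - z1 * z2)) *
      ((cfun z1 - cfun z2) / (cfun z1 - cfun z2 - 2 * γ)) *
      ((cfun z3 - cfun z4) / (cfun z3 - cfun z4 - 2 * γ)) *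
      (z3 * z4 / (1 - z3 * z4) - 2 * (z1 * z3 / (1 - z1 * z3)) * A1 γ z1 z2 z3 z4 +
        z1 * z2 / (1 - z1 * z2) * (1 + A2 γ z1 z2 z3 z4))

theorem cint_eq {ρ : ℝ} (hρ : ρ ≠ 0) (f : ℂ → ℂ) :
    cint ρ f = (2 * Real.pi : ℂ)⁻¹ * ∫ θ in (0 : ℝ)..2 * Real.pi, f (circleMap 0 ρ θ) := by
  have h : (∮ z in C(0, ρ), f z / z)
      = Complex.I * ∫ θ in (0 : ℝ)..2 * Real.pi, f (circleMap 0 ρ θ) := by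
    rw [circleIntegral, ← intervalIntegral.integral_const_mul]
    congr 1
    ext θ
    have : circleMap 0 ρ θ ≠ 0 := by simpa using hρ
    simp only [deriv_circleMap, smul_eq_mul]
    field_simp
  rw [cint, h]
  have := Complex.I_ne_zero
  have : (Real.pi : ℂ) ≠ 0 := by exact_mod_cast Real.pi_ne_zero
  field_simp

theorem norm_circleMap_pos {ρ : ℝ} (hρ : 0 < ρ) (θ : ℝ) : ‖circleMap 0 ρ θ‖ = ρ := by
  simp [abs_of_pos hρ]

theorem cint_congr {ρ : ℝ} (hρ : 0 < ρ) {f g : ℂ → ℂ} (h : ∀ z, ‖z‖ = ρ → f z = g z) :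
    cint ρ f = cint ρ g := by
  rw [cint_eq hρ.ne', cint_eq hρ.ne']
  congr 2
  ext θ
  exact h _ (norm_circleMap_pos hρ θ)

theorem cint_const_mul {ρ : ℝ} (hρ : 0 < ρ) (c : ℂ) (f : ℂ → ℂ) :
    cint ρ (fun z => c * f z) = c * cint ρ f := by
  rw [cint_eq hρ.ne', cint_eq hρ.ne', intervalIntegral.integral_const_mul]
  ring

theorem cint_mul_const {ρ : ℝ} (hρ : 0 < ρ) (c : ℂ) (f : ℂ → ℂ) :
    cint ρ (fun z => f z * c) = cint ρ f * c := by
  simp_rw [mul_comm _ c]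
  exact cint_const_mul hρ c f

theorem continuous_circle_of_forall {ρ : ℝ} (hρ : 0 < ρ) {f : ℂ → ℂ}
    (h : ∀ z, ‖z‖ = ρ → ContinuousAt f z) : Continuous fun θ => f (circleMap 0 ρ θ) :=
  continuous_iff_continuousAt.2 fun θ =>
    ContinuousAt.comp (h _ (norm_circleMap_pos hρ θ)) (continuous_circleMap 0 ρ).continuousAt

theorem cint_add {ρ : ℝ} (hρ : 0 < ρ) {f g : ℂ → ℂ}
    (hf : Continuous fun θ => f (circleMap 0 ρ θ)) (hg : Continuous fun θ => g (circleMap 0 ρ θ)) :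
    cint ρ (fun z => f z + g z) = cint ρ f + cint ρ g := by
  simp only [cint_eq hρ.ne']
  rw [intervalIntegral.integral_add (hf.intervalIntegrable _ _) (hg.intervalIntegrable _ _)]
  ring

theorem cint_sub {ρ : ℝ} (hρ : 0 < ρ) {f g : ℂ → ℂ}
    (hf : Continuous fun θ => f (circleMap 0 ρ θ)) (hg : Continuous fun θ => g (circleMap 0 ρ θ)) :
    cint ρ (fun z => f z - g z) = cint ρ f - cint ρ g := by
  simp only [cint_eq hρ.ne']
  rw [intervalIntegral.integral_sub (hf.intervalIntegrable _ _) (hg.intervalIntegrable _ _)]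
  ring

theorem norm_cint_le {ρ C : ℝ} (hρ : 0 < ρ) {f : ℂ → ℂ} (h : ∀ z, ‖z‖ = ρ → ‖f z‖ ≤ C) :
    ‖cint ρ f‖ ≤ C := by
  rw [cint_eq hρ.ne', norm_mul]
  have h1 := intervalIntegral.norm_integral_le_of_norm_le_const
    (a := 0) (b := 2 * Real.pi) (f := fun θ => f (circleMap 0 ρ θ)) (C := C)
    fun θ _ => h _ (norm_circleMap_pos hρ θ)
  have hpi := Real.pi_pos
  rw [sub_zero, abs_of_pos (by positivity)] at h1
  have h2 : ‖(2 * Real.pi : ℂ)⁻¹‖ = (2 * Real.pi)⁻¹ := by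
    simp [abs_of_pos hpi]
  rw [h2]
  calc (2 * Real.pi)⁻¹ * _ ≤ (2 * Real.pi)⁻¹ * (C * (2 * Real.pi)) := by gcongr
    _ = C := by field_simp

theorem continuous_cint {X : Type*} [TopologicalSpace X] {ρ : ℝ} (hρ : 0 < ρ) {F : X → ℂ → ℂ}
    (h : Continuous fun p : X × ℝ => F p.1 (circleMap 0 ρ p.2)) :
    Continuous fun x => cint ρ (F x) := by
  simp only [cint_eq hρ.ne']
  exact continuous_const.mul
    (intervalIntegral.continuous_parametric_intervalIntegral_of_continuous' (by exact h) _ _)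

theorem cint_comm {ρ₁ ρ₂ : ℝ} (h₁ : 0 < ρ₁) (h₂ : 0 < ρ₂) {f : ℂ → ℂ → ℂ}
    (h : Continuous fun p : ℝ × ℝ => f (circleMap 0 ρ₁ p.1) (circleMap 0 ρ₂ p.2)) :
    cint ρ₁ (fun a => cint ρ₂ fun b => f a b) = cint ρ₂ (fun b => cint ρ₁ fun a => f a b) := by
  simp only [cint_eq h₁.ne', cint_eq h₂.ne', intervalIntegral.integral_const_mul]
  congr 2
  simp only [intervalIntegral.integral_of_le Real.two_pi_pos.le]
  refine MeasureTheory.integral_integral_swap ?_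
  rw [MeasureTheory.Measure.prod_restrict, ← MeasureTheory.IntegrableOn]
  exact (h.continuousOn.integrableOn_compact (isCompact_Icc.prod isCompact_Icc)).mono_set
    (Set.prod_mono Set.Ioc_subset_Icc_self Set.Ioc_subset_Icc_self)

theorem cint_radius {ρ₁ ρ₂ : ℝ} (h₁ : 0 < ρ₁) (h : ρ₁ ≤ ρ₂) {f : ℂ → ℂ}
    (hf : ∀ z, ρ₁ ≤ ‖z‖ → ‖z‖ ≤ ρ₂ → DifferentiableAt ℂ f z) : cint ρ₁ f = cint ρ₂ f := by
  have := Complex.circleIntegral_sub_center_inv_smul_eq_of_differentiable_on_annulus_off_countable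
    (c := 0) h₁ h (f := f) Set.countable_empty
    (fun z hz => by
      simp only [Set.mem_sdiff, Metric.mem_closedBall, dist_zero_right, Metric.mem_ball,
        not_lt] at hz
      exact (hf z hz.2 hz.1).continuousAt.continuousWithinAt)
    (fun z hz => by
      simp only [Set.mem_sdiff, Metric.mem_closedBall, dist_zero_right, Metric.mem_ball,
        not_le, Set.mem_empty_iff_false, not_false_eq_true, and_true] at hz
      exact hf z hz.2.le hz.1.le)
  simp only [sub_zero, smul_eq_mul] at this
  simp only [cint, div_eq_inv_mul, this]

theorem cint_disc {ρ : ℝ} (hρ : 0 < ρ) {f : ℂ → ℂ}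
    (hf : ∀ z, ‖z‖ ≤ ρ → DifferentiableAt ℂ f z) : cint ρ f = f 0 := by
  have := Complex.circleIntegral_sub_inv_smul_of_differentiable_on_off_countable
    (c := 0) (w := 0) (R := ρ) (f := f) Set.countable_empty (by simpa using hρ)
    (fun z hz => (hf z (by simpa using hz)).continuousAt.continuousWithinAt)
    (fun z hz => hf z (by
      have := hz.1
      simp only [Metric.mem_ball, dist_zero_right] at this
      exact this.le))
  simp only [sub_zero, smul_eq_mul] at this
  simp only [cint, div_eq_inv_mul, this]
  have := Complex.I_ne_zero
  have : (Real.pi : ℂ) ≠ 0 := by exact_mod_cast Real.pi_ne_zero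
  field_simp

theorem cint_inv_sub_outside {ρ : ℝ} (hρ : 0 < ρ) {a : ℂ} (ha : ‖a‖ < ρ) (ha0 : a ≠ 0) :
    cint ρ (fun z => (z - a)⁻¹) = 0 := by
  have e : ∀ z : ℂ, ‖z‖ = ρ → (z - a)⁻¹ / z = a⁻¹ * ((z - a)⁻¹ - (z - 0)⁻¹) := by
    intro z hz
    have hz0 : z ≠ 0 := by rintro rfl; simp at hz; exact hρ.ne hz
    have hza : z - a ≠ 0 := by
      intro h
      rw [sub_eq_zero.1 h] at hz
      exact ha.ne hz
    rw [sub_zero]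
    field_simp
    ring
  have hi : ∀ b : ℂ, ‖b‖ < ρ → CircleIntegrable (fun z => (z - b)⁻¹) 0 ρ := by
    intro b hb
    rw [circleIntegrable_sub_inv_iff]
    right
    simp only [Metric.mem_sphere, dist_zero_right, abs_of_pos hρ]
    exact hb.ne
  rw [cint, circleIntegral.integral_congr hρ.le (fun z hz => e z (by simpa using hz)),
    circleIntegral.integral_const_mul, circleIntegral.integral_sub (hi a ha) (hi 0 (by simpa)),
    circleIntegral.integral_sub_inv_of_mem_ball (by simpa using ha),
    circleIntegral.integral_sub_inv_of_mem_ball (by simpa using hρ)]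
  simp

/-- Moving a circle outwards across a simple pole at `a`. -/
theorem cint_pole {ρ₁ ρ₂ : ℝ} (h₁ : 0 < ρ₁) {a : ℂ} (ha₁ : ρ₁ < ‖a‖) (ha₂ : ‖a‖ < ρ₂)
    {h : ℂ → ℂ} (hh : ∀ z, ρ₁ ≤ ‖z‖ → ‖z‖ ≤ ρ₂ → DifferentiableAt ℂ h z) :
    cint ρ₁ (fun z => h z / (z - a)) = cint ρ₂ (fun z => h z / (z - a)) - h a / a := by
  have h₂ : 0 < ρ₂ := h₁.trans (ha₁.trans ha₂)
  have ha0 : a ≠ 0 := by rintro rfl; simp at ha₁; linarith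
  have hd : ∀ z, ρ₁ ≤ ‖z‖ → ‖z‖ ≤ ρ₂ → DifferentiableAt ℂ (dslope h a) z := by
    intro z hz1 hz2
    rcases eq_or_ne z a with rfl | hne
    · have hopen : {w : ℂ | ρ₁ < ‖w‖ ∧ ‖w‖ < ρ₂} ∈ nhds z :=
        IsOpen.mem_nhds ((isOpen_lt continuous_const continuous_norm).inter
          (isOpen_lt continuous_norm continuous_const)) ⟨ha₁, ha₂⟩
      have : DifferentiableOn ℂ h {w : ℂ | ρ₁ < ‖w‖ ∧ ‖w‖ < ρ₂} :=
        fun w hw => (hh w hw.1.le hw.2.le).differentiableWithinAt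
      exact ((Complex.differentiableOn_dslope hopen).2 this).differentiableAt hopen
    · exact (differentiableAt_dslope_of_ne hne).2 (hh z hz1 hz2)
  have key : ∀ ρ, ρ₁ ≤ ρ → ρ ≤ ρ₂ → ρ ≠ ‖a‖ →
      cint ρ (fun z => h z / (z - a)) = h a * cint ρ (fun z => (z - a)⁻¹) + cint ρ (dslope h a) := by
    intro ρ hρ1 hρ2 hρa
    have hρ : 0 < ρ := h₁.trans_le hρ1
    have hne : ∀ z : ℂ, ‖z‖ = ρ → z - a ≠ 0 := by
      intro z hz h0
      rw [sub_eq_zero.1 h0] at hz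
      exact hρa hz.symm
    rw [← cint_const_mul hρ, ← cint_add hρ]
    · refine cint_congr hρ fun z hz => ?_
      have := hne z hz
      rw [dslope_of_ne _ (sub_ne_zero.1 this), slope_def_field]
      field_simp
      ring
    · refine continuous_circle_of_forall (f := fun z => h a * (z - a)⁻¹) hρ fun z hz => ?_
      have := hne z hz
      fun_prop (disch := assumption)
    · exact continuous_circle_of_forall hρ fun z hz =>
        (hd z (hz ▸ hρ1) (hz ▸ hρ2)).continuousAt
  rw [key ρ₁ le_rfl (ha₁.trans ha₂).le ha₁.ne, key ρ₂ (ha₁.trans ha₂).le le_rfl ha₂.ne',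
    cint_inv_sub_outside h₂ ha₂ ha0, cint_radius h₁ (ha₁.trans ha₂).le hd,
    cint_disc h₁ (f := fun z => (z - a)⁻¹)]
  · simp
    field_simp
    ring
  · intro z hz
    have : z - a ≠ 0 := by
      intro h0
      rw [sub_eq_zero.1 h0] at hz
      linarith
    fun_prop (disch := assumption)

theorem cint_eq_shift {ρ : ℝ} (hρ : ρ ≠ 0) (f : ℂ → ℂ) (s : ℝ) :
    cint ρ f = (2 * Real.pi : ℂ)⁻¹ * ∫ θ in s..s + 2 * Real.pi, f (circleMap 0 ρ θ) := by
  rw [cint_eq hρ]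
  have hp : Function.Periodic (fun θ => f (circleMap 0 ρ θ)) (2 * Real.pi) := fun θ => by
    simp only [periodic_circleMap 0 ρ θ]
  have := hp.intervalIntegral_add_eq 0 s
  rw [zero_add] at this
  rw [this]

theorem cint_scale {ρ : ℝ} (hρ : 0 < ρ) {a : ℂ} (ha : a ≠ 0) (f : ℂ → ℂ) :
    cint ρ f = cint (ρ * ‖a‖) (fun z => f (z / a)) := by
  have h2 : ρ * ‖a‖ ≠ 0 := by positivity
  rw [cint_eq_shift h2 _ a.arg, cint_eq hρ.ne']
  congr 1
  have := intervalIntegral.integral_comp_add_right (a := 0) (b := 2 * Real.pi)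
    (fun θ => f (circleMap 0 (ρ * ‖a‖) θ / a)) a.arg
  rw [zero_add, add_comm (2 * Real.pi)] at this
  rw [← this]
  congr 1
  ext θ
  congr 1
  simp only [circleMap, zero_add, Complex.ofReal_mul, Complex.ofReal_add, add_mul, Complex.exp_add]
  rw [eq_div_iff ha]
  conv_lhs => rw [← Complex.norm_mul_exp_arg_mul_I a]
  ring

theorem cint_inv {ρ : ℝ} (hρ : 0 < ρ) (f : ℂ → ℂ) :
    cint ρ (fun z => f z⁻¹) = cint ρ⁻¹ f := by
  rw [cint_eq (inv_ne_zero hρ.ne'), cint_eq_shift hρ.ne' _ (-(2 * Real.pi))]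
  congr 1
  have := intervalIntegral.integral_comp_neg (a := -(2 * Real.pi)) (b := 0)
    (fun θ => f (circleMap 0 ρ⁻¹ θ))
  rw [neg_add_cancel]
  rw [neg_zero, neg_neg] at this
  rw [← this]
  congr 1
  ext θ
  congr 1
  simp [circleMap, Complex.exp_neg, mul_comm]

/-- The fourfold iterated normalized contour integral. -/
noncomputable def cint4 (ρ₁ ρ₂ ρ₃ ρ₄ : ℝ) (G : ℂ → ℂ → ℂ → ℂ → ℂ) : ℂ :=
  cint ρ₁ fun a => cint ρ₂ fun b => cint ρ₃ fun c => cint ρ₄ fun d => G a b c d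

/-- Joint complex differentiability of `G` on a product of four closed annuli. -/
def Reg4 (G : ℂ → ℂ → ℂ → ℂ → ℂ) (a a' b b' c c' d d' : ℝ) : Prop :=
  ∀ z₁ z₂ z₃ z₄ : ℂ, a ≤ ‖z₁‖ → ‖z₁‖ ≤ a' → b ≤ ‖z₂‖ → ‖z₂‖ ≤ b' → c ≤ ‖z₃‖ → ‖z₃‖ ≤ c' →
    d ≤ ‖z₄‖ → ‖z₄‖ ≤ d' →
    DifferentiableAt ℂ (fun p : ℂ × ℂ × ℂ × ℂ => G p.1 p.2.1 p.2.2.1 p.2.2.2) (z₁, z₂, z₃, z₄)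

section

variable {G H : ℂ → ℂ → ℂ → ℂ → ℂ} {a a' b b' c c' d d' ρ₁ ρ₂ ρ₃ ρ₄ : ℝ}

theorem Reg4.mono {e e' f f' g g' h h' : ℝ} (hG : Reg4 G a a' b b' c c' d d') (ha : a ≤ e)
    (ha' : e' ≤ a') (hb : b ≤ f) (hb' : f' ≤ b') (hc : c ≤ g) (hc' : g' ≤ c') (hd : d ≤ h)
    (hd' : h' ≤ d') : Reg4 G e e' f f' g g' h h' :=
  fun z₁ z₂ z₃ z₄ h1 h2 h3 h4 h5 h6 h7 h8 => hG z₁ z₂ z₃ z₄ (ha.trans h1) (h2.trans ha')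
    (hb.trans h3) (h4.trans hb') (hc.trans h5) (h6.trans hc') (hd.trans h7) (h8.trans hd')

theorem Reg4.swap34 (hG : Reg4 G a a' b b' c c' d d') :
    Reg4 (fun w x y z => G w x z y) a a' b b' d d' c c' := by
  intro z₁ z₂ z₃ z₄ h1 h2 h3 h4 h5 h6 h7 h8
  have := hG z₁ z₂ z₄ z₃ h1 h2 h3 h4 h7 h8 h5 h6
  exact this.comp (z₁, z₂, z₃, z₄)
    (f := fun p : ℂ × ℂ × ℂ × ℂ => (p.1, p.2.1, p.2.2.2, p.2.2.1)) (by fun_prop)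

theorem Reg4.swap23 (hG : Reg4 G a a' b b' c c' d d') :
    Reg4 (fun w x y z => G w y x z) a a' c c' b b' d d' := by
  intro z₁ z₂ z₃ z₄ h1 h2 h3 h4 h5 h6 h7 h8
  have := hG z₁ z₃ z₂ z₄ h1 h2 h5 h6 h3 h4 h7 h8
  exact this.comp (z₁, z₂, z₃, z₄)
    (f := fun p : ℂ × ℂ × ℂ × ℂ => (p.1, p.2.2.1, p.2.1, p.2.2.2)) (by fun_prop)

theorem Reg4.swap12 (hG : Reg4 G a a' b b' c c' d d') :
    Reg4 (fun w x y z => G x w y z) b b' a a' c c' d d' := by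
  intro z₁ z₂ z₃ z₄ h1 h2 h3 h4 h5 h6 h7 h8
  have := hG z₂ z₁ z₃ z₄ h3 h4 h1 h2 h5 h6 h7 h8
  exact this.comp (z₁, z₂, z₃, z₄)
    (f := fun p : ℂ × ℂ × ℂ × ℂ => (p.2.1, p.1, p.2.2.1, p.2.2.2)) (by fun_prop)

theorem Reg4.add (hG : Reg4 G a a' b b' c c' d d') (hH : Reg4 H a a' b b' c c' d d') :
    Reg4 (fun w x y z => G w x y z + H w x y z) a a' b b' c c' d d' :=
  fun z₁ z₂ z₃ z₄ h1 h2 h3 h4 h5 h6 h7 h8 =>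
    (hG z₁ z₂ z₃ z₄ h1 h2 h3 h4 h5 h6 h7 h8).add (hH z₁ z₂ z₃ z₄ h1 h2 h3 h4 h5 h6 h7 h8)

theorem Reg4.sub (hG : Reg4 G a a' b b' c c' d d') (hH : Reg4 H a a' b b' c c' d d') :
    Reg4 (fun w x y z => G w x y z - H w x y z) a a' b b' c c' d d' :=
  fun z₁ z₂ z₃ z₄ h1 h2 h3 h4 h5 h6 h7 h8 =>
    (hG z₁ z₂ z₃ z₄ h1 h2 h3 h4 h5 h6 h7 h8).sub (hH z₁ z₂ z₃ z₄ h1 h2 h3 h4 h5 h6 h7 h8)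

theorem Reg4.const_mul (k : ℂ) (hG : Reg4 G a a' b b' c c' d d') :
    Reg4 (fun w x y z => k * G w x y z) a a' b b' c c' d d' :=
  fun z₁ z₂ z₃ z₄ h1 h2 h3 h4 h5 h6 h7 h8 =>
    (hG z₁ z₂ z₃ z₄ h1 h2 h3 h4 h5 h6 h7 h8).const_mul k

variable (h₁ : 0 < ρ₁) (h₂ : 0 < ρ₂) (h₃ : 0 < ρ₃) (h₄ : 0 < ρ₄)
include h₁ h₂ h₃ h₄

theorem Reg4.continuous (hG : Reg4 G ρ₁ ρ₁ ρ₂ ρ₂ ρ₃ ρ₃ ρ₄ ρ₄) :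
    Continuous fun p : ℝ × ℝ × ℝ × ℝ => G (circleMap 0 ρ₁ p.1) (circleMap 0 ρ₂ p.2.1)
      (circleMap 0 ρ₃ p.2.2.1) (circleMap 0 ρ₄ p.2.2.2) := by
  refine continuous_iff_continuousAt.2 fun p => ?_
  have hc : Continuous fun p : ℝ × ℝ × ℝ × ℝ => (circleMap 0 ρ₁ p.1, circleMap 0 ρ₂ p.2.1,
      circleMap 0 ρ₃ p.2.2.1, circleMap 0 ρ₄ p.2.2.2) := by fun_prop
  have := (hG (circleMap 0 ρ₁ p.1) (circleMap 0 ρ₂ p.2.1) (circleMap 0 ρ₃ p.2.2.1)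
    (circleMap 0 ρ₄ p.2.2.2) (norm_circleMap_pos h₁ _).ge (norm_circleMap_pos h₁ _).le
    (norm_circleMap_pos h₂ _).ge (norm_circleMap_pos h₂ _).le (norm_circleMap_pos h₃ _).ge
    (norm_circleMap_pos h₃ _).le (norm_circleMap_pos h₄ _).ge
    (norm_circleMap_pos h₄ _).le).continuousAt
  exact ContinuousAt.comp (f := fun p : ℝ × ℝ × ℝ × ℝ => (circleMap 0 ρ₁ p.1, circleMap 0 ρ₂ p.2.1,
      circleMap 0 ρ₃ p.2.2.1, circleMap 0 ρ₄ p.2.2.2)) this hc.continuousAt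

theorem cint4_congr (h : ∀ z₁ z₂ z₃ z₄, ‖z₁‖ = ρ₁ → ‖z₂‖ = ρ₂ → ‖z₃‖ = ρ₃ → ‖z₄‖ = ρ₄ →
    G z₁ z₂ z₃ z₄ = H z₁ z₂ z₃ z₄) : cint4 ρ₁ ρ₂ ρ₃ ρ₄ G = cint4 ρ₁ ρ₂ ρ₃ ρ₄ H :=
  cint_congr h₁ fun _ e1 => cint_congr h₂ fun _ e2 => cint_congr h₃ fun _ e3 =>
    cint_congr h₄ fun _ e4 => h _ _ _ _ e1 e2 e3 e4

theorem cint4_swap34 (hG : Reg4 G ρ₁ ρ₁ ρ₂ ρ₂ ρ₃ ρ₃ ρ₄ ρ₄) :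
    cint4 ρ₁ ρ₂ ρ₃ ρ₄ G = cint4 ρ₁ ρ₂ ρ₄ ρ₃ fun w x y z => G w x z y := by
  have hc := hG.continuous h₁ h₂ h₃ h₄
  simp only [cint4]
  rw [cint_eq h₁.ne', cint_eq h₁.ne']
  congr 2; ext θ
  rw [cint_eq h₂.ne', cint_eq h₂.ne']
  congr 2; ext φ
  exact cint_comm h₃ h₄ (hc.comp (f := fun p : ℝ × ℝ => (θ, φ, p.1, p.2)) (by fun_prop))

theorem cint4_swap23 (hG : Reg4 G ρ₁ ρ₁ ρ₂ ρ₂ ρ₃ ρ₃ ρ₄ ρ₄) :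
    cint4 ρ₁ ρ₂ ρ₃ ρ₄ G = cint4 ρ₁ ρ₃ ρ₂ ρ₄ fun w x y z => G w y x z := by
  have hc := hG.continuous h₁ h₂ h₃ h₄
  simp only [cint4]
  rw [cint_eq h₁.ne', cint_eq h₁.ne']
  congr 2; ext θ
  exact cint_comm (f := fun b c => cint ρ₄ fun d => G (circleMap 0 ρ₁ θ) b c d) h₂ h₃
    (continuous_cint h₄
      (hc.comp (f := fun p : (ℝ × ℝ) × ℝ => (θ, p.1.1, p.1.2, p.2)) (by fun_prop)))

theorem cint4_swap12 (hG : Reg4 G ρ₁ ρ₁ ρ₂ ρ₂ ρ₃ ρ₃ ρ₄ ρ₄) :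
    cint4 ρ₁ ρ₂ ρ₃ ρ₄ G = cint4 ρ₂ ρ₁ ρ₃ ρ₄ fun w x y z => G x w y z := by
  have hc := hG.continuous h₁ h₂ h₃ h₄
  exact cint_comm (f := fun a b => cint ρ₃ fun c => cint ρ₄ fun d => G a b c d) h₁ h₂
    (continuous_cint h₃ (continuous_cint
      (F := fun (p : (ℝ × ℝ) × ℝ) d => G (circleMap 0 ρ₁ p.1.1) (circleMap 0 ρ₂ p.1.2)
        (circleMap 0 ρ₃ p.2) d) h₄
      (hc.comp (f := fun p : ((ℝ × ℝ) × ℝ) × ℝ => (p.1.1.1, p.1.1.2, p.1.2, p.2))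
        (by fun_prop))))

theorem cint4_add (hG : Reg4 G ρ₁ ρ₁ ρ₂ ρ₂ ρ₃ ρ₃ ρ₄ ρ₄) (hH : Reg4 H ρ₁ ρ₁ ρ₂ ρ₂ ρ₃ ρ₃ ρ₄ ρ₄) :
    cint4 ρ₁ ρ₂ ρ₃ ρ₄ (fun w x y z => G w x y z + H w x y z) =
      cint4 ρ₁ ρ₂ ρ₃ ρ₄ G + cint4 ρ₁ ρ₂ ρ₃ ρ₄ H := by
  have cG := hG.continuous h₁ h₂ h₃ h₄
  have cH := hH.continuous h₁ h₂ h₃ h₄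
  have l4 : ∀ {K : ℂ → ℂ → ℂ → ℂ → ℂ}, (Continuous fun p : ℝ × ℝ × ℝ × ℝ =>
      K (circleMap 0 ρ₁ p.1) (circleMap 0 ρ₂ p.2.1) (circleMap 0 ρ₃ p.2.2.1)
        (circleMap 0 ρ₄ p.2.2.2)) → Continuous fun p : ℝ × ℝ × ℝ =>
      cint ρ₄ (K (circleMap 0 ρ₁ p.1) (circleMap 0 ρ₂ p.2.1) (circleMap 0 ρ₃ p.2.2)) :=
    fun hK => continuous_cint h₄
      (hK.comp (f := fun p : (ℝ × ℝ × ℝ) × ℝ => (p.1.1, p.1.2.1, p.1.2.2, p.2)) (by fun_prop))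
  have l3 : ∀ {K : ℂ → ℂ → ℂ → ℂ → ℂ}, (Continuous fun p : ℝ × ℝ × ℝ × ℝ =>
      K (circleMap 0 ρ₁ p.1) (circleMap 0 ρ₂ p.2.1) (circleMap 0 ρ₃ p.2.2.1)
        (circleMap 0 ρ₄ p.2.2.2)) → Continuous fun p : ℝ × ℝ =>
      cint ρ₃ fun c => cint ρ₄ (K (circleMap 0 ρ₁ p.1) (circleMap 0 ρ₂ p.2) c) :=
    fun hK => continuous_cint h₃
      ((l4 hK).comp (f := fun p : (ℝ × ℝ) × ℝ => (p.1.1, p.1.2, p.2)) (by fun_prop))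
  have l2 : ∀ {K : ℂ → ℂ → ℂ → ℂ → ℂ}, (Continuous fun p : ℝ × ℝ × ℝ × ℝ =>
      K (circleMap 0 ρ₁ p.1) (circleMap 0 ρ₂ p.2.1) (circleMap 0 ρ₃ p.2.2.1)
        (circleMap 0 ρ₄ p.2.2.2)) → Continuous fun p : ℝ =>
      cint ρ₂ fun b => cint ρ₃ fun c => cint ρ₄ (K (circleMap 0 ρ₁ p) b c) :=
    fun hK => continuous_cint h₂ (l3 hK)
  simp only [cint4]
  rw [← cint_add h₁ (l2 cG) (l2 cH), cint_eq h₁.ne', cint_eq h₁.ne']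
  congr 2; ext θ
  rw [← cint_add h₂ ((l3 cG).comp (f := fun p : ℝ => (θ, p)) (by fun_prop))
    ((l3 cH).comp (f := fun p : ℝ => (θ, p)) (by fun_prop)), cint_eq h₂.ne', cint_eq h₂.ne']
  congr 2; ext φ
  rw [← cint_add h₃ ((l4 cG).comp (f := fun p : ℝ => (θ, φ, p)) (by fun_prop))
    ((l4 cH).comp (f := fun p : ℝ => (θ, φ, p)) (by fun_prop)), cint_eq h₃.ne', cint_eq h₃.ne']
  congr 2; ext ψ
  exact cint_add h₄ (cG.comp (f := fun p : ℝ => (θ, φ, ψ, p)) (by fun_prop))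
    (cH.comp (f := fun p : ℝ => (θ, φ, ψ, p)) (by fun_prop))

theorem cint4_const_mul (k : ℂ) :
    cint4 ρ₁ ρ₂ ρ₃ ρ₄ (fun w x y z => k * G w x y z) = k * cint4 ρ₁ ρ₂ ρ₃ ρ₄ G := by
  simp only [cint4, cint_const_mul h₁, cint_const_mul h₂, cint_const_mul h₃, cint_const_mul h₄]

theorem cint4_sub (hG : Reg4 G ρ₁ ρ₁ ρ₂ ρ₂ ρ₃ ρ₃ ρ₄ ρ₄) (hH : Reg4 H ρ₁ ρ₁ ρ₂ ρ₂ ρ₃ ρ₃ ρ₄ ρ₄) :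
    cint4 ρ₁ ρ₂ ρ₃ ρ₄ (fun w x y z => G w x y z - H w x y z) =
      cint4 ρ₁ ρ₂ ρ₃ ρ₄ G - cint4 ρ₁ ρ₂ ρ₃ ρ₄ H := by
  have := cint4_add h₁ h₂ h₃ h₄ hG (hH.const_mul (-1))
  rw [cint4_const_mul h₁ h₂ h₃ h₄] at this
  simp only [neg_one_mul, ← sub_eq_add_neg] at this
  exact this

end

section

variable {G H : ℂ → ℂ → ℂ → ℂ → ℂ} {ρ₁ ρ₂ ρ₃ ρ₄ ρ' : ℝ}
variable (h₁ : 0 < ρ₁) (h₂ : 0 < ρ₂) (h₃ : 0 < ρ₃) (h₄ : 0 < ρ₄)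
include h₁ h₂ h₃ h₄

theorem cint4_radius4 (hle : ρ₄ ≤ ρ') (hG : Reg4 G ρ₁ ρ₁ ρ₂ ρ₂ ρ₃ ρ₃ ρ₄ ρ') :
    cint4 ρ₁ ρ₂ ρ₃ ρ₄ G = cint4 ρ₁ ρ₂ ρ₃ ρ' G := by
  refine cint_congr h₁ fun z₁ e1 => cint_congr h₂ fun z₂ e2 => cint_congr h₃ fun z₃ e3 =>
    cint_radius h₄ hle fun z hz hz' => ?_
  exact (hG z₁ z₂ z₃ z e1.ge e1.le e2.ge e2.le e3.ge e3.le hz hz').comp z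
    (f := fun z : ℂ => (z₁, z₂, z₃, z)) (by fun_prop)

theorem cint4_radius3 (hle : ρ₃ ≤ ρ') (hG : Reg4 G ρ₁ ρ₁ ρ₂ ρ₂ ρ₃ ρ' ρ₄ ρ₄) :
    cint4 ρ₁ ρ₂ ρ₃ ρ₄ G = cint4 ρ₁ ρ₂ ρ' ρ₄ G := by
  have h' := h₃.trans_le hle
  rw [cint4_swap34 h₁ h₂ h₃ h₄ (hG.mono le_rfl le_rfl le_rfl le_rfl le_rfl hle le_rfl le_rfl),
    cint4_swap34 h₁ h₂ h' h₄ (hG.mono le_rfl le_rfl le_rfl le_rfl hle le_rfl le_rfl le_rfl)]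
  exact cint4_radius4 h₁ h₂ h₄ h₃ hle hG.swap34

theorem cint4_radius2 (hle : ρ₂ ≤ ρ') (hG : Reg4 G ρ₁ ρ₁ ρ₂ ρ' ρ₃ ρ₃ ρ₄ ρ₄) :
    cint4 ρ₁ ρ₂ ρ₃ ρ₄ G = cint4 ρ₁ ρ' ρ₃ ρ₄ G := by
  have h' := h₂.trans_le hle
  rw [cint4_swap23 h₁ h₂ h₃ h₄ (hG.mono le_rfl le_rfl le_rfl hle le_rfl le_rfl le_rfl le_rfl),
    cint4_swap23 h₁ h' h₃ h₄ (hG.mono le_rfl le_rfl hle le_rfl le_rfl le_rfl le_rfl le_rfl)]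
  exact cint4_radius3 h₁ h₃ h₂ h₄ hle hG.swap23

theorem cint4_radius1 (hle : ρ₁ ≤ ρ') (hG : Reg4 G ρ₁ ρ' ρ₂ ρ₂ ρ₃ ρ₃ ρ₄ ρ₄) :
    cint4 ρ₁ ρ₂ ρ₃ ρ₄ G = cint4 ρ' ρ₂ ρ₃ ρ₄ G := by
  have h' := h₁.trans_le hle
  rw [cint4_swap12 h₁ h₂ h₃ h₄ (hG.mono le_rfl hle le_rfl le_rfl le_rfl le_rfl le_rfl le_rfl),
    cint4_swap12 h' h₂ h₃ h₄ (hG.mono hle le_rfl le_rfl le_rfl le_rfl le_rfl le_rfl le_rfl)]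
  exact cint4_radius2 h₂ h₁ h₃ h₄ hle hG.swap12

theorem cint4_antisymm34 (hle : ρ₃ ≤ ρ₄) (hH : Reg4 H ρ₁ ρ₁ ρ₂ ρ₂ ρ₃ ρ₄ ρ₃ ρ₄) :
    cint4 ρ₁ ρ₂ ρ₃ ρ₄ (fun w x y z => H w x y z - H w x z y) = 0 := by
  have s1 := hH.mono le_rfl le_rfl le_rfl le_rfl le_rfl hle hle le_rfl
  have s2 : Reg4 H ρ₁ ρ₁ ρ₂ ρ₂ ρ₃ ρ₄ ρ₄ ρ₄ := hH.mono le_rfl le_rfl le_rfl le_rfl le_rfl le_rfl hle le_rfl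
  have s3 := hH.swap34.mono le_rfl le_rfl le_rfl le_rfl le_rfl le_rfl hle le_rfl
  have s4 := s3.mono le_rfl le_rfl le_rfl le_rfl le_rfl hle le_rfl le_rfl
  rw [cint4_sub h₁ h₂ h₃ h₄ s1 s4, cint4_radius3 h₁ h₂ h₃ h₄ hle s2,
    cint4_radius3 h₁ h₂ h₃ h₄ hle s3,
    cint4_swap34 h₁ h₂ h₄ h₄ (s2.mono le_rfl le_rfl le_rfl le_rfl hle le_rfl le_rfl le_rfl), sub_self]

theorem cint4_antisymm23 (hle : ρ₂ ≤ ρ₃) (hH : Reg4 H ρ₁ ρ₁ ρ₂ ρ₃ ρ₂ ρ₃ ρ₄ ρ₄) :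
    cint4 ρ₁ ρ₂ ρ₃ ρ₄ (fun w x y z => H w x y z - H w y x z) = 0 := by
  have s1 := hH.mono le_rfl le_rfl le_rfl hle hle le_rfl le_rfl le_rfl
  have s2 : Reg4 H ρ₁ ρ₁ ρ₂ ρ₃ ρ₃ ρ₃ ρ₄ ρ₄ := hH.mono le_rfl le_rfl le_rfl le_rfl hle le_rfl le_rfl le_rfl
  have s3 := hH.swap23.mono le_rfl le_rfl le_rfl le_rfl hle le_rfl le_rfl le_rfl
  have s4 := s3.mono le_rfl le_rfl le_rfl hle le_rfl le_rfl le_rfl le_rfl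
  rw [cint4_sub h₁ h₂ h₃ h₄ s1 s4, cint4_radius2 h₁ h₂ h₃ h₄ hle s2,
    cint4_radius2 h₁ h₂ h₃ h₄ hle s3,
    cint4_swap23 h₁ h₃ h₃ h₄ (s2.mono le_rfl le_rfl hle le_rfl le_rfl le_rfl le_rfl le_rfl), sub_self]

theorem cint4_antisymm12 (hle : ρ₁ ≤ ρ₂) (hH : Reg4 H ρ₁ ρ₂ ρ₁ ρ₂ ρ₃ ρ₃ ρ₄ ρ₄) :
    cint4 ρ₁ ρ₂ ρ₃ ρ₄ (fun w x y z => H w x y z - H x w y z) = 0 := by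
  have s1 := hH.mono le_rfl hle hle le_rfl le_rfl le_rfl le_rfl le_rfl
  have s2 : Reg4 H ρ₁ ρ₂ ρ₂ ρ₂ ρ₃ ρ₃ ρ₄ ρ₄ := hH.mono le_rfl le_rfl hle le_rfl le_rfl le_rfl le_rfl le_rfl
  have s3 := hH.swap12.mono le_rfl le_rfl hle le_rfl le_rfl le_rfl le_rfl le_rfl
  have s4 := s3.mono le_rfl hle le_rfl le_rfl le_rfl le_rfl le_rfl le_rfl
  rw [cint4_sub h₁ h₂ h₃ h₄ s1 s4, cint4_radius1 h₁ h₂ h₃ h₄ hle s2,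
    cint4_radius1 h₁ h₂ h₃ h₄ hle s3,
    cint4_swap12 h₂ h₂ h₃ h₄ (s2.mono hle le_rfl le_rfl le_rfl le_rfl le_rfl le_rfl le_rfl), sub_self]

end

/-- The remainder left after removing the `3 ↔ 4` and `1 ↔ 2` antisymmetric parts, as a function of
`R_{ij} = 1/(c_i - c_j - g)`, `U = U₁₂`, `X = U₁₃`, `Y = U₂₃`. -/
def remTerm (g D r12 r13 r14 r24 r34 U X Y : ℂ) : ℂ :=
  (g * (1 + g * r12) * (g * r24 * r34 + r14 * (1 - g * r24 + g * r34 + g ^ 2 * r24 * r34)) +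
      g * (1 + g * r12) * r24 * (1 + 2 * g * r13) -
      (2 * g ^ 2 * (r12 * r14 - r12 * r13) + 2 * g * (r14 - r13)) -
      (g ^ 2 * r14 * r34 + g * r24 - g ^ 2 * r24 * r34 - g * r14)) * U ^ 2 +
    (-2 * ((1 + g * r12) * (1 + g * r34) * (1 + g * r13) * (1 + g * r24) * D * r14) +
      2 * ((1 + g * r12) * (1 + g * r34)) + 2 * g * r34 - 2 * g * r14) * (U * X) +
    (2 * ((1 + g * r12) * (1 + g * r34)) - 2 * g * r34 + 2 * g * r24) * (U * Y) -
    2 * ((1 + g * r12) * (1 + g * r34)) * (X * Y)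

theorem remTerm_antisymm {c1 c2 c3 c4 g r12 r13 r14 r24 r34 U X Y : ℂ}
    (h12 : r12 * (c1 - c2 - g) = 1) (h13 : r13 * (c1 - c3 - g) = 1)
    (h14 : r14 * (c1 - c4 - g) = 1) (h24 : r24 * (c2 - c4 - g) = 1)
    (h34 : r34 * (c3 - c4 - g) = 1)
    (hU : (c1 - c2) * U + (c2 - c3) * Y = (c1 - c3) * X) :
    remTerm g (c1 - c4 - 2 * g) r12 r13 r14 r24 r34 U X Y +
      remTerm g (c1 - c4 - 2 * g) r13 r12 r14 r34 r24 X U Y = 0 := by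
  have n12 : c1 - c2 - g ≠ 0 := right_ne_zero_of_mul_eq_one h12
  have n13 : c1 - c3 - g ≠ 0 := right_ne_zero_of_mul_eq_one h13
  have n14 : c1 - c4 - g ≠ 0 := right_ne_zero_of_mul_eq_one h14
  have n24 : c2 - c4 - g ≠ 0 := right_ne_zero_of_mul_eq_one h24
  have n34 : c3 - c4 - g ≠ 0 := right_ne_zero_of_mul_eq_one h34
  obtain rfl : r12 = 1 / (c1 - c2 - g) := by rw [eq_div_iff n12, h12]
  obtain rfl : r13 = 1 / (c1 - c3 - g) := by rw [eq_div_iff n13, h13]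
  obtain rfl : r14 = 1 / (c1 - c4 - g) := by rw [eq_div_iff n14, h14]
  obtain rfl : r24 = 1 / (c2 - c4 - g) := by rw [eq_div_iff n24, h24]
  obtain rfl : r34 = 1 / (c3 - c4 - g) := by rw [eq_div_iff n34, h34]
  clear h12 h13 h14 h24 h34
  have e1 : c1 = (c1 - c2 - g) + (c2 - c4 - g) + 2 * g + c4 := by ring
  have e3 : c3 = (c3 - c4 - g) + g + c4 := by ring
  set L : ℂ := 2 * (g * (1 / (c1 - c2 - g)) * (1 / (c1 - c3 - g)) + g ^ 2 * (c1 - c4 - 2 * g) *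
    (1 / (c1 - c2 - g)) * (1 / (c1 - c3 - g)) * (1 / (c2 - c4 - g)) * (1 / (c3 - c4 - g))) with hL
  have al : ∀ c2 c3 : ℂ, c1 - c2 - g ≠ 0 → c1 - c3 - g ≠ 0 → c2 - c4 - g ≠ 0 → c3 - c4 - g ≠ 0 →
    (g * (1 + g * (1 / (c1 - c2 - g))) * (g * (1 / (c2 - c4 - g)) * (1 / (c3 - c4 - g)) +
      (1 / (c1 - c4 - g)) * (1 - g * (1 / (c2 - c4 - g)) + g * (1 / (c3 - c4 - g)) +
        g ^ 2 * (1 / (c2 - c4 - g)) * (1 / (c3 - c4 - g)))) +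
      g * (1 + g * (1 / (c1 - c2 - g))) * (1 / (c2 - c4 - g)) * (1 + 2 * g * (1 / (c1 - c3 - g))) -
      (2 * g ^ 2 * ((1 / (c1 - c2 - g)) * (1 / (c1 - c4 - g)) -
        (1 / (c1 - c2 - g)) * (1 / (c1 - c3 - g))) +
        2 * g * ((1 / (c1 - c4 - g)) - (1 / (c1 - c3 - g)))) -
      (g ^ 2 * (1 / (c1 - c4 - g)) * (1 / (c3 - c4 - g)) + g * (1 / (c2 - c4 - g)) -
        g ^ 2 * (1 / (c2 - c4 - g)) * (1 / (c3 - c4 - g)) - g * (1 / (c1 - c4 - g)))) =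
      2 * (g * (1 / (c1 - c2 - g)) * (1 / (c1 - c3 - g)) + g ^ 2 * (c1 - c4 - 2 * g) *
        (1 / (c1 - c2 - g)) * (1 / (c1 - c3 - g)) * (1 / (c2 - c4 - g)) * (1 / (c3 - c4 - g))) *
        (c1 - c2) := by
    intro c2 c3 n12 n13 n24 n34
    field_simp
    ring
  have be : (-2 * ((1 + g * (1 / (c1 - c2 - g))) * (1 + g * (1 / (c3 - c4 - g))) *
      (1 + g * (1 / (c1 - c3 - g))) * (1 + g * (1 / (c2 - c4 - g))) * (c1 - c4 - 2 * g) *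
        (1 / (c1 - c4 - g))) +
      2 * ((1 + g * (1 / (c1 - c2 - g))) * (1 + g * (1 / (c3 - c4 - g)))) +
      2 * g * (1 / (c3 - c4 - g)) - 2 * g * (1 / (c1 - c4 - g))) +
      (-2 * ((1 + g * (1 / (c1 - c3 - g))) * (1 + g * (1 / (c2 - c4 - g))) *
      (1 + g * (1 / (c1 - c2 - g))) * (1 + g * (1 / (c3 - c4 - g))) * (c1 - c4 - 2 * g) *
        (1 / (c1 - c4 - g))) +
      2 * ((1 + g * (1 / (c1 - c3 - g))) * (1 + g * (1 / (c2 - c4 - g)))) +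
      2 * g * (1 / (c2 - c4 - g)) - 2 * g * (1 / (c1 - c4 - g))) =
      - L * (c1 - c2) - L * (c1 - c3) := by
    rw [hL]
    field_simp
    ring
  have de : (2 * ((1 + g * (1 / (c1 - c2 - g))) * (1 + g * (1 / (c3 - c4 - g)))) -
      2 * g * (1 / (c3 - c4 - g)) + 2 * g * (1 / (c2 - c4 - g))) -
      2 * ((1 + g * (1 / (c1 - c3 - g))) * (1 + g * (1 / (c2 - c4 - g)))) = L * (c2 - c3) := by
    rw [hL]
    field_simp
    ring
  have a1 := al c2 c3 n12 n13 n24 n34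
  have a2 := al c3 c2 n13 n12 n34 n24
  rw [remTerm, remTerm]
  linear_combination U ^ 2 * a1 + X ^ 2 * a2 + U * X * be + (U - X) * Y * de +
    (U - X) * L * hU

theorem A2_split {c1 c2 c3 c4 g r12 r14 r23 r24 r34 : ℂ}
    (h12 : r12 * (c1 - c2 - g) = 1)
    (h14 : r14 * (c1 - c4 - g) = 1) (h23 : r23 * (c2 - c3 - g) = 1)
    (h24 : r24 * (c2 - c4 - g) = 1) (h34 : r34 * (c3 - c4 - g) = 1) :
    (1 + g * r12) * (1 + g * r34) *
      (g * (c1 + c2 - c3 - c4) * r23 * r14 * (c2 - c4 - 2 * g) * r24) =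
    g * (1 + g * r12) * r23 * (1 + 2 * g * r14) +
    g * (1 + g * r12) * (g * r24 * r34 + r14 * (1 - g * r24 + g * r34 + g ^ 2 * r24 * r34)) := by
  have n12 : c1 - c2 - g ≠ 0 := right_ne_zero_of_mul_eq_one h12
  have n14 : c1 - c4 - g ≠ 0 := right_ne_zero_of_mul_eq_one h14
  have n23 : c2 - c3 - g ≠ 0 := right_ne_zero_of_mul_eq_one h23
  have n24 : c2 - c4 - g ≠ 0 := right_ne_zero_of_mul_eq_one h24
  have n34 : c3 - c4 - g ≠ 0 := right_ne_zero_of_mul_eq_one h34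
  obtain rfl : r14 = 1 / (c1 - c4 - g) := by rw [eq_div_iff n14, h14]
  obtain rfl : r23 = 1 / (c2 - c3 - g) := by rw [eq_div_iff n23, h23]
  obtain rfl : r24 = 1 / (c2 - c4 - g) := by rw [eq_div_iff n24, h24]
  obtain rfl : r34 = 1 / (c3 - c4 - g) := by rw [eq_div_iff n34, h34]
  have key : (1 + g * (1 / (c3 - c4 - g))) *
      (g * (c1 + c2 - c3 - c4) * (1 / (c2 - c3 - g)) * (1 / (c1 - c4 - g)) * (c2 - c4 - 2 * g) *
        (1 / (c2 - c4 - g))) =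
      g * (1 / (c2 - c3 - g)) * (1 + 2 * g * (1 / (c1 - c4 - g))) +
      g * (g * (1 / (c2 - c4 - g)) * (1 / (c3 - c4 - g)) + (1 / (c1 - c4 - g)) *
        (1 - g * (1 / (c2 - c4 - g)) + g * (1 / (c3 - c4 - g)) +
          g ^ 2 * (1 / (c2 - c4 - g)) * (1 / (c3 - c4 - g)))) := by
    field_simp
    ring
  linear_combination (1 + g * r12) * key

/-- `1 / (c(a) - c(b) - 2γ)`. -/
noncomputable def Rf (γ : ℝ) (a b : ℂ) : ℂ := (cfun a - cfun b - 2 * γ)⁻¹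

/-- `ab / (1 - ab)`. -/
noncomputable def Uf (a b : ℂ) : ℂ := a * b / (1 - a * b)

/-- `w / (1 - w)²`. -/
noncomputable def om (w : ℂ) : ℂ := w / (1 - w) ^ 2

/-- The symmetric weight `e^{tΣε} ω(z₁z₂z₃z₄)`. -/
noncomputable def Wf (t γ : ℝ) (a b c d : ℂ) : ℂ :=
  Complex.exp (t * (epsfun γ a + epsfun γ b + epsfun γ c + epsfun γ d)) * om (a * b * c * d)

@[fun_prop]
theorem DifferentiableAt.Rf {E : Type*} [NormedAddCommGroup E] [NormedSpace ℂ E] {γ : ℝ}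
    {f g : E → ℂ} {x : E} (hf : DifferentiableAt ℂ f x) (hg : DifferentiableAt ℂ g x)
    (hf0 : f x ≠ 0) (hg0 : g x ≠ 0) (h : cfun (f x) - cfun (g x) - 2 * γ ≠ 0) :
    DifferentiableAt ℂ (fun y => Rf γ (f y) (g y)) x := by
  unfold _root_.Rf cfun at *
  fun_prop (disch := assumption)

@[fun_prop]
theorem DifferentiableAt.Uf {E : Type*} [NormedAddCommGroup E] [NormedSpace ℂ E]
    {f g : E → ℂ} {x : E} (hf : DifferentiableAt ℂ f x) (hg : DifferentiableAt ℂ g x)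
    (h : 1 - f x * g x ≠ 0) : DifferentiableAt ℂ (fun y => Uf (f y) (g y)) x := by
  unfold _root_.Uf
  fun_prop (disch := assumption)

@[fun_prop]
theorem DifferentiableAt.om {E : Type*} [NormedAddCommGroup E] [NormedSpace ℂ E]
    {f : E → ℂ} {x : E} (hf : DifferentiableAt ℂ f x)
    (h : 1 - f x ≠ 0) : DifferentiableAt ℂ (fun y => om (f y)) x := by
  unfold _root_.om
  have : (1 - f x) ^ 2 ≠ 0 := pow_ne_zero _ h
  fun_prop (disch := assumption)

@[fun_prop]
theorem DifferentiableAt.cfun {E : Type*} [NormedAddCommGroup E] [NormedSpace ℂ E]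
    {f : E → ℂ} {x : E} (hf : DifferentiableAt ℂ f x)
    (h : f x ≠ 0) : DifferentiableAt ℂ (fun y => cfun (f y)) x := by
  unfold _root_.cfun
  fun_prop (disch := assumption)

@[fun_prop]
theorem DifferentiableAt.epsfun {E : Type*} [NormedAddCommGroup E] [NormedSpace ℂ E] {γ : ℂ}
    {f : E → ℂ} {x : E} (hf : DifferentiableAt ℂ f x)
    (h : f x ≠ 0) : DifferentiableAt ℂ (fun y => epsfun γ (f y)) x := by
  unfold _root_.epsfun
  fun_prop (disch := assumption)

@[fun_prop]
theorem DifferentiableAt.Wf {E : Type*} [NormedAddCommGroup E] [NormedSpace ℂ E] {t γ : ℝ}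
    {f g h k : E → ℂ} {x : E} (hf : DifferentiableAt ℂ f x) (hg : DifferentiableAt ℂ g x)
    (hh : DifferentiableAt ℂ h x) (hk : DifferentiableAt ℂ k x)
    (hf0 : f x ≠ 0) (hg0 : g x ≠ 0) (hh0 : h x ≠ 0) (hk0 : k x ≠ 0)
    (hw : 1 - f x * g x * h x * k x ≠ 0) :
    DifferentiableAt ℂ (fun y => Wf t γ (f y) (g y) (h y) (k y)) x := by
  unfold _root_.Wf
  fun_prop (disch := assumption)

/-- The smallness condition on `r` under which all denominators stay away from zero. -/
def SmallRad (γ r : ℝ) : Prop := 0 < γ ∧ 0 < r ∧ r * (4 * γ + 4) < 1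

theorem SmallRad.lt_one {γ r : ℝ} (h : SmallRad γ r) : r < 1 := by
  obtain ⟨h1, h2, h3⟩ := h
  nlinarith

theorem norm_cfun_le {a : ℂ} : ‖cfun a‖ ≤ (‖a‖ + ‖a‖⁻¹) / 2 := by
  rw [cfun, norm_div, ← norm_inv]
  simp only [Complex.norm_ofNat]
  gcongr
  exact norm_add_le _ _

theorem le_norm_cfun {a : ℂ} : (‖a‖⁻¹ - ‖a‖) / 2 ≤ ‖cfun a‖ := by
  rw [cfun, norm_div, ← norm_inv]
  simp only [Complex.norm_ofNat]
  gcongr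
  rw [add_comm]
  exact norm_sub_le_norm_add _ _

theorem Rf_ne {γ r : ℝ} (h : SmallRad γ r) {a b : ℂ} (ha : 0 < ‖a‖) (hb : 0 < ‖b‖)
    (hab : ‖a‖ ≤ r * ‖b‖) (hab' : ‖a‖ * ‖b‖ ≤ r) : cfun a - cfun b - 2 * γ ≠ 0 := by
  obtain ⟨h1, h2, h3⟩ := h
  intro h0
  have e : cfun a = cfun b + 2 * γ := by linear_combination h0
  have h4 : ‖cfun a‖ ≤ ‖cfun b‖ + 2 * γ := by
    rw [e]
    refine (norm_add_le _ _).trans ?_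
    simp [abs_of_pos h1]
  have h5 := (le_norm_cfun (a := a)).trans (h4.trans (add_le_add_left norm_cfun_le _))
  have h6 : ‖b‖ ≤ r * ‖a‖⁻¹ := by
    rw [← div_eq_mul_inv, le_div_iff₀ ha]; linarith
  have h7 : ‖b‖⁻¹ ≤ r * ‖a‖⁻¹ := by
    rw [← div_eq_mul_inv, inv_le_comm₀ hb (by positivity), inv_div]
    rw [div_le_iff₀ h2]; linarith
  have h8 : ‖a‖ ≤ r := by
    have : ‖a‖ * ‖a‖ ≤ r * r := by nlinarith
    nlinarith
  have h9 : r⁻¹ ≤ ‖a‖⁻¹ := inv_anti₀ ha h8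
  have h10 : 4 * γ + 4 < r⁻¹ := by
    rw [lt_inv_comm₀ (by positivity) h2, ← one_div, lt_div_iff₀ (by positivity)]; exact h3
  have h11 : r * r⁻¹ = 1 := mul_inv_cancel₀ h2.ne'
  have h12 : r < 1 := by nlinarith
  have : ‖a‖⁻¹ * (1 - 2 * r) ≤ r + 4 * γ := by linarith
  have : r⁻¹ * (1 - 2 * r) ≤ ‖a‖⁻¹ * (1 - 2 * r) := by
    apply mul_le_mul_of_nonneg_right h9
    nlinarith
  nlinarith

section

variable {γ r : ℝ} (h : SmallRad γ r)
include h

theorem SmallRad.ne_zero {i : ℕ} {a : ℂ} (ha : r ^ i ≤ ‖a‖) : a ≠ 0 := by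
  rintro rfl
  have := pow_pos h.2.1 i
  simp at ha
  linarith

theorem SmallRad.Rf_ne {i i' j k : ℕ} {a b : ℂ} (ha : r ^ i' ≤ ‖a‖) (ha' : ‖a‖ ≤ r ^ i)
    (hb : r ^ j ≤ ‖b‖) (hb' : ‖b‖ ≤ r ^ k) (h1 : j + 1 ≤ i) (h2 : 1 ≤ i + k) :
    cfun a - cfun b - 2 * γ ≠ 0 := by
  have h0 := h.2.1
  have hl := h.lt_one.le
  refine _root_.Rf_ne h (norm_pos_iff.2 (h.ne_zero ha)) (norm_pos_iff.2 (h.ne_zero hb)) ?_ ?_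
  · calc ‖a‖ ≤ r ^ i := ha'
      _ ≤ r ^ (j + 1) := pow_le_pow_of_le_one h0.le hl h1
      _ = r * r ^ j := by ring
      _ ≤ r * ‖b‖ := by gcongr
  · calc ‖a‖ * ‖b‖ ≤ r ^ i * r ^ k := by gcongr
      _ = r ^ (i + k) := by ring
      _ ≤ r ^ 1 := pow_le_pow_of_le_one h0.le hl h2
      _ = r := pow_one r

theorem SmallRad.Uf_ne {i k : ℕ} {a b : ℂ} (ha : ‖a‖ ≤ r ^ i) (hb : ‖b‖ ≤ r ^ k) (h2 : 1 ≤ i + k) :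
    1 - a * b ≠ 0 := by
  have h0 := h.2.1
  have hl := h.lt_one
  intro h3
  have : ‖a * b‖ = 1 := by rw [← sub_eq_zero.1 h3]; simp
  rw [norm_mul] at this
  have : ‖a‖ * ‖b‖ ≤ r := calc
    ‖a‖ * ‖b‖ ≤ r ^ i * r ^ k := by gcongr
      _ = r ^ (i + k) := by ring
      _ ≤ r ^ 1 := pow_le_pow_of_le_one h0.le hl.le h2
      _ = r := pow_one r
  linarith

theorem SmallRad.Wf_ne {i j k l : ℕ} {a b c d : ℂ} (ha : ‖a‖ ≤ r ^ i) (hb : ‖b‖ ≤ r ^ j)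
    (hc : ‖c‖ ≤ r ^ k) (hd : ‖d‖ ≤ r ^ l) (h2 : 1 ≤ i + j + k + l) :
    1 - a * b * c * d ≠ 0 := by
  have h0 := h.2.1
  refine h.Uf_ne (i := i + j + k) (k := l) ?_ hd h2
  calc ‖a * b * c‖ = ‖a‖ * ‖b‖ * ‖c‖ := by simp
    _ ≤ r ^ i * r ^ j * r ^ k := by gcongr
    _ = _ := by ring

end

theorem Rf_mul {γ : ℝ} {a b : ℂ} (h : cfun a - cfun b - 2 * γ ≠ 0) :
    Rf γ a b * (cfun a - cfun b - 2 * γ) = 1 := inv_mul_cancel₀ h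

theorem Uf_rel {a b c : ℂ} (ha : a ≠ 0) (hb : b ≠ 0) (hc : c ≠ 0) (hab : 1 - a * b ≠ 0)
    (hac : 1 - a * c ≠ 0) (hbc : 1 - b * c ≠ 0) :
    (cfun a - cfun b) * Uf a b + (cfun b - cfun c) * Uf b c = (cfun a - cfun c) * Uf a c := by
  unfold cfun Uf
  field_simp
  ring

/-- The `3 ↔ 4` generator. -/
noncomputable def G34 (t γ : ℝ) (a b c d : ℂ) : ℂ :=
  Wf t γ a b c d * (2 * γ * Uf a b ^ 2 * (1 + 2 * γ * Rf γ a b) * Rf γ b c *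
    (1 + 2 * (2 * γ) * Rf γ a d) + 2 * (2 * γ) ^ 2 * Uf a b ^ 2 * Rf γ a b * Rf γ a d +
    2 * (2 * γ) * Uf a b ^ 2 * Rf γ a d)

/-- The `1 ↔ 2` generator. -/
noncomputable def G12 (t γ : ℝ) (a b c d : ℂ) : ℂ :=
  Wf t γ a b c d * ((2 * γ) ^ 2 * Uf a b ^ 2 * Rf γ a d * Rf γ c d +
    2 * (2 * γ) * Uf a b * Uf b c * Rf γ c d + 2 * γ * Uf a b ^ 2 * Rf γ b d -
    2 * (2 * γ) * Uf a b * Uf b c * Rf γ b d)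

/-- The `2 ↔ 3` antisymmetric remainder. -/
noncomputable def G23 (t γ : ℝ) (a b c d : ℂ) : ℂ :=
  Wf t γ a b c d * remTerm (2 * γ) (cfun a - cfun d - 2 * (2 * γ)) (Rf γ a b) (Rf γ a c)
    (Rf γ a d) (Rf γ b d) (Rf γ c d) (Uf a b) (Uf a c) (Uf b c)

/-- The reduced integrand of `q2`. -/
noncomputable def G1 (t γ : ℝ) (a b c d : ℂ) : ℂ :=
  Wf t γ a b c d * ((1 + 2 * γ * Rf γ a b) * (1 + 2 * γ * Rf γ c d) *
    (Uf a b * Uf c d + Uf a b ^ 2 - 2 * Uf a b * Uf a c + 2 * Uf a c * Uf b c -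
      2 * Uf a b * Uf b c))

section

variable {γ r : ℝ} (h : SmallRad γ r) (t : ℝ)
include h

theorem reg_G34 : Reg4 (G34 t γ) (r ^ 3) (r ^ 3) (r ^ 2) (r ^ 2) (r ^ 1) (r ^ 0) (r ^ 1) (r ^ 0) := by
  intro a b c d ha ha' hb hb' hc hc' hd hd'
  have n1 := h.ne_zero ha
  have n2 := h.ne_zero hb
  have n3 := h.ne_zero hc
  have n4 := h.ne_zero hd
  have r12 := h.Rf_ne ha ha' hb hb' (by norm_num) (by norm_num)
  have r14 := h.Rf_ne ha ha' hd hd' (by norm_num) (by norm_num)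
  have r23 := h.Rf_ne hb hb' hc hc' (by norm_num) (by norm_num)
  have u12 := h.Uf_ne ha' hb' (by norm_num)
  have w := h.Wf_ne ha' hb' hc' hd' (by norm_num)
  unfold G34
  fun_prop (disch := assumption)

theorem reg_G12 : Reg4 (G12 t γ) (r ^ 3) (r ^ 2) (r ^ 3) (r ^ 2) (r ^ 1) (r ^ 1) (r ^ 0) (r ^ 0) := by
  intro a b c d ha ha' hb hb' hc hc' hd hd'
  have n1 := h.ne_zero ha
  have n2 := h.ne_zero hb
  have n3 := h.ne_zero hc
  have n4 := h.ne_zero hd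
  have r14 := h.Rf_ne ha ha' hd hd' (by norm_num) (by norm_num)
  have r24 := h.Rf_ne hb hb' hd hd' (by norm_num) (by norm_num)
  have r34 := h.Rf_ne hc hc' hd hd' (by norm_num) (by norm_num)
  have u12 := h.Uf_ne ha' hb' (by norm_num)
  have u23 := h.Uf_ne hb' hc' (by norm_num)
  have w := h.Wf_ne ha' hb' hc' hd' (by norm_num)
  unfold G12
  fun_prop (disch := assumption)

theorem reg_G23 : Reg4 (G23 t γ) (r ^ 3) (r ^ 3) (r ^ 2) (r ^ 1) (r ^ 2) (r ^ 1) (r ^ 0) (r ^ 0) := by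
  intro a b c d ha ha' hb hb' hc hc' hd hd'
  have n1 := h.ne_zero ha
  have n2 := h.ne_zero hb
  have n3 := h.ne_zero hc
  have n4 := h.ne_zero hd
  have r12 := h.Rf_ne ha ha' hb hb' (by norm_num) (by norm_num)
  have r13 := h.Rf_ne ha ha' hc hc' (by norm_num) (by norm_num)
  have r14 := h.Rf_ne ha ha' hd hd' (by norm_num) (by norm_num)
  have r24 := h.Rf_ne hb hb' hd hd' (by norm_num) (by norm_num)
  have r34 := h.Rf_ne hc hc' hd hd' (by norm_num) (by norm_num)
  have u12 := h.Uf_ne ha' hb' (by norm_num)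
  have u13 := h.Uf_ne ha' hc' (by norm_num)
  have u23 := h.Uf_ne hb' hc' (by norm_num)
  have w := h.Wf_ne ha' hb' hc' hd' (by norm_num)
  unfold G23 remTerm
  fun_prop (disch := assumption)

theorem reg_G1 : Reg4 (G1 t γ) (r ^ 3) (r ^ 3) (r ^ 2) (r ^ 2) (r ^ 1) (r ^ 1) (r ^ 0) (r ^ 0) := by
  intro a b c d ha ha' hb hb' hc hc' hd hd'
  have n1 := h.ne_zero ha
  have n2 := h.ne_zero hb
  have n3 := h.ne_zero hc
  have n4 := h.ne_zero hd
  have r12 := h.Rf_ne ha ha' hb hb' (by norm_num) (by norm_num)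
  have r34 := h.Rf_ne hc hc' hd hd' (by norm_num) (by norm_num)
  have u12 := h.Uf_ne ha' hb' (by norm_num)
  have u13 := h.Uf_ne ha' hc' (by norm_num)
  have u23 := h.Uf_ne hb' hc' (by norm_num)
  have u34 := h.Uf_ne hc' hd' (by norm_num)
  have w := h.Wf_ne ha' hb' hc' hd' (by norm_num)
  unfold G1
  fun_prop (disch := assumption)

theorem q2_reduced : q2 γ r t = cint4 (r ^ 3) (r ^ 2) (r ^ 1) (r ^ 0) (G1 t γ) := by
  have p3 := pow_pos h.2.1 3
  have p2 := pow_pos h.2.1 2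
  have p1 := pow_pos h.2.1 1
  have p0 := pow_pos h.2.1 0
  have hl := h.lt_one.le
  have l34 : r ^ 1 ≤ r ^ 0 := pow_le_pow_of_le_one h.2.1.le hl (by norm_num)
  have l23 : r ^ 2 ≤ r ^ 1 := pow_le_pow_of_le_one h.2.1.le hl (by norm_num)
  have l12 : r ^ 3 ≤ r ^ 2 := pow_le_pow_of_le_one h.2.1.le hl (by norm_num)
  have s1 : cint4 (r ^ 3) (r ^ 2) (r ^ 1) (r ^ 0) (fun a b c d => G23 t γ a b c d) = 0 := by
    have := cint4_antisymm23 p3 p2 p1 p0 l23 (reg_G23 h t)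
    have e : cint4 (r ^ 3) (r ^ 2) (r ^ 1) (r ^ 0) (fun a b c d => 2 * G23 t γ a b c d) =
        cint4 (r ^ 3) (r ^ 2) (r ^ 1) (r ^ 0) (fun a b c d => G23 t γ a b c d - G23 t γ a c b d) := by
      refine cint4_congr p3 p2 p1 p0 fun a b c d ha hb hc hd => ?_
      have n1 := h.ne_zero ha.ge
      have n2 := h.ne_zero hb.ge
      have n3 := h.ne_zero hc.ge
      have n4 := h.ne_zero hd.ge
      have r12 := h.Rf_ne ha.ge ha.le hb.ge hb.le (by norm_num) (by norm_num)
      have r13 := h.Rf_ne ha.ge ha.le hc.ge hc.le (by norm_num) (by norm_num)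
      have r14 := h.Rf_ne ha.ge ha.le hd.ge hd.le (by norm_num) (by norm_num)
      have r24 := h.Rf_ne hb.ge hb.le hd.ge hd.le (by norm_num) (by norm_num)
      have r34 := h.Rf_ne hc.ge hc.le hd.ge hd.le (by norm_num) (by norm_num)
      have u12 := h.Uf_ne ha.le hb.le (by norm_num)
      have u13 := h.Uf_ne ha.le hc.le (by norm_num)
      have u23 := h.Uf_ne hb.le hc.le (by norm_num)
      have key := remTerm_antisymm (Rf_mul r12) (Rf_mul r13) (Rf_mul r14) (Rf_mul r24)
        (Rf_mul r34) (Uf_rel n1 n2 n3 u12 u13 u23)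
      have ws : Wf t γ a c b d = Wf t γ a b c d := by unfold Wf; congr 2 <;> ring_nf
      have us : Uf c b = Uf b c := by unfold Uf; rw [mul_comm]
      unfold G23
      rw [ws, us]
      linear_combination (Wf t γ a b c d) * key
    rw [cint4_const_mul p3 p2 p1 p0, this] at e
    simpa using e
  have s2 := cint4_antisymm34 p3 p2 p1 p0 l34 (reg_G34 h t)
  have s3 := cint4_antisymm12 p3 p2 p1 p0 l12 (reg_G12 h t)
  have g1 := reg_G1 h t
  have g23 := (reg_G23 h t).mono le_rfl le_rfl le_rfl l23 l23 le_rfl le_rfl le_rfl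
  have g34 := ((reg_G34 h t).mono le_rfl le_rfl le_rfl le_rfl le_rfl l34 l34 le_rfl).sub
    ((reg_G34 h t).swap34.mono le_rfl le_rfl le_rfl le_rfl le_rfl l34 l34 le_rfl)
  have g12 := ((reg_G12 h t).mono le_rfl l12 l12 le_rfl le_rfl le_rfl le_rfl le_rfl).sub
    ((reg_G12 h t).swap12.mono le_rfl l12 l12 le_rfl le_rfl le_rfl le_rfl le_rfl)
  have big := cint4_add p3 p2 p1 p0 (g1.add g23) (g34.add g12)
  rw [cint4_add p3 p2 p1 p0 g1 g23, cint4_add p3 p2 p1 p0 g34 g12, s1, s2, s3, add_zero, add_zero,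
    add_zero] at big
  rw [← big]
  rw [pow_one, pow_zero]
  change cint4 (r ^ 3) (r ^ 2) r 1 _ = _
  refine cint4_congr p3 p2 h.2.1 one_pos fun a b c d ha hb hc hd => ?_
  rw [← pow_one r] at hc
  rw [← pow_zero r] at hd
  have n1 := h.ne_zero ha.ge
  have n2 := h.ne_zero hb.ge
  have n3 := h.ne_zero hc.ge
  have n4 := h.ne_zero hd.ge
  have r12 := Rf_mul (h.Rf_ne ha.ge ha.le hb.ge hb.le (by norm_num) (by norm_num))
  have r13 := Rf_mul (h.Rf_ne ha.ge ha.le hc.ge hc.le (by norm_num) (by norm_num))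
  have r14 := Rf_mul (h.Rf_ne ha.ge ha.le hd.ge hd.le (by norm_num) (by norm_num))
  have r23 := Rf_mul (h.Rf_ne hb.ge hb.le hc.ge hc.le (by norm_num) (by norm_num))
  have r24 := Rf_mul (h.Rf_ne hb.ge hb.le hd.ge hd.le (by norm_num) (by norm_num))
  have r34 := Rf_mul (h.Rf_ne hc.ge hc.le hd.ge hd.le (by norm_num) (by norm_num))
  have ws1 : Wf t γ a b d c = Wf t γ a b c d := by unfold Wf; congr 2 <;> ring_nf
  have ws2 : Wf t γ b a c d = Wf t γ a b c d := by unfold Wf; congr 2 <;> ring_nf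
  have us : Uf b a = Uf a b := by unfold Uf; rw [mul_comm]
  have key := A2_split r12 r14 r23 r24 r34
  have f : ∀ {x y : ℂ}, Rf γ x y * (cfun x - cfun y - 2 * γ) = 1 →
      (cfun x - cfun y) / (cfun x - cfun y - 2 * γ) = 1 + 2 * γ * Rf γ x y := by
    intro x y hxy
    rw [div_eq_mul_inv, show (cfun x - cfun y - 2 * γ)⁻¹ = Rf γ x y from rfl]
    linear_combination hxy
  unfold A1 A2
  rw [f r12, f r34, f r13, f r24]
  rw [show Complex.exp (t * (epsfun γ a + epsfun γ b + epsfun γ c + epsfun γ d)) *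
      (a * b * c * d / (1 - a * b * c * d) ^ 2) = Wf t γ a b c d from rfl,
    show a * b / (1 - a * b) = Uf a b from rfl, show a * c / (1 - a * c) = Uf a c from rfl,
    show c * d / (1 - c * d) = Uf c d from rfl]
  unfold G1 G23 G34 G12
  rw [ws1, ws2, us]
  simp only [div_eq_mul_inv, mul_inv]
  simp only [show (cfun b - cfun c - 2 * (γ : ℂ))⁻¹ = Rf γ b c from rfl,
    show (cfun a - cfun d - 2 * (γ : ℂ))⁻¹ = Rf γ a d from rfl,
    show (cfun b - cfun d - 2 * (γ : ℂ))⁻¹ = Rf γ b d from rfl]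
  unfold remTerm
  generalize Wf t γ a b c d = W at *
  generalize Uf a b = U at *
  generalize Uf a c = X at *
  generalize Uf c d = V at *
  generalize Uf b c = Y at *
  generalize Uf a c = X at *
  linear_combination (W * U ^ 2) * key

end

/-- The integrand of `q1`. -/
noncomputable def Kf (t γ : ℝ) (a b : ℂ) : ℂ :=
  Complex.exp (t * (epsfun γ a + epsfun γ b)) * (1 + 2 * γ * Rf γ a b) * om (a * b)

/-- The part of the reduced integrand that is antisymmetric under `(13)(24)`. -/
noncomputable def GA (t γ : ℝ) (a b c d : ℂ) : ℂ :=
  Wf t γ a b c d * ((1 + 2 * γ * Rf γ a b) * (1 + 2 * γ * Rf γ c d) *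
    ((Uf a b ^ 2 + 2 * Uf a b) - (Uf c d ^ 2 + 2 * Uf c d)))

/-- The negligible part of the reduced integrand. -/
noncomputable def GN (t γ : ℝ) (a b c d : ℂ) : ℂ :=
  Wf t γ a b c d * ((1 + 2 * γ * Rf γ c d) *
    (1 + (2 * γ + 2 * ((c - a) / (1 - a * c))) * Rf γ a b))

/-- The main part of the reduced integrand. -/
noncomputable def GJ (t γ : ℝ) (a b c d : ℂ) : ℂ :=
  Wf t γ a b c d * (Rf γ a b * (1 + 2 * γ * Rf γ c d) * ((b - c) / (1 - b * c)))

section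

variable {γ r : ℝ} (h : SmallRad γ r) (t : ℝ)
include h

theorem q1_eq : q1 γ r t = cint r fun a => cint 1 fun b => Kf t γ a b := by
  refine cint_congr h.2.1 fun a ha => cint_congr one_pos fun b hb => ?_
  rw [← pow_one r] at ha
  rw [← pow_zero r] at hb
  have r12 := Rf_mul (h.Rf_ne ha.ge ha.le hb.ge hb.le (by norm_num) (by norm_num))
  have e : (cfun a - cfun b) / (cfun a - cfun b - 2 * γ) = 1 + 2 * γ * Rf γ a b := by
    rw [div_eq_mul_inv, show (cfun a - cfun b - 2 * γ)⁻¹ = Rf γ a b from rfl]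
    linear_combination r12
  rw [e]
  rfl

theorem diff_Kf {i j : ℕ} {i' : ℕ} (hi : j + 1 ≤ i) {k : ℕ}
    {a b : ℂ} (ha : r ^ i' ≤ ‖a‖) (ha' : ‖a‖ ≤ r ^ i) (hb : r ^ j ≤ ‖b‖) (hb' : ‖b‖ ≤ r ^ k)
    {E : Type*} [NormedAddCommGroup E] [NormedSpace ℂ E] {f g : E → ℂ} {x : E}
    (hf : DifferentiableAt ℂ f x) (hg : DifferentiableAt ℂ g x) (hfa : f x = a) (hgb : g x = b) :
    DifferentiableAt ℂ (fun y => Kf t γ (f y) (g y)) x := by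
  subst hfa hgb
  have n1 := h.ne_zero ha
  have n2 := h.ne_zero hb
  have r12 := h.Rf_ne ha ha' hb hb' hi (by omega)
  have u := h.Uf_ne ha' hb' (by omega)
  unfold Kf
  fun_prop (disch := assumption)

theorem q1_eq' : q1 γ r t = cint (r ^ 3) fun a => cint (r ^ 2) fun b => Kf t γ a b := by
  have p3 := pow_pos h.2.1 3
  have p2 := pow_pos h.2.1 2
  have hr := h.2.1
  have hl := h.lt_one.le
  have e1 : r ^ 1 = r := pow_one r
  have e0 : r ^ 0 = 1 := pow_zero r
  have hcont : ∀ {ρ : ℝ}, r ^ 3 ≤ ρ → ρ ≤ r → 0 < ρ → Continuous fun p : ℝ × ℝ =>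
      Kf t γ (circleMap 0 ρ p.1) (circleMap 0 1 p.2) := fun {ρ} h1 h2 h3 => by
    have hc : Continuous fun p : ℝ × ℝ => (circleMap 0 ρ p.1, circleMap 0 1 p.2) := by fun_prop
    refine continuous_iff_continuousAt.2 fun p => ?_
    have := diff_Kf h t (i := 1) (j := 0) (i' := 3) (k := 0) (by simp)
      (a := circleMap 0 ρ p.1) (b := circleMap 0 1 p.2)
      (by rw [norm_circleMap_pos h3]; exact h1) (by rw [norm_circleMap_pos h3, e1]; exact h2)
      (by simp) (by simp)
      (f := fun q : ℂ × ℂ => q.1) (g := fun q : ℂ × ℂ => q.2)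
      (x := (circleMap 0 ρ p.1, circleMap 0 1 p.2)) (by fun_prop) (by fun_prop) rfl rfl
    exact ContinuousAt.comp (f := fun p : ℝ × ℝ => (circleMap 0 ρ p.1, circleMap 0 1 p.2))
      this.continuousAt hc.continuousAt
  have hle3 : r ^ 3 ≤ r := by
    calc r ^ 3 ≤ r ^ 1 := pow_le_pow_of_le_one hr.le hl (by norm_num)
      _ = r := e1
  rw [q1_eq h, cint_comm hr one_pos (hcont hle3 le_rfl hr)]
  have : (cint 1 fun b => cint r fun a => Kf t γ a b) =
      cint 1 fun b => cint (r ^ 3) fun a => Kf t γ a b := by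
    refine cint_congr one_pos fun b hb => (cint_radius p3 hle3 fun a ha ha' => ?_).symm
    exact diff_Kf h t (i := 1) (j := 0) (i' := 3) (k := 0) (by simp) (a := a) (b := b)
      ha (by rw [e1]; exact ha') (by rw [e0, hb]) (by rw [e0, hb]) differentiableAt_fun_id
      (differentiableAt_const b) rfl rfl
  rw [this, ← cint_comm p3 one_pos (hcont le_rfl hle3 p3)]
  refine cint_congr p3 fun a ha => (cint_radius p2 (pow_le_one₀ hr.le hl) fun b hb hb' => ?_).symm
  exact diff_Kf h t (i := 3) (j := 2) (i' := 3) (k := 0) (by simp) (a := a) (b := b)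
    ha.ge ha.le hb (by rw [e0]; exact hb') (differentiableAt_const a) differentiableAt_fun_id rfl rfl

theorem q1_sq : q1 γ r t ^ 2 = cint4 (r ^ 3) (r ^ 2) (r ^ 1) (r ^ 0)
    (fun a b c d => Kf t γ a b * Kf t γ c d) := by
  have p3 := pow_pos h.2.1 3
  have p2 := pow_pos h.2.1 2
  have p1 := pow_pos h.2.1 1
  have p0 := pow_pos h.2.1 0
  rw [sq]
  nth_rewrite 1 [q1_eq' h]
  rw [q1_eq h]
  rw [pow_one, pow_zero, cint4, ← cint_mul_const p3]
  refine cint_congr p3 fun a _ => ?_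
  rw [← cint_mul_const p2]
  refine cint_congr p2 fun b _ => ?_
  rw [← cint_const_mul h.2.1]
  refine cint_congr h.2.1 fun c _ => ?_
  rw [← cint_const_mul one_pos]

theorem reg_GA : Reg4 (GA t γ) (r ^ 3) (r ^ 3) (r ^ 2) (r ^ 0) (r ^ 1) (r ^ 1) (r ^ 0) (r ^ 0) := by
  intro a b c d ha ha' hb hb' hc hc' hd hd'
  have n1 := h.ne_zero ha
  have n2 := h.ne_zero hb
  have n3 := h.ne_zero hc
  have n4 := h.ne_zero hd
  have r12 := h.Rf_ne ha ha' hb hb' (by norm_num) (by norm_num)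
  have r34 := h.Rf_ne hc hc' hd hd' (by norm_num) (by norm_num)
  have u12 := h.Uf_ne ha' hb' (by norm_num)
  have u34 := h.Uf_ne hc' hd' (by norm_num)
  have w := h.Wf_ne ha' hb' hc' hd' (by norm_num)
  unfold GA
  fun_prop (disch := assumption)

theorem reg_GA' : Reg4 (GA t γ) (r ^ 3) (r ^ 1) (r ^ 0) (r ^ 0) (r ^ 1) (r ^ 1) (r ^ 0) (r ^ 0) := by
  intro a b c d ha ha' hb hb' hc hc' hd hd'
  have n1 := h.ne_zero ha
  have n2 := h.ne_zero hb
  have n3 := h.ne_zero hc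
  have n4 := h.ne_zero hd
  have r12 := h.Rf_ne ha ha' hb hb' (by norm_num) (by norm_num)
  have r34 := h.Rf_ne hc hc' hd hd' (by norm_num) (by norm_num)
  have u12 := h.Uf_ne ha' hb' (by norm_num)
  have u34 := h.Uf_ne hc' hd' (by norm_num)
  have w := h.Wf_ne ha' hb' hc' hd' (by norm_num)
  unfold GA
  fun_prop (disch := assumption)

theorem reg_GN : Reg4 (GN t γ) (r ^ 3) (r ^ 3) (r ^ 2) (r ^ 2) (r ^ 1) (r ^ 1) (r ^ 0) (r ^ 0) := by
  intro a b c d ha ha' hb hb' hc hc' hd hd'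
  have n1 := h.ne_zero ha
  have n2 := h.ne_zero hb
  have n3 := h.ne_zero hc
  have n4 := h.ne_zero hd
  have r12 := h.Rf_ne ha ha' hb hb' (by norm_num) (by norm_num)
  have r34 := h.Rf_ne hc hc' hd hd' (by norm_num) (by norm_num)
  have u13 := h.Uf_ne ha' hc' (by norm_num)
  have w := h.Wf_ne ha' hb' hc' hd' (by norm_num)
  unfold GN
  fun_prop (disch := assumption)

theorem reg_GJ : Reg4 (GJ t γ) (r ^ 3) (r ^ 3) (r ^ 2) (r ^ 2) (r ^ 1) (r ^ 1) (r ^ 0) (r ^ 0) := by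
  intro a b c d ha ha' hb hb' hc hc' hd hd'
  have n1 := h.ne_zero ha
  have n2 := h.ne_zero hb
  have n3 := h.ne_zero hc
  have n4 := h.ne_zero hd
  have r12 := h.Rf_ne ha ha' hb hb' (by norm_num) (by norm_num)
  have r34 := h.Rf_ne hc hc' hd hd' (by norm_num) (by norm_num)
  have u23 := h.Uf_ne hb' hc' (by norm_num)
  have w := h.Wf_ne ha' hb' hc' hd' (by norm_num)
  unfold GJ
  fun_prop (disch := assumption)

theorem cint4_GA : cint4 (r ^ 3) (r ^ 2) (r ^ 1) (r ^ 0) (GA t γ) = 0 := by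
  have p3 := pow_pos h.2.1 3
  have p2 := pow_pos h.2.1 2
  have p1 := pow_pos h.2.1 1
  have p0 := pow_pos h.2.1 0
  have hl := h.lt_one.le
  have l02 : r ^ 2 ≤ r ^ 0 := pow_le_pow_of_le_one h.2.1.le hl (by norm_num)
  have l13 : r ^ 3 ≤ r ^ 1 := pow_le_pow_of_le_one h.2.1.le hl (by norm_num)
  rw [cint4_radius2 p3 p2 p1 p0 l02 (reg_GA h t), cint4_radius1 p3 p0 p1 p0 l13 (reg_GA' h t)]
  have hr := (reg_GA' h t).mono l13 le_rfl le_rfl le_rfl le_rfl le_rfl le_rfl le_rfl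
  have e := cint4_swap23 p1 p0 p1 p0 hr
  rw [cint4_swap12 p1 p1 p0 p0 hr.swap23, cint4_swap34 p1 p1 p0 p0 hr.swap23.swap12,
    cint4_swap23 p1 p1 p0 p0 hr.swap23.swap12.swap34] at e
  have e2 : cint4 (r ^ 1) (r ^ 0) (r ^ 1) (r ^ 0) (fun a b c d => GA t γ c d a b) =
      cint4 (r ^ 1) (r ^ 0) (r ^ 1) (r ^ 0) (fun a b c d => (-1) * GA t γ a b c d) := by
    congr 1; ext a b c d
    have ws : Wf t γ c d a b = Wf t γ a b c d := by unfold Wf; congr 2 <;> ring_nf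
    unfold GA
    rw [ws]; ring
  rw [cint4_const_mul p1 p0 p1 p0] at e2
  have e3 := e.trans e2
  linear_combination e3 / 2

theorem two_q2_sub_q1_sq : 2 * q2 γ r t - q1 γ r t ^ 2 =
    - cint4 (r ^ 3) (r ^ 2) (r ^ 1) (r ^ 0) (GN t γ) -
      2 * cint4 (r ^ 3) (r ^ 2) (r ^ 1) (r ^ 0) (GJ t γ) := by
  have p3 := pow_pos h.2.1 3
  have p2 := pow_pos h.2.1 2
  have p1 := pow_pos h.2.1 1
  have p0 := pow_pos h.2.1 0
  have hl := h.lt_one.le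
  have l02 : r ^ 2 ≤ r ^ 0 := pow_le_pow_of_le_one h.2.1.le hl (by norm_num)
  have g1 := reg_G1 h t
  have gn := reg_GN h t
  have gj := reg_GJ h t
  have ga := (reg_GA h t).mono le_rfl le_rfl le_rfl l02 le_rfl le_rfl le_rfl le_rfl
  have e : cint4 (r ^ 3) (r ^ 2) (r ^ 1) (r ^ 0) (fun a b c d => Kf t γ a b * Kf t γ c d) =
      cint4 (r ^ 3) (r ^ 2) (r ^ 1) (r ^ 0) (fun a b c d =>
        (2 * G1 t γ a b c d - GA t γ a b c d) + (GN t γ a b c d + 2 * GJ t γ a b c d)) := by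
    refine cint4_congr p3 p2 p1 p0 fun a b c d ha hb hc hd => ?_
    have n1 := h.ne_zero ha.ge
    have n2 := h.ne_zero hb.ge
    have n3 := h.ne_zero hc.ge
    have n4 := h.ne_zero hd.ge
    have r12 := Rf_mul (h.Rf_ne ha.ge ha.le hb.ge hb.le (by norm_num) (by norm_num))
    have u12 := h.Uf_ne ha.le hb.le (by norm_num)
    have u13 := h.Uf_ne ha.le hc.le (by norm_num)
    have u23 := h.Uf_ne hb.le hc.le (by norm_num)
    have u34 := h.Uf_ne hc.le hd.le (by norm_num)
    have w := h.Wf_ne ha.le hb.le hc.le hd.le (by norm_num)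
    have e1 : om (a * b) * om (c * d) =
        om (a * b * c * d) * (1 + Uf a b + Uf c d) ^ 2 := by
      unfold om Uf
      field_simp
      ring
    have e2 : (cfun a - cfun b) * (1 + 4 * Uf a b + 4 * Uf a b * Uf a c - 4 * Uf a c * Uf b c +
        4 * Uf a b * Uf b c) = (cfun a - cfun b) + 2 * ((c - a) / (1 - a * c)) +
          2 * ((b - c) / (1 - b * c)) := by
      unfold cfun Uf
      field_simp
      ring
    have e3 : Complex.exp (t * (epsfun γ a + epsfun γ b + epsfun γ c + epsfun γ d)) =
        Complex.exp (t * (epsfun γ a + epsfun γ b)) * Complex.exp (t * (epsfun γ c + epsfun γ d)) := by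
      rw [← Complex.exp_add]; congr 1; ring
    unfold Kf G1 GA GN GJ Wf
    rw [e3]
    generalize Complex.exp (t * (epsfun γ a + epsfun γ b)) = E1
    generalize Complex.exp (t * (epsfun γ c + epsfun γ d)) = E2
    generalize om (a * b * c * d) = W at *
    generalize om (a * b) = W1 at *
    generalize om (c * d) = W2 at *
    generalize (c - a) / (1 - a * c) = m1 at *
    generalize (b - c) / (1 - b * c) = m2 at *
    generalize Uf a b = U at *
    generalize Uf a c = X at *
    generalize Uf c d = V at *
    generalize Uf b c = Y at *
    generalize Rf γ a b = R at *
    generalize Rf γ c d = S at *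
    linear_combination E1 * E2 * (1 + 2 * γ * R) * (1 + 2 * γ * S) * e1 +
      E1 * E2 * W * (1 + 2 * γ * S) * R * e2 +
      E1 * E2 * W * (1 + 2 * γ * S) * (1 - (1 + 4 * U + 4 * U * X - 4 * X * Y + 4 * U * Y)) * r12
  rw [q1_sq h, e, q2_reduced h,
    cint4_add p3 p2 p1 p0 ((g1.const_mul 2).sub ga) (gn.add (gj.const_mul 2)),
    cint4_sub p3 p2 p1 p0 (g1.const_mul 2) ga, cint4_add p3 p2 p1 p0 gn (gj.const_mul 2),
    cint4_const_mul p3 p2 p1 p0, cint4_const_mul p3 p2 p1 p0, cint4_GA h]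
  ring

end

theorem epsfun_inv {γ : ℝ} {a b c d : ℂ} (hb : b = c⁻¹) :
    epsfun γ a + epsfun γ b + epsfun γ c + epsfun γ d = epsfun γ a + epsfun γ d - 4 * γ := by
  subst hb
  simp only [epsfun, inv_inv]
  ring

theorem cfun_inv (c : ℂ) : cfun c⁻¹ = cfun c := by
  simp only [cfun, inv_inv, add_comm]

/-- The residue of `GJ` at `b = 1/c`. -/
noncomputable def GY (t γ : ℝ) (a c d : ℂ) : ℂ :=
  Complex.exp (t * (epsfun γ a + epsfun γ d - 4 * γ)) * om (a * d) *
    ((c⁻¹ - c) * (Rf γ a c * (1 + 2 * γ * Rf γ c d)))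

/-- The integrand left after integrating `GY` over `c`. -/
noncomputable def GY2 (t γ : ℝ) (a d : ℂ) : ℂ :=
  Complex.exp (t * (epsfun γ a + epsfun γ d - 4 * γ)) * om (a * d) *
    (4 * γ / (cfun a - cfun d - 4 * γ))

theorem cint_antisymm_inv {r : ℝ} (hr : 0 < r) (hr1 : r ≤ 1) {f : ℂ → ℂ}
    (hf : ∀ z, r ≤ ‖z‖ → ‖z‖ ≤ r⁻¹ → DifferentiableAt ℂ f z)
    (h : ∀ z, ‖z‖ = r → f z⁻¹ = - f z) : cint r f = 0 := by
  have e1 := cint_radius hr (hr1.trans (one_le_inv₀ hr |>.2 hr1)) hf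
  have e2 := cint_inv hr f
  have e3 : cint r (fun z => f z⁻¹) = cint r (fun z => (-1) * f z) :=
    cint_congr hr fun z hz => by rw [h z hz]; ring
  rw [cint_const_mul hr] at e3
  linear_combination (e1 - e2 + e3) / 2

section

variable {γ r : ℝ} (h : SmallRad γ r) (t : ℝ)
include h

theorem cint_GY_inner (h2 : SmallRad (2 * γ) r) {a d : ℂ} (ha : ‖a‖ = r ^ 3) (hd : ‖d‖ = 1) :
    cint r (fun c => (c⁻¹ - c) * (Rf γ a c * (1 + 2 * γ * Rf γ c d))) =
      4 * γ / (cfun a - cfun d - 4 * γ) := by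
  have hr := h.2.1
  have hl := h.lt_one
  have p3 := pow_pos hr 3
  have ha0 : 0 < ‖a‖ := by rw [ha]; exact p3
  have hd0 : 0 < ‖d‖ := by rw [hd]; exact one_pos
  have hnorm : ∀ {z : ℂ}, 0 < ‖z‖ → z ≠ 0 := fun h => norm_pos_iff.1 h
  have nd : cfun a - cfun d - 4 * γ ≠ 0 := by
    have := Rf_ne h2 ha0 hd0 (by rw [ha, hd]; nlinarith [pow_le_of_le_one hr.le hl.le (n := 3) (by norm_num)])
      (by rw [ha, hd]; nlinarith [pow_le_of_le_one hr.le hl.le (n := 3) (by norm_num)])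
    push_cast at this
    rwa [← mul_assoc, show (2 : ℂ) * 2 = 4 by norm_num] at this
  have nac : ∀ z : ℂ, r ≤ ‖z‖ → ‖z‖ ≤ r⁻¹ → cfun a - cfun z - 2 * γ ≠ 0 := fun z hz hz' => by
    refine Rf_ne h ha0 (hr.trans_le hz) ?_ ?_
    · rw [ha]; nlinarith [pow_pos hr 2]
    · rw [ha]
      calc r ^ 3 * ‖z‖ ≤ r ^ 3 * r⁻¹ := by gcongr
        _ = r ^ 2 := by field_simp
        _ ≤ r := pow_le_of_le_one hr.le hl.le (by norm_num)
  have ncd : ∀ z : ℂ, 0 < ‖z‖ → ‖z‖ ≤ r → cfun z - cfun d - 2 * γ ≠ 0 := fun z hz hz' =>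
    Rf_ne h hz hd0 (by rw [hd]; linarith) (by rw [hd]; linarith)
  have i1 : cint r (fun z => (z⁻¹ - z) * Rf γ a z) = 0 := by
    refine cint_antisymm_inv hr hl.le (fun z hz hz' => ?_) fun z _ => ?_
    · have := nac z hz hz'
      have := hnorm (hr.trans_le hz)
      have := hnorm ha0
      fun_prop (disch := assumption)
    · rw [Rf, Rf, cfun_inv, inv_inv]; ring
  have i2 : cint r (fun z => (z⁻¹ - z) * Rf γ z d) = 2 := by
    have hn : ∀ z : ℂ, ‖z‖ ≤ r → 1 + z ^ 2 - 2 * (cfun d + 2 * γ) * z ≠ 0 := by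
      intro z hz h0
      rcases eq_or_ne z 0 with rfl | hz0
      · simp at h0
      · refine ncd z (norm_pos_iff.2 hz0) hz ?_
        have : 2 * z * (cfun z - cfun d - 2 * γ) = 0 := by
          rw [← h0]; simp only [cfun]; field_simp; ring
        simpa [hz0] using this
    have : cint r (fun z => (z⁻¹ - z) * Rf γ z d) =
        cint r (fun z => 2 * (1 - z ^ 2) / (1 + z ^ 2 - 2 * (cfun d + 2 * γ) * z)) := by
      refine cint_congr hr fun z hz => ?_
      have hz0 := hnorm (hz ▸ hr)
      have h1 := hn z hz.le
      have h2 := ncd z (hz ▸ hr) hz.le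
      rw [Rf, ← div_eq_mul_inv, div_eq_div_iff h2 h1]
      simp only [cfun]
      field_simp
      ring
    rw [this, cint_disc hr]
    · simp
    · intro z hz
      have := hn z hz
      fun_prop (disch := assumption)
  have hc : ∀ {f : ℂ → ℂ}, (∀ z, ‖z‖ = r → DifferentiableAt ℂ f z) →
      Continuous fun θ => f (circleMap 0 r θ) := fun hf =>
    continuous_circle_of_forall hr fun z hz => (hf z hz).continuousAt
  have hle : r ≤ r⁻¹ := hl.le.trans (one_le_inv₀ hr |>.2 hl.le)
  have d1 : ∀ z, ‖z‖ = r → DifferentiableAt ℂ (fun z => (z⁻¹ - z) * Rf γ a z) z := fun z hz => by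
    have := nac z hz.ge (hz.le.trans hle)
    have := hnorm (hz ▸ hr)
    have := hnorm ha0
    fun_prop (disch := assumption)
  have d2 : ∀ z, ‖z‖ = r → DifferentiableAt ℂ (fun z => (z⁻¹ - z) * Rf γ z d) z := fun z hz => by
    have := ncd z (hz ▸ hr) hz.le
    have := hnorm (hz ▸ hr)
    have := hnorm hd0
    fun_prop (disch := assumption)
  have key : cint r (fun c => (c⁻¹ - c) * (Rf γ a c * (1 + 2 * γ * Rf γ c d))) =
      cint r (fun c => (1 + 2 * γ / (cfun a - cfun d - 4 * γ)) * ((c⁻¹ - c) * Rf γ a c) +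
        2 * γ / (cfun a - cfun d - 4 * γ) * ((c⁻¹ - c) * Rf γ c d)) := by
    refine cint_congr hr fun z hz => ?_
    have h1 := nac z hz.ge (hz.le.trans hle)
    have h2 := ncd z (hz ▸ hr) hz.le
    have : Rf γ a z * (1 + 2 * γ * Rf γ z d) = (1 + 2 * γ / (cfun a - cfun d - 4 * γ)) * Rf γ a z +
        2 * γ / (cfun a - cfun d - 4 * γ) * Rf γ z d := by
      have hD := mul_inv_cancel₀ nd
      rw [div_eq_mul_inv]
      linear_combination 2 * γ * (-Rf γ a z * Rf γ z d * hD +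
        (cfun a - cfun d - 4 * γ)⁻¹ * (Rf γ z d * Rf_mul h1 + Rf γ a z * Rf_mul h2))
    rw [this]; ring
  rw [key, cint_add hr (hc fun z hz => (d1 z hz).const_mul _) (hc fun z hz => (d2 z hz).const_mul _),
    cint_const_mul hr, cint_const_mul hr, i1, i2]
  ring

theorem reg_GJ_big {ρ : ℝ} (hρ : r ^ 2 ≤ ρ) (hρ' : ρ ≤ (r ^ 2)⁻¹) (hρ1 : ρ ≠ r⁻¹) :
    Reg4 (fun a c d b => GJ t γ a b c d) (r ^ 3) (r ^ 3) r r 1 1 ρ ρ := by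
  intro a c d b ha ha' hc hc' hd hd' hb hb'
  have hr := h.2.1
  have hl := h.lt_one
  have pa : 0 < ‖a‖ := (pow_pos hr 3).trans_le ha
  have pb : 0 < ‖b‖ := (pow_pos hr 2).trans_le (hρ.trans hb)
  have pc : 0 < ‖c‖ := hr.trans_le hc
  have pd : 0 < ‖d‖ := one_pos.trans_le hd
  have n1 := norm_pos_iff.1 pa
  have n2 := norm_pos_iff.1 pb
  have n3 := norm_pos_iff.1 pc
  have n4 := norm_pos_iff.1 pd
  have ea := le_antisymm ha' ha
  have eb := le_antisymm hb' hb
  have ec := le_antisymm hc' hc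
  have ed := le_antisymm hd' hd
  have hab : r ^ 3 * ρ ≤ r := by
    calc r ^ 3 * ρ ≤ r ^ 3 * (r ^ 2)⁻¹ := by gcongr
      _ = r := by field_simp
  have r12 := Rf_ne h pa pb (by rw [ea, eb]; nlinarith) (by rw [ea, eb]; exact hab)
  have r34 := Rf_ne h pc pd (by rw [ec, ed]; linarith) (by rw [ec, ed]; linarith)
  have u23 : 1 - b * c ≠ 0 := by
    intro h0
    have : ‖b * c‖ = 1 := by rw [← sub_eq_zero.1 h0]; simp
    rw [norm_mul, eb, ec] at this
    exact hρ1 (eq_inv_of_mul_eq_one_left this)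
  have w : 1 - a * b * c * d ≠ 0 := by
    intro h0
    have : ‖a * b * c * d‖ = 1 := by rw [← sub_eq_zero.1 h0]; simp
    rw [norm_mul, norm_mul, norm_mul, ea, eb, ec, ed] at this
    nlinarith
  unfold GJ
  fun_prop (disch := assumption)

theorem reg_GY {ρ : ℝ} : Reg4 (fun a c d _ => GY t γ a c d) (r ^ 3) (r ^ 3) r r 1 1 ρ ρ := by
  intro a c d b ha ha' hc hc' hd hd' hb hb'
  have hr := h.2.1
  have hl := h.lt_one
  have pa : 0 < ‖a‖ := (pow_pos hr 3).trans_le ha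
  have pc : 0 < ‖c‖ := hr.trans_le hc
  have pd : 0 < ‖d‖ := one_pos.trans_le hd
  have n1 := norm_pos_iff.1 pa
  have n3 := norm_pos_iff.1 pc
  have n4 := norm_pos_iff.1 pd
  have ea := le_antisymm ha' ha
  have ec := le_antisymm hc' hc
  have ed := le_antisymm hd' hd
  have hr3 := pow_le_of_le_one hr.le hl.le (n := 3) (by norm_num)
  have r12 := Rf_ne h pa pc (by rw [ea, ec]; nlinarith) (by rw [ea, ec]; nlinarith)
  have r34 := Rf_ne h pc pd (by rw [ec, ed]; linarith) (by rw [ec, ed]; linarith)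
  have w : 1 - a * d ≠ 0 := by
    intro h0
    have : ‖a * d‖ = 1 := by rw [← sub_eq_zero.1 h0]; simp
    rw [norm_mul, ea, ed] at this
    linarith
  unfold GY
  fun_prop (disch := assumption)

theorem cint_GJ_pole {a c d : ℂ} (ha : ‖a‖ = r ^ 3) (hc : ‖c‖ = r) (hd : ‖d‖ = 1) :
    cint (r ^ 2) (fun b => GJ t γ a b c d) =
      cint (r ^ 2)⁻¹ (fun b => GJ t γ a b c d + GY t γ a c d) := by
  have p3 := pow_pos h.2.1 3
  have p2 := pow_pos h.2.1 2
  have hr := h.2.1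
  have hl := h.lt_one
  have pi : 0 < (r ^ 2)⁻¹ := inv_pos.2 p2
  have hr2 : r ^ 2 < r := by nlinarith
  have hri : r < r⁻¹ := hl.trans (one_lt_inv₀ hr |>.2 hl)
  have hi2 : r⁻¹ < (r ^ 2)⁻¹ := inv_strictAnti₀ p2 hr2
  have rb := reg_GJ_big h t (ρ := (r ^ 2)⁻¹) (by linarith) le_rfl hi2.ne'
  have n1 : a ≠ 0 := norm_pos_iff.1 (ha ▸ p3)
  have n3 : c ≠ 0 := norm_pos_iff.1 (hc ▸ hr)
  have n4 : d ≠ 0 := norm_pos_iff.1 (hd ▸ one_pos)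
  have hcinv : ‖c⁻¹‖ = r⁻¹ := by rw [norm_inv, hc]
  have pole := cint_pole (ρ₁ := r ^ 2) (ρ₂ := (r ^ 2)⁻¹) (a := c⁻¹) p2 (by rw [hcinv]; linarith)
    (by rw [hcinv]; exact hi2)
    (h := fun b => Wf t γ a b c d * (Rf γ a b * (1 + 2 * γ * Rf γ c d) * (-(b - c) / c))) (by
      intro b hb hb'
      have pb : 0 < ‖b‖ := p2.trans_le hb
      have n2 := norm_pos_iff.1 pb
      have hab : r ^ 3 * ‖b‖ ≤ r := by
        calc r ^ 3 * ‖b‖ ≤ r ^ 3 * (r ^ 2)⁻¹ := by gcongr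
          _ = r := by field_simp
      have r12 := Rf_ne h (ha ▸ p3) pb (by rw [ha]; nlinarith) (by rw [ha]; exact hab)
      have w : 1 - a * b * c * d ≠ 0 := by
        intro h0
        have : ‖a * b * c * d‖ = 1 := by rw [← sub_eq_zero.1 h0]; simp
        rw [norm_mul, norm_mul, norm_mul, ha, hc, hd] at this
        nlinarith
      fun_prop (disch := assumption))
  have e : ∀ b, GJ t γ a b c d = Wf t γ a b c d * (Rf γ a b * (1 + 2 * γ * Rf γ c d) *
      (-(b - c) / c)) / (b - c⁻¹) := by
    intro b
    have : (b - c) / (1 - b * c) = (-(b - c) / c) / (b - c⁻¹) := by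
      rw [div_div, show c * (b - c⁻¹) = -(1 - b * c) by field_simp; ring, neg_div_neg_eq]
    rw [GJ, this]; ring
  have eY : GY t γ a c d = -(Wf t γ a c⁻¹ c d * (Rf γ a c⁻¹ * (1 + 2 * γ * Rf γ c d) *
      (-(c⁻¹ - c) / c)) / c⁻¹) := by
    rw [GY, Wf, epsfun_inv rfl, show a * c⁻¹ * c * d = a * d by field_simp,
      show Rf γ a c⁻¹ = Rf γ a c by rw [Rf, Rf, cfun_inv]]
    field_simp
  have hadd := cint_add pi (f := fun b => GJ t γ a b c d) (g := fun _ => GY t γ a c d)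
    (continuous_circle_of_forall pi fun b hb =>
      ((rb a c d b ha.ge ha.le hc.ge hc.le hd.ge hd.le hb.ge hb.le).comp b
        (f := fun b => (a, c, d, b)) (by fun_prop)).continuousAt) continuous_const
  rw [hadd, cint_disc pi (f := fun _ => GY t γ a c d) (fun _ _ => by fun_prop), eY]
  simp only [e]
  rw [pole]
  ring

theorem cint4_GY (h2 : SmallRad (2 * γ) r) :
    cint4 (r ^ 3) r 1 (r ^ 2)⁻¹ (fun a c d _ => GY t γ a c d) =
      cint (r ^ 3) fun a => cint 1 fun d => GY2 t γ a d := by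
  have p3 := pow_pos h.2.1 3
  have hr := h.2.1
  have pi : 0 < (r ^ 2)⁻¹ := inv_pos.2 (pow_pos h.2.1 2)
  rw [cint4_swap23 p3 hr one_pos pi (reg_GY h t)]
  refine cint_congr p3 fun a ha => cint_congr one_pos fun d hd => ?_
  have : (cint r fun c => cint (r ^ 2)⁻¹ fun _ => GY t γ a c d) = cint r fun c =>
      (Complex.exp (t * (epsfun γ a + epsfun γ d - 4 * γ)) * om (a * d)) *
        ((c⁻¹ - c) * (Rf γ a c * (1 + 2 * γ * Rf γ c d))) := by
    refine cint_congr hr fun c _ => ?_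
    rw [cint_disc pi (fun _ _ => by fun_prop), GY]
  rw [this, cint_const_mul hr, cint_GY_inner h h2 ha hd, GY2]

theorem cint4_GJ (h2 : SmallRad (2 * γ) r) : cint4 (r ^ 3) (r ^ 2) (r ^ 1) (r ^ 0) (GJ t γ) =
    cint4 (r ^ 3) r 1 (r ^ 2)⁻¹ (fun a c d b => GJ t γ a b c d) +
      cint (r ^ 3) fun a => cint 1 fun d => GY2 t γ a d := by
  have p3 := pow_pos h.2.1 3
  have p2 := pow_pos h.2.1 2
  have p1 := pow_pos h.2.1 1
  have p0 := pow_pos h.2.1 0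
  have hr := h.2.1
  have hl := h.lt_one
  have pi : 0 < (r ^ 2)⁻¹ := inv_pos.2 p2
  have hr2 : r ^ 2 < r := by nlinarith
  have hri : r < r⁻¹ := hl.trans (one_lt_inv₀ hr |>.2 hl)
  have hi2 : r⁻¹ < (r ^ 2)⁻¹ := inv_strictAnti₀ p2 hr2
  have e1 : r ^ 1 = r := pow_one r
  have e0 : r ^ 0 = 1 := pow_zero r
  have rg := reg_GJ h t
  rw [e1, e0] at rg ⊢
  have st0 : cint4 (r ^ 3) (r ^ 2) r 1 (GJ t γ) =
      cint4 (r ^ 3) r 1 (r ^ 2) (fun a c d b => GJ t γ a b c d) :=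
    (cint4_swap23 p3 p2 hr one_pos rg).trans (cint4_swap34 p3 hr p2 one_pos rg.swap23)
  have rb := reg_GJ_big h t (ρ := (r ^ 2)⁻¹) (by linarith) le_rfl hi2.ne'
  have ry := reg_GY h t (ρ := (r ^ 2)⁻¹)
  have step : cint4 (r ^ 3) r 1 (r ^ 2) (fun a c d b => GJ t γ a b c d) =
      cint4 (r ^ 3) r 1 (r ^ 2)⁻¹ (fun a c d b => GJ t γ a b c d + GY t γ a c d) := by
    exact cint_congr p3 fun a ha => cint_congr hr fun c hc => cint_congr one_pos fun d hd =>
      cint_GJ_pole h t ha hc hd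
  rw [st0, step, cint4_add p3 hr one_pos pi rb ry]
  rw [cint4_GY h t h2]

end

/-- `ε(z) + ε(u/z)` in terms of the pair product `u`. -/
noncomputable def ef (γ : ℝ) (u z : ℂ) : ℂ := (1 - u) * (z⁻¹ + z / u) - 4 * γ

/-- `c(z) - c(u/z) - 2γ` in terms of the pair product `u`. -/
noncomputable def df (γ : ℝ) (u z : ℂ) : ℂ := (1 - u) / 2 * (z⁻¹ - z / u) - 2 * γ

theorem ef_eq {γ : ℝ} {u z : ℂ} (hu : u ≠ 0) (hz : z ≠ 0) :
    epsfun γ z + epsfun γ (u / z) = ef γ u z := by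
  simp only [epsfun, ef]
  field_simp
  ring

theorem df_eq {γ : ℝ} {u z : ℂ} (hu : u ≠ 0) (hz : z ≠ 0) :
    cfun z - cfun (u / z) - 2 * γ = df γ u z := by
  simp only [cfun, df]
  field_simp
  ring

@[fun_prop]
theorem DifferentiableAt.ef {E : Type*} [NormedAddCommGroup E] [NormedSpace ℂ E] {γ : ℝ}
    {f g : E → ℂ} {x : E} (hf : DifferentiableAt ℂ f x) (hg : DifferentiableAt ℂ g x)
    (hf0 : f x ≠ 0) (hg0 : g x ≠ 0) :
    DifferentiableAt ℂ (fun y => ef γ (f y) (g y)) x := by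
  unfold _root_.ef
  fun_prop (disch := assumption)

@[fun_prop]
theorem DifferentiableAt.df {E : Type*} [NormedAddCommGroup E] [NormedSpace ℂ E] {γ : ℝ}
    {f g : E → ℂ} {x : E} (hf : DifferentiableAt ℂ f x) (hg : DifferentiableAt ℂ g x)
    (hf0 : f x ≠ 0) (hg0 : g x ≠ 0) :
    DifferentiableAt ℂ (fun y => df γ (f y) (g y)) x := by
  unfold _root_.df
  fun_prop (disch := assumption)

/-- The integrand of the main term in pair variables. -/
noncomputable def PJ (t γ : ℝ) (a c v u : ℂ) : ℂ :=
  Complex.exp (t * (ef γ u a + ef γ v c)) * om (u * v) *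
    ((df γ u a)⁻¹ * (1 + 2 * γ * (df γ v c)⁻¹) * ((u - a * c) / (a - u * c)))

/-- The integrand of the negligible term in pair variables. -/
noncomputable def PN (t γ : ℝ) (a c v u : ℂ) : ℂ :=
  Complex.exp (t * (ef γ u a + ef γ v c)) * om (u * v) *
    ((1 + 2 * γ * (df γ v c)⁻¹) * (1 + (2 * γ + 2 * ((c - a) / (1 - a * c))) * (df γ u a)⁻¹))

/-- The integrand of the residue term in pair variables. -/
noncomputable def PY (t γ : ℝ) (a u : ℂ) : ℂ :=
  Complex.exp (t * ef (2 * γ) u a) * om u * (4 * γ * (df (2 * γ) u a)⁻¹)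

theorem df_ne_of_small {γ r : ℝ} (h : SmallRad γ r) {u z : ℂ} (hz : z ≠ 0) (hu : u ≠ 0)
    (h1 : ‖u‖ ≤ r) (h2 : ‖z‖ ^ 2 ≤ r * ‖u‖) : df γ u z ≠ 0 := by
  rw [← df_eq hu hz]
  have hz' := norm_pos_iff.2 hz
  have hu' := norm_pos_iff.2 hu
  refine Rf_ne h hz' (by rw [norm_div]; positivity) ?_ ?_
  · rw [norm_div, mul_div_assoc', le_div_iff₀ hz', ← sq]; exact h2
  · rw [norm_div, mul_div_cancel₀ _ hz'.ne']; exact h1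

theorem df_ne_of_tiny {γ q ρ s : ℝ} (hγ : 0 < γ) (hq : 0 < q) (hsq : s ≤ q)
    (hρ : ρ < 1) (hs2 : 4 * γ < (1 - ρ) * (s⁻¹ - 1)) {u z : ℂ} (hz : z ≠ 0) (hzs : ‖z‖ ≤ s)
    (hqu : q ≤ ‖u‖) (huρ : ‖u‖ ≤ ρ) : df γ u z ≠ 0 := by
  have hz' := norm_pos_iff.2 hz
  have hs : 0 < s := hz'.trans_le hzs
  have hu' : 0 < ‖u‖ := hq.trans_le hqu
  intro h0
  have e : (1 - u) * (z⁻¹ - z / u) = 4 * γ := by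
    simp only [df] at h0; linear_combination 2 * h0
  have e2 : ‖1 - u‖ * ‖z⁻¹ - z / u‖ = 4 * γ := by
    rw [← norm_mul, e]; simp [abs_of_pos hγ]
  have h1 : 1 - ρ ≤ ‖1 - u‖ := by
    have := norm_sub_norm_le 1 u
    rw [norm_one] at this
    linarith
  have h2 : s⁻¹ - 1 ≤ ‖z⁻¹ - z / u‖ := by
    have := norm_sub_norm_le z⁻¹ (z / u)
    have h3 : ‖z / u‖ ≤ 1 := by
      rw [norm_div, div_le_one hu']; linarith
    have h4 : s⁻¹ ≤ ‖z⁻¹‖ := by rw [norm_inv]; exact inv_anti₀ hz' hzs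
    linarith
  have h3 : 0 < s⁻¹ - 1 := by
    by_contra h4
    nlinarith
  nlinarith

theorem exists_tiny {γ q ρ : ℝ} (hq : 0 < q) (hρ : ρ < 1) :
    ∃ s, 0 < s ∧ s ≤ q ∧ 4 * γ < (1 - ρ) * (s⁻¹ - 1) := by
  have h1 : Tendsto (fun s : ℝ => (1 - ρ) * (s⁻¹ - 1)) (nhdsWithin 0 (Set.Ioi 0)) atTop :=
    ((tendsto_atTop_add_const_right _ (-1) tendsto_inv_nhdsGT_zero)).const_mul_atTop (by linarith)
  have h2 : ∀ᶠ s : ℝ in nhdsWithin 0 (Set.Ioi 0), s ≤ q :=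
    (Filter.eventually_of_mem (nhdsWithin_le_nhds (Iic_mem_nhds hq)) fun _ h => h)
  obtain ⟨s, h3, h4, h5⟩ := ((h1.eventually_gt_atTop (4 * γ)).and
    (h2.and self_mem_nhdsWithin)).exists
  exact ⟨s, h5, h4, h3⟩

theorem cint4_shrink {P : ℂ → ℂ → ℂ → ℂ → ℂ} {A C V U s₁ s₃ ρ ρ₁ : ℝ} (hs1 : 0 < s₁) (hs3 : 0 < s₃)
    (hV : 0 < V) (hU : 0 < U) (hA : s₁ ≤ A) (hC : s₃ ≤ C) (hVρ : V ≤ ρ) (hUρ : U ≤ ρ₁)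
    (H1 : Reg4 P s₁ A C C V V U U) (H2 : Reg4 P s₁ s₁ s₃ C V V U U)
    (H3 : Reg4 P s₁ s₁ s₃ s₃ V V U ρ₁) (H4 : Reg4 P s₁ s₁ s₃ s₃ V ρ ρ₁ ρ₁) :
    cint4 A C V U P = cint4 ρ ρ₁ s₃ s₁ (fun v u c a => P a c v u) := by
  have hC' := hs3.trans_le hC
  have hρ := hV.trans_le hVρ
  have hρ₁ := hU.trans_le hUρ
  rw [← cint4_radius1 hs1 hC' hV hU hA H1, ← cint4_radius2 hs1 hs3 hV hU hC H2,
    cint4_radius4 hs1 hs3 hV hU hUρ H3, cint4_radius3 hs1 hs3 hV hρ₁ hVρ H4]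
  have R := H4.mono le_rfl le_rfl le_rfl le_rfl hVρ le_rfl le_rfl le_rfl
  rw [cint4_swap23 hs1 hs3 hρ hρ₁ R, cint4_swap12 hs1 hρ hs3 hρ₁ R.swap23,
    cint4_swap34 hρ hs1 hs3 hρ₁ R.swap23.swap12, cint4_swap23 hρ hs1 hρ₁ hs3 R.swap23.swap12.swap34,
    cint4_swap34 hρ hρ₁ hs1 hs3 R.swap23.swap12.swap34.swap23]

theorem one_sub_ne {w : ℂ} (h : ‖w‖ < 1) : 1 - w ≠ 0 := by
  intro h0
  rw [← sub_eq_zero.1 h0] at h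
  simp at h

theorem cint_const {ρ : ℝ} (hρ : 0 < ρ) (c : ℂ) : cint ρ (fun _ => c) = c :=
  cint_disc hρ fun _ _ => differentiableAt_const c

theorem diff_PJ {γ : ℝ} (t : ℝ) {a c v u : ℂ} (ha : a ≠ 0) (hc : c ≠ 0) (hv : v ≠ 0) (hu : u ≠ 0)
    (h1 : df γ u a ≠ 0) (h2 : df γ v c ≠ 0) (h3 : a - u * c ≠ 0) (h4 : 1 - u * v ≠ 0) :
    DifferentiableAt ℂ (fun p : ℂ × ℂ × ℂ × ℂ => PJ t γ p.1 p.2.1 p.2.2.1 p.2.2.2) (a, c, v, u) := by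
  unfold PJ
  fun_prop (disch := assumption)

theorem diff_PN {γ : ℝ} (t : ℝ) {a c v u : ℂ} (ha : a ≠ 0) (hc : c ≠ 0) (hv : v ≠ 0) (hu : u ≠ 0)
    (h1 : df γ u a ≠ 0) (h2 : df γ v c ≠ 0) (h3 : 1 - a * c ≠ 0) (h4 : 1 - u * v ≠ 0) :
    DifferentiableAt ℂ (fun p : ℂ × ℂ × ℂ × ℂ => PN t γ p.1 p.2.1 p.2.2.1 p.2.2.2) (a, c, v, u) := by
  unfold PN
  fun_prop (disch := assumption)

section

variable {γ r : ℝ} (h : SmallRad γ r) (t : ℝ)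
include h

theorem cint4_PJ {ρ ρ₁ s₁ s₃ : ℝ} (hρ : r ≤ ρ) (hρ' : ρ < 1) (hρ₁ : r ≤ ρ₁) (hρ₁' : ρ₁ < 1)
    (hs3 : 0 < s₃) (hs3' : s₃ ≤ r) (hs1 : 0 < s₁) (hs1' : s₁ < r * s₃) (hs1'' : s₁ ≤ r ^ 3)
    (ht3 : 4 * γ < (1 - ρ) * (s₃⁻¹ - 1)) (ht1 : 4 * γ < (1 - ρ₁) * (s₁⁻¹ - 1)) :
    cint4 (r ^ 3) r 1 (r ^ 2)⁻¹ (fun a c d b => GJ t γ a b c d) =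
      cint4 ρ ρ₁ s₃ s₁ (fun v u c a => PJ t γ a c v u) := by
  have hr := h.2.1
  have hl := h.lt_one
  have p3 := pow_pos hr 3
  have st : cint4 (r ^ 3) r 1 (r ^ 2)⁻¹ (fun a c d b => GJ t γ a b c d) =
      cint4 (r ^ 3) r r r (PJ t γ) := by
    refine cint_congr p3 fun a ha => cint_congr hr fun c hc => ?_
    have ha0 : a ≠ 0 := norm_pos_iff.1 (ha ▸ p3)
    have hc0 : c ≠ 0 := norm_pos_iff.1 (hc ▸ hr)
    rw [cint_scale one_pos hc0, one_mul, hc]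
    refine cint_congr hr fun v hv => ?_
    have hv0 : v ≠ 0 := norm_pos_iff.1 (hv ▸ hr)
    rw [cint_scale (inv_pos.2 (pow_pos hr 2)) ha0, ha, show (r ^ 2)⁻¹ * r ^ 3 = r by field_simp]
    refine cint_congr hr fun u hu => ?_
    have hu0 : u ≠ 0 := norm_pos_iff.1 (hu ▸ hr)
    have e1 : a * (u / a) * c * (v / c) = u * v := by field_simp
    have e2 : (u / a - c) / (1 - u / a * c) = (u - a * c) / (a - u * c) := by
      rw [← mul_div_mul_left _ _ ha0]
      congr 1 <;> field_simp
    change GJ t γ a (u / a) c (v / c) = PJ t γ a c v u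
    rw [GJ, Wf, Rf, Rf, add_assoc, ef_eq hu0 ha0, ef_eq hv0 hc0, df_eq hu0 ha0, df_eq hv0 hc0, e1,
      e2, PJ]
  rw [st]
  have hne : ∀ {z : ℂ} {x : ℝ}, 0 < x → x ≤ ‖z‖ → z ≠ 0 := fun hx hz => norm_pos_iff.1 (hx.trans_le hz)
  have hac : ∀ {a u c : ℂ}, ‖a‖ < ‖u‖ * ‖c‖ → a - u * c ≠ 0 := fun {a u c} hh h0 => by
    rw [sub_eq_zero.1 h0, norm_mul] at hh
    exact lt_irrefl _ hh
  have huv : ∀ {u v : ℂ}, ‖u‖ < 1 → ‖v‖ < 1 → 1 - u * v ≠ 0 := fun {u v} hu hv =>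
    one_sub_ne (by rw [norm_mul]; nlinarith [norm_nonneg u, norm_nonneg v])
  refine cint4_shrink hs1 hs3 hr hr hs1'' hs3' hρ hρ₁ ?_ ?_ ?_ ?_
  · intro a c v u ha ha' hc hc' hv hv' hu hu'
    refine diff_PJ t (hne hs1 ha) (hne hr hc) (hne hr hv) (hne hr hu)
      (df_ne_of_small h (hne hs1 ha) (hne hr hu) hu' ?_)
      (df_ne_of_small h (hne hr hc) (hne hr hv) hv' ?_)
      (hac ?_) (huv (by linarith) (by linarith))
    · calc ‖a‖ ^ 2 ≤ (r ^ 3) ^ 2 := by gcongr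
        _ = r ^ 6 := by ring
        _ ≤ r ^ 2 := pow_le_pow_of_le_one hr.le hl.le (by norm_num)
        _ ≤ r * ‖u‖ := by rw [sq]; gcongr
    · calc ‖c‖ ^ 2 ≤ r ^ 2 := by gcongr
        _ ≤ r * ‖v‖ := by rw [sq]; gcongr
    · calc ‖a‖ ≤ r ^ 3 := ha'
        _ < r ^ 2 := pow_lt_pow_right_of_lt_one₀ hr hl (by norm_num)
        _ = r * r := sq r
        _ ≤ ‖u‖ * ‖c‖ := by gcongr
  · intro a c v u ha ha' hc hc' hv hv' hu hu'
    refine diff_PJ t (hne hs1 ha) (hne hs3 hc) (hne hr hv) (hne hr hu)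
      (df_ne_of_small h (hne hs1 ha) (hne hr hu) hu' ?_)
      (df_ne_of_small h (hne hs3 hc) (hne hr hv) hv' ?_)
      (hac ?_) (huv (by linarith) (by linarith))
    · calc ‖a‖ ^ 2 ≤ (r ^ 3) ^ 2 := by gcongr; exact ha'.trans hs1''
        _ = r ^ 6 := by ring
        _ ≤ r ^ 2 := pow_le_pow_of_le_one hr.le hl.le (by norm_num)
        _ ≤ r * ‖u‖ := by rw [sq]; gcongr
    · calc ‖c‖ ^ 2 ≤ r ^ 2 := by gcongr
        _ ≤ r * ‖v‖ := by rw [sq]; gcongr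
    · calc ‖a‖ ≤ s₁ := ha'
        _ < r * s₃ := hs1'
        _ ≤ ‖u‖ * ‖c‖ := by gcongr
  · intro a c v u ha ha' hc hc' hv hv' hu hu'
    refine diff_PJ t (hne hs1 ha) (hne hs3 hc) (hne hr hv) (hne hr hu)
      (df_ne_of_tiny h.1 hr (by nlinarith) hρ₁' ht1 (hne hs1 ha) ha' hu hu')
      (df_ne_of_tiny h.1 hr hs3' hρ' ht3 (hne hs3 hc) hc' hv (hv'.trans hρ))
      (hac ?_) (huv (by linarith) (by linarith))
    · calc ‖a‖ ≤ s₁ := ha'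
        _ < r * s₃ := hs1'
        _ ≤ ‖u‖ * ‖c‖ := by gcongr
  · intro a c v u ha ha' hc hc' hv hv' hu hu'
    refine diff_PJ t (hne hs1 ha) (hne hs3 hc) (hne hr hv) (hne hr (hρ₁.trans hu))
      (df_ne_of_tiny h.1 hr (by nlinarith) hρ₁' ht1 (hne hs1 ha) ha' (hρ₁.trans hu) hu')
      (df_ne_of_tiny h.1 hr hs3' hρ' ht3 (hne hs3 hc) hc' hv hv')
      (hac ?_) (huv (by linarith) (by linarith))
    · calc ‖a‖ ≤ s₁ := ha'
        _ < r * s₃ := hs1'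
        _ ≤ ‖u‖ * ‖c‖ := by gcongr; exact hρ₁.trans hu

theorem cint4_PN {ρ s : ℝ} (hρ : r ≤ ρ) (hρ' : ρ < 1)
    (hs : 0 < s) (hs' : s ≤ r ^ 5) (ht : 4 * γ < (1 - ρ) * (s⁻¹ - 1)) :
    cint4 (r ^ 3) (r ^ 2) (r ^ 1) (r ^ 0) (GN t γ) =
      cint4 ρ ρ s s (fun v u c a => PN t γ a c v u) := by
  have hr := h.2.1
  have hl := h.lt_one
  have p3 := pow_pos hr 3
  have p5 := pow_pos hr 5
  have p2 := pow_pos hr 2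
  have e1 : r ^ 1 = r := pow_one r
  have e0 : r ^ 0 = 1 := pow_zero r
  have l53 : r ^ 5 ≤ r ^ 3 := pow_le_pow_of_le_one hr.le hl.le (by norm_num)
  have l51 : r ^ 5 ≤ r := pow_le_of_le_one hr.le hl.le (by norm_num)
  have l31 : r ^ 3 ≤ r := pow_le_of_le_one hr.le hl.le (by norm_num)
  have st : cint4 (r ^ 3) (r ^ 2) (r ^ 1) (r ^ 0) (GN t γ) =
      cint4 (r ^ 3) r r (r ^ 5) (PN t γ) := by
    have rg := reg_GN h t
    rw [e1, e0] at rg ⊢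
    rw [cint4_swap23 p3 p2 hr one_pos rg, cint4_swap34 p3 hr p2 one_pos rg.swap23]
    refine cint_congr p3 fun a ha => cint_congr hr fun c hc => ?_
    have ha0 : a ≠ 0 := norm_pos_iff.1 (ha ▸ p3)
    have hc0 : c ≠ 0 := norm_pos_iff.1 (hc ▸ hr)
    rw [cint_scale one_pos hc0, one_mul, hc]
    refine cint_congr hr fun v hv => ?_
    have hv0 : v ≠ 0 := norm_pos_iff.1 (hv ▸ hr)
    rw [cint_scale p2 ha0, ha, show r ^ 2 * r ^ 3 = r ^ 5 by ring]
    refine cint_congr p5 fun u hu => ?_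
    have hu0 : u ≠ 0 := norm_pos_iff.1 (hu ▸ p5)
    have e1 : a * (u / a) * c * (v / c) = u * v := by field_simp
    change GN t γ a (u / a) c (v / c) = PN t γ a c v u
    rw [GN, Wf, Rf, Rf, add_assoc, ef_eq hu0 ha0, ef_eq hv0 hc0, df_eq hu0 ha0, df_eq hv0 hc0, e1,
      PN]
  rw [st]
  have hne : ∀ {z : ℂ} {x : ℝ}, 0 < x → x ≤ ‖z‖ → z ≠ 0 := fun hx hz => norm_pos_iff.1 (hx.trans_le hz)
  have huv : ∀ {u v : ℂ}, ‖u‖ < 1 → ‖v‖ < 1 → 1 - u * v ≠ 0 := fun {u v} hu hv =>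
    one_sub_ne (by rw [norm_mul]; nlinarith [norm_nonneg u, norm_nonneg v])
  refine cint4_shrink hs hs hr p5 (hs'.trans l53) (hs'.trans l51) hρ (l51.trans hρ) ?_ ?_ ?_ ?_
  · intro a c v u ha ha' hc hc' hv hv' hu hu'
    refine diff_PN t (hne hs ha) (hne hr hc) (hne hr hv) (hne p5 hu)
      (df_ne_of_small h (hne hs ha) (hne p5 hu) (hu'.trans l51) ?_)
      (df_ne_of_small h (hne hr hc) (hne hr hv) hv' ?_)
      (huv (by linarith) (by linarith)) (huv (by linarith) (by linarith))
    · calc ‖a‖ ^ 2 ≤ (r ^ 3) ^ 2 := by gcongr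
        _ = r * r ^ 5 := by ring
        _ ≤ r * ‖u‖ := by gcongr
    · calc ‖c‖ ^ 2 ≤ r ^ 2 := by gcongr
        _ ≤ r * ‖v‖ := by rw [sq]; gcongr
  · intro a c v u ha ha' hc hc' hv hv' hu hu'
    refine diff_PN t (hne hs ha) (hne hs hc) (hne hr hv) (hne p5 hu)
      (df_ne_of_small h (hne hs ha) (hne p5 hu) (hu'.trans l51) ?_)
      (df_ne_of_small h (hne hs hc) (hne hr hv) hv' ?_)
      (huv (by linarith) (by linarith)) (huv (by linarith) (by linarith))
    · calc ‖a‖ ^ 2 ≤ (r ^ 3) ^ 2 := by gcongr; linarith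
        _ = r * r ^ 5 := by ring
        _ ≤ r * ‖u‖ := by gcongr
    · calc ‖c‖ ^ 2 ≤ r ^ 2 := by gcongr
        _ ≤ r * ‖v‖ := by rw [sq]; gcongr
  · intro a c v u ha ha' hc hc' hv hv' hu hu'
    exact diff_PN t (hne hs ha) (hne hs hc) (hne hr hv) (hne p5 hu)
      (df_ne_of_tiny h.1 p5 hs' hρ' ht (hne hs ha) ha' hu hu')
      (df_ne_of_tiny h.1 hr (by linarith) hρ' ht (hne hs hc) hc' hv (hv'.trans hρ))
      (huv (by linarith) (by linarith)) (huv (by linarith) (by linarith))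
  · intro a c v u ha ha' hc hc' hv hv' hu hu'
    exact diff_PN t (hne hs ha) (hne hs hc) (hne hr hv) (hne hr (hρ.trans hu))
      (df_ne_of_tiny h.1 hr (by linarith) hρ' ht (hne hs ha) ha' (hρ.trans hu) hu')
      (df_ne_of_tiny h.1 hr (by linarith) hρ' ht (hne hs hc) hc' hv hv')
      (huv (by linarith) (by linarith)) (huv (by linarith) (by linarith))

theorem cint_PY (h2 : SmallRad (2 * γ) r) {ρ s : ℝ} (hρ : r ≤ ρ) (hρ' : ρ < 1)
    (hs : 0 < s) (hs' : s ≤ r ^ 3) (ht : 4 * (2 * γ) < (1 - ρ) * (s⁻¹ - 1)) :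
    (cint (r ^ 3) fun a => cint 1 fun d => GY2 t γ a d) =
      cint ρ fun u => cint s fun a => PY t γ a u := by
  have hr := h.2.1
  have hl := h.lt_one
  have p3 := pow_pos hr 3
  have l31 : r ^ 3 ≤ r := pow_le_of_le_one hr.le hl.le (by norm_num)
  have st : (cint (r ^ 3) fun a => cint 1 fun d => GY2 t γ a d) =
      cint4 1 1 (r ^ 3) (r ^ 3) (fun _ _ a u => PY t γ a u) := by
    refine Eq.trans ?_ ((cint_const one_pos _).trans (cint_const one_pos _)).symm
    refine cint_congr p3 fun a ha => ?_
    have ha0 : a ≠ 0 := norm_pos_iff.1 (ha ▸ p3)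
    rw [cint_scale one_pos ha0, one_mul, ha]
    refine cint_congr p3 fun u hu => ?_
    have hu0 : u ≠ 0 := norm_pos_iff.1 (hu ▸ p3)
    have e1 := ef_eq (γ := γ) hu0 ha0
    have e2 := df_eq (γ := γ) hu0 ha0
    have e3 : epsfun γ a + epsfun γ (u / a) - 4 * γ = ef (2 * γ) u a := by
      rw [e1]; simp only [ef]; push_cast; ring
    have e4 : cfun a - cfun (u / a) - 4 * γ = df (2 * γ) u a := by
      rw [show cfun a - cfun (u / a) - 4 * γ = (cfun a - cfun (u / a) - 2 * γ) - 2 * γ by ring, e2]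
      simp only [df]; push_cast; ring
    change GY2 t γ a (u / a) = PY t γ a u
    rw [GY2, PY, e3, e4, mul_div_cancel₀ _ ha0, div_eq_mul_inv]
  have hne : ∀ {z : ℂ} {x : ℝ}, 0 < x → x ≤ ‖z‖ → z ≠ 0 := fun hx hz => norm_pos_iff.1 (hx.trans_le hz)
  have dP : ∀ {a u b c : ℂ}, a ≠ 0 → u ≠ 0 → df (2 * γ) u a ≠ 0 → 1 - u ≠ 0 →
      DifferentiableAt ℂ (fun p : ℂ × ℂ × ℂ × ℂ => PY t γ p.2.2.1 p.2.2.2) (b, c, a, u) := by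
    intro a u b c h1 h2 h3 h4
    unfold PY
    fun_prop (disch := assumption)
  have R1 : Reg4 (fun _ _ a u => PY t γ a u) 1 1 1 1 s (r ^ 3) (r ^ 3) (r ^ 3) := by
    intro b c a u _ _ _ _ ha ha' hu hu'
    refine dP (hne hs ha) (hne p3 hu) (df_ne_of_small h2 (hne hs ha) (hne p3 hu) (hu'.trans l31) ?_)
      (one_sub_ne (by linarith))
    calc ‖a‖ ^ 2 ≤ (r ^ 3) ^ 2 := by gcongr
        _ = r * r ^ 5 := by ring
        _ ≤ r * r ^ 3 := by
          gcongr r * ?_; exact pow_le_pow_of_le_one hr.le hl.le (by norm_num)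
        _ ≤ r * ‖u‖ := by gcongr
  have R2 : Reg4 (fun _ _ a u => PY t γ a u) 1 1 1 1 s s (r ^ 3) ρ := by
    intro b c a u _ _ _ _ ha ha' hu hu'
    exact dP (hne hs ha) (hne p3 hu)
      (df_ne_of_tiny h2.1 p3 hs' hρ' ht (hne hs ha) ha' hu hu') (one_sub_ne (by linarith))
  have R3 := R2.mono le_rfl le_rfl le_rfl le_rfl le_rfl le_rfl (l31.trans hρ) le_rfl
  rw [st, ← cint4_radius3 one_pos one_pos hs p3 hs' R1,
    cint4_radius4 one_pos one_pos hs p3 (l31.trans hρ) R2,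
    cint4_swap34 one_pos one_pos hs (hr.trans_le hρ) R3]
  exact (cint_const one_pos _).trans (cint_const one_pos _)

end

/-- The square root `√(4γ² + (1-u)²/u)`. -/
noncomputable def Tf (γ : ℝ) (u : ℂ) : ℂ := (4 * γ ^ 2 + (1 - u) ^ 2 / u) ^ (2⁻¹ : ℂ)

/-- The zero of `df γ u` inside the disc of radius `√|u|`. -/
noncomputable def zf (γ : ℝ) (u : ℂ) : ℂ := (1 - u) / (2 * γ + Tf γ u)

theorem Tf_sq (γ : ℝ) (u : ℂ) : Tf γ u ^ 2 = 4 * γ ^ 2 + (1 - u) ^ 2 / u := by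
  rw [Tf, ← Nat.cast_ofNat (R := ℂ) (n := 2), Complex.cpow_nat_inv_pow _ (by norm_num)]

theorem Tf_re_nonneg (γ : ℝ) (u : ℂ) : 0 ≤ (Tf γ u).re := by
  rw [Tf, Complex.cpow_inv_two_re]
  positivity

section

variable {γ : ℝ} (hγ : 0 < γ) {u : ℂ} (hu : u ≠ 0) (hu1 : ‖u‖ < 1)
include hγ

theorem Tf_add_ne : 2 * γ + Tf γ u ≠ 0 := by
  intro h0
  have := congrArg Complex.re h0
  have h1 := Tf_re_nonneg γ u
  simp at this
  linarith

omit hγ in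
theorem norm_Tf_add : 2 * γ ≤ ‖2 * γ + Tf γ u‖ := by
  refine le_trans ?_ (Complex.re_le_norm _)
  have h1 := Tf_re_nonneg γ u
  simp
  linarith

theorem zf_mul : zf γ u * (2 * γ + Tf γ u) = 1 - u := by
  rw [zf, div_mul_cancel₀ _ (Tf_add_ne hγ)]

include hu in
theorem zf_mul' : (1 - u) * zf γ u = u * (Tf γ u - 2 * γ) := by
  have h1 := Tf_add_ne (u := u) hγ
  have h2 := Tf_sq γ u
  field_simp at h2
  rw [zf, mul_div_assoc', div_eq_iff h1]
  linear_combination -h2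

include hu1 in
theorem zf_ne : zf γ u ≠ 0 := div_ne_zero (one_sub_ne hu1) (Tf_add_ne hγ)

include hu hu1 in
theorem ef_zf : ef γ u (zf γ u) = 2 * Tf γ u - 4 * γ := by
  have h0 := zf_ne (u := u) hγ hu1
  have h1 := zf_mul (u := u) hγ
  have h2 := zf_mul' hγ hu
  have e1 : (1 - u) * (zf γ u)⁻¹ = 2 * γ + Tf γ u := by
    rw [← h1]; field_simp
  have e2 : (1 - u) * (zf γ u / u) = Tf γ u - 2 * γ := by
    rw [← mul_div_assoc, h2]; field_simp
  rw [ef, mul_add, e1, e2]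
  ring

include hu hu1 in
theorem df_factor {z : ℂ} (hz : z ≠ 0) :
    df γ u z = -((1 - u) / (2 * u * z)) * ((z - zf γ u) * (z + u / zf γ u)) := by
  have h0 := zf_ne (u := u) hγ hu1
  have h1 := zf_mul (u := u) hγ
  have h2 := zf_mul' hγ hu
  have e1 : (1 - u) / zf γ u = 2 * γ + Tf γ u := by
    rw [← h1]; field_simp
  have e2 : (1 - u) * zf γ u / u = Tf γ u - 2 * γ := by
    rw [h2]; field_simp
  have : -((1 - u) / (2 * u * z)) * ((z - zf γ u) * (z + u / zf γ u)) =
      (1 - u) / 2 * (z⁻¹ - z / u) - ((1 - u) / zf γ u - (1 - u) * zf γ u / u) / 2 := by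
    field_simp
    ring
  rw [this, e1, e2, df]
  ring

include hu hu1 in
theorem df_zf : df γ u (zf γ u) = 0 := by
  rw [df_factor hγ hu hu1 (zf_ne hγ hu1)]
  simp

include hu hu1 in
theorem two_Tf : 2 * Tf γ u = (1 - u) / u * (zf γ u + u / zf γ u) := by
  have h0 := zf_ne (u := u) hγ hu1
  have h := ef_zf hγ hu hu1
  rw [ef] at h
  linear_combination (exp := 1) -h + (1 - u) * (by field_simp; ring : (zf γ u)⁻¹ + zf γ u / u = u⁻¹ * (zf γ u + u / zf γ u))

include hu in
theorem zf_norm_sq : ‖zf γ u‖ ^ 2 * ‖2 * γ + Tf γ u‖ = ‖u‖ * ‖Tf γ u - 2 * γ‖ := by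
  rw [← norm_mul, ← zf_mul' hγ hu, ← zf_mul (u := u) hγ, norm_mul, norm_mul]
  ring

omit hγ in
theorem normSq_Tf : ‖2 * γ + Tf γ u‖ ^ 2 - ‖Tf γ u - 2 * γ‖ ^ 2 = 8 * γ * (Tf γ u).re := by
  rw [← Complex.normSq_eq_norm_sq, ← Complex.normSq_eq_norm_sq, Complex.normSq_apply,
    Complex.normSq_apply]
  simp
  ring

include hu in
theorem norm_zf_le : ‖zf γ u‖ ≤ √‖u‖ := by
  apply Real.le_sqrt_of_sq_le
  have h1 := zf_norm_sq hγ hu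
  have h2 := normSq_Tf (u := u) (γ := γ)
  have h3 := Tf_re_nonneg γ u
  have h4 := norm_Tf_add (u := u) (γ := γ)
  have h5 : ‖Tf γ u - 2 * γ‖ ≤ ‖2 * γ + Tf γ u‖ := by
    refine le_of_sq_le_sq ?_ (norm_nonneg _)
    have : 0 ≤ 8 * γ * (Tf γ u).re := by positivity
    linarith
  have h6 : 0 < ‖2 * γ + Tf γ u‖ := by linarith
  refine le_of_mul_le_mul_right ?_ h6
  rw [h1]
  gcongr

include hu in
theorem Tf_re_ge {β : ℝ} (h : ‖zf γ u‖ ≤ β * √‖u‖) :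
    (1 - β ^ 4) * γ / 2 ≤ (Tf γ u).re := by
  have h1 := zf_norm_sq hγ hu
  have h2 := normSq_Tf (u := u) (γ := γ)
  have h4 := norm_Tf_add (u := u) (γ := γ)
  have hu' := norm_pos_iff.2 hu
  have h5 : ‖Tf γ u - 2 * γ‖ ≤ β ^ 2 * ‖2 * γ + Tf γ u‖ := by
    refine le_of_mul_le_mul_left ?_ hu'
    rw [← h1]
    calc ‖zf γ u‖ ^ 2 * ‖2 * γ + Tf γ u‖ ≤ (β * √‖u‖) ^ 2 * ‖2 * γ + Tf γ u‖ := by gcongr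
      _ = ‖u‖ * (β ^ 2 * ‖2 * γ + Tf γ u‖) := by
        rw [mul_pow, Real.sq_sqrt hu'.le]; ring
  have h6 : ‖Tf γ u - 2 * γ‖ ^ 2 ≤ β ^ 4 * ‖2 * γ + Tf γ u‖ ^ 2 := by
    calc _ ≤ (β ^ 2 * ‖2 * γ + Tf γ u‖) ^ 2 := by gcongr
      _ = _ := by ring
  rcases le_total 1 (β ^ 4) with h7 | h7
  · exact le_trans (by nlinarith) (Tf_re_nonneg γ u)
  · have h8 : (2 * γ) ^ 2 ≤ ‖2 * γ + Tf γ u‖ ^ 2 := by gcongr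
    have h9 : (1 - β ^ 4) * (2 * γ) ^ 2 ≤ 8 * γ * (Tf γ u).re := by nlinarith
    refine le_of_mul_le_mul_left (a := 8 * γ) ?_ (by positivity)
    linarith

end

/-- The contribution of the zero `zf γ u`, present when the zero is well inside the disc. -/
noncomputable def sg (β t γ : ℝ) (u : ℂ) : ℂ :=
  open Classical in if ‖zf γ u‖ ≤ β * √‖u‖ then Complex.exp (t * (2 * Tf γ u - 4 * γ)) / Tf γ u else 0

/-- The radius of the contour that avoids the zero `zf γ u`. -/
noncomputable def rd (b β b' γ : ℝ) (u : ℂ) : ℝ :=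
  open Classical in if ‖zf γ u‖ ≤ β * √‖u‖ then b' * √‖u‖ else b * √‖u‖

theorem pair_residue {γ t b β b' s : ℝ} (hγ : 0 < γ) {u : ℂ} (hu : u ≠ 0) (hu1 : ‖u‖ < 1)
    (hb : 0 < b) (hbβ : b < β) (hβb : β < b') (hb1 : b' < 1)
    (hs : 0 < s) (hsb : s ≤ b * √‖u‖) (hd : ∀ z, z ≠ 0 → ‖z‖ ≤ s → df γ u z ≠ 0)
    {g h : ℂ → ℂ} (hg : ∀ z, s ≤ ‖z‖ → ‖z‖ ≤ b' * √‖u‖ → DifferentiableAt ℂ g z)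
    (hh : ∀ z, s ≤ ‖z‖ → ‖z‖ ≤ b' * √‖u‖ → DifferentiableAt ℂ h z) :
    cint s (fun z => Complex.exp (t * ef γ u z) * (g z + h z * (df γ u z)⁻¹)) =
      sg β t γ u * h (zf γ u) + cint (rd b β b' γ u)
        (fun z => Complex.exp (t * ef γ u z) * (g z + h z * (df γ u z)⁻¹)) := by
  have hu' := norm_pos_iff.2 hu
  have hR : 0 < √‖u‖ := Real.sqrt_pos.2 hu'
  have hR2 : √‖u‖ * √‖u‖ = ‖u‖ := Real.mul_self_sqrt hu'.le
  have hz0 := zf_ne (u := u) hγ hu1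
  have hz0' := norm_pos_iff.2 hz0
  have hle := norm_zf_le hγ hu
  have hu2 := one_sub_ne hu1
  have far : ∀ z : ℂ, ‖z‖ ≤ b' * √‖u‖ → z + u / zf γ u ≠ 0 := by
    intro z hz h0
    have e : ‖z‖ = ‖u‖ / ‖zf γ u‖ := by
      rw [← norm_div, eq_neg_of_add_eq_zero_left h0, norm_neg]
    have : √‖u‖ ≤ ‖u‖ / ‖zf γ u‖ := by
      rw [le_div_iff₀ hz0']
      nlinarith
    nlinarith
  unfold sg rd
  split_ifs with hc
  · set H : ℂ → ℂ := fun z => Complex.exp (t * ef γ u z) * (g z * (z - zf γ u) +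
      h z * (-2 * u * z / ((1 - u) * (z + u / zf γ u)))) with hH
    have key : ∀ z, z ≠ 0 → ‖z‖ ≤ b' * √‖u‖ → z ≠ zf γ u →
        Complex.exp (t * ef γ u z) * (g z + h z * (df γ u z)⁻¹) = H z / (z - zf γ u) := by
      intro z hz hz' hzz
      have h1 := far z hz'
      have h2 : z - zf γ u ≠ 0 := sub_ne_zero.2 hzz
      have e : (df γ u z)⁻¹ = (-2 * u * z / ((1 - u) * (z + u / zf γ u))) / (z - zf γ u) := by
        rw [df_factor hγ hu hu1 hz]
        field_simp
      rw [e, hH]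
      simp only
      generalize -2 * u * z / ((1 - u) * (z + u / zf γ u)) = W
      field_simp
    have hsz : s < ‖zf γ u‖ := by
      by_contra hcon
      exact hd _ hz0 (not_lt.1 hcon) (df_zf hγ hu hu1)
    have hzb : ‖zf γ u‖ < b' * √‖u‖ := hc.trans_lt (by gcongr)
    have P := cint_pole hs hsz hzb (h := H) (fun z h1 h2 => by
      have hz : z ≠ 0 := norm_pos_iff.1 (hs.trans_le h1)
      have h3 := far z h2
      have h4 := hg z h1 h2
      have h5 := hh z h1 h2
      have h6 : (1 - u) * (z + u / zf γ u) ≠ 0 := mul_ne_zero hu2 h3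
      rw [hH]
      fun_prop (disch := assumption))
    have hsb' : s ≤ b' * √‖u‖ := hsz.le.trans hzb.le
    rw [cint_congr hs (g := fun z => H z / (z - zf γ u)) fun z hz => key z
      (norm_pos_iff.1 (hz ▸ hs)) (hz.le.trans hsb') (fun h0 => hsz.ne' (h0 ▸ hz)), P,
      cint_congr (hz0'.trans hzb) (f := fun z => Complex.exp (t * ef γ u z) * _) fun z hz => key z
      (norm_pos_iff.1 (hz ▸ hz0'.trans hzb)) hz.le (fun h0 => hzb.ne (h0 ▸ hz))]
    have e2 : H (zf γ u) / zf γ u =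
        -(Complex.exp (t * (2 * Tf γ u - 4 * γ)) / Tf γ u * h (zf γ u)) := by
      have hT : (1 - u) / u * (zf γ u + u / zf γ u) ≠ 0 :=
        mul_ne_zero (div_ne_zero hu2 hu) (far _ hzb.le)
      have h7 : Tf γ u = (1 - u) / u * (zf γ u + u / zf γ u) / 2 := by
        rw [← two_Tf hγ hu hu1]; ring
      rw [hH]
      simp only
      rw [ef_zf hγ hu hu1, sub_self, mul_zero, zero_add]
      set Ex := Complex.exp (t * (2 * Tf γ u - 4 * γ))
      rw [h7]
      have h8 := far _ hzb.le
      set q := zf γ u + u / zf γ u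
      field_simp
    rw [e2]
    ring
  · rw [zero_mul, zero_add]
    have hbb : b * √‖u‖ ≤ b' * √‖u‖ := by gcongr; linarith
    refine cint_radius hs hsb fun z h1 h2 => ?_
    have hz : z ≠ 0 := norm_pos_iff.1 (hs.trans_le h1)
    have h3 : df γ u z ≠ 0 := by
      rw [df_factor hγ hu hu1 hz]
      have h4 := far z (h2.trans hbb)
      have h5 : z - zf γ u ≠ 0 := by
        intro h0
        rw [← sub_eq_zero.1 h0] at hc
        have : b * √‖u‖ ≤ β * √‖u‖ := by gcongr
        exact hc (h2.trans this)
      refine mul_ne_zero (neg_ne_zero.2 (div_ne_zero hu2 ?_)) (mul_ne_zero h5 h4)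
      exact mul_ne_zero (mul_ne_zero two_ne_zero hu) hz
    have h4 := hg z h1 (h2.trans hbb)
    have h5 := hh z h1 (h2.trans hbb)
    fun_prop (disch := assumption)

/-- The point `e^{-κ+ix}` of the circle of radius `e^{-κ}`. -/
noncomputable def eu (κ x : ℝ) : ℂ := Complex.exp (-κ + x * Complex.I)

theorem eu_ne (κ x : ℝ) : eu κ x ≠ 0 := Complex.exp_ne_zero _

theorem norm_eu (κ x : ℝ) : ‖eu κ x‖ = Real.exp (-κ) := by
  rw [eu, Complex.norm_exp]; simp

theorem norm_eu_lt {κ : ℝ} (hκ : 0 < κ) (x : ℝ) : ‖eu κ x‖ < 1 := by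
  rw [norm_eu]; simpa using hκ

theorem nu_eu (κ x : ℝ) : (1 - eu κ x) ^ 2 / eu κ x =
    (((Real.exp κ + Real.exp (-κ)) * Real.cos x - 2 : ℝ) : ℂ) +
      (((Real.exp (-κ) - Real.exp κ) * Real.sin x : ℝ) : ℂ) * Complex.I := by
  have h := eu_ne κ x
  have e1 : (1 - eu κ x) ^ 2 / eu κ x = eu κ x + (eu κ x)⁻¹ - 2 := by
    field_simp; ring
  have e2 : (eu κ x)⁻¹ = Complex.exp (κ + (-x : ℝ) * Complex.I) := by
    rw [eu, ← Complex.exp_neg]; congr 1; push_cast; ring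
  rw [e1, e2, eu, Complex.exp_add, Complex.exp_add, Complex.exp_mul_I, Complex.exp_mul_I]
  push_cast
  rw [Complex.cos_neg, Complex.sin_neg]
  ring

theorem exp_add_exp_neg_le {κ : ℝ} (h : 0 < κ) (h1 : κ ≤ 1) :
    Real.exp κ + Real.exp (-κ) ≤ 2 + 2 * κ ^ 2 := by
  have a := abs_le.1 (Real.abs_exp_sub_one_sub_id_le (x := κ) (by rw [abs_of_pos h]; exact h1))
  have b := abs_le.1 (Real.abs_exp_sub_one_sub_id_le (x := -κ) (by rw [abs_neg, abs_of_pos h]; exact h1))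
  nlinarith

theorem exp_sub_exp_neg_le {κ : ℝ} (h : 0 < κ) (h1 : κ ≤ 1) :
    Real.exp κ - Real.exp (-κ) ≤ 4 * κ := by
  have a := abs_le.1 (Real.abs_exp_sub_one_sub_id_le (x := κ) (by rw [abs_of_pos h]; exact h1))
  have b := abs_le.1 (Real.abs_exp_sub_one_sub_id_le (x := -κ) (by rw [abs_neg, abs_of_pos h]; exact h1))
  nlinarith

theorem two_le_exp_add (κ : ℝ) : 2 ≤ Real.exp κ + Real.exp (-κ) := by
  have := Real.add_one_le_exp κ
  have := Real.add_one_le_exp (-κ)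
  linarith

theorem le_one_sub_norm_eu {κ : ℝ} (h : 0 < κ) (h1 : κ ≤ 1) : κ / 2 ≤ 1 - Real.exp (-κ) := by
  have := Real.add_one_le_exp κ
  have e : Real.exp (-κ) * Real.exp κ = 1 := by rw [← Real.exp_add]; simp
  have := Real.exp_pos (-κ)
  nlinarith

theorem re_add_le {p q : ℂ} {m : ℝ} (hp : ‖p‖ ^ 2 = m) (hq : ‖q‖ ^ 2 = m) :
    (p.re + q.re) ^ 2 ≤ 2 * (m + (p * q).re) := by
  rw [← Complex.normSq_eq_norm_sq, Complex.normSq_apply] at hp hq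
  rw [Complex.mul_re]
  nlinarith [sq_nonneg (p.im - q.im)]

/-- The exponent is strictly negative away from the zero of `df`. -/
theorem re_ef_le {γ κ x c : ℝ} (hκ : 0 < κ) (hκ1 : κ ≤ 1) (hκγ : 3 * κ ≤ γ) (hc : 0 < c)
    (hc1 : c ≤ 1) (hcγ : 3 * (1 / c - c) ≤ γ) {z : ℂ} (hz : ‖z‖ = c * √‖eu κ x‖) :
    (ef γ (eu κ x) z).re ≤ -2 * γ := by
  set u := eu κ x with hu
  have hu0 : u ≠ 0 := eu_ne κ x
  have hu' : 0 < ‖u‖ := norm_pos_iff.2 hu0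
  have hR : 0 < √‖u‖ := Real.sqrt_pos.2 hu'
  have hR2 : √‖u‖ ^ 2 = ‖u‖ := Real.sq_sqrt hu'.le
  have hz' : 0 < ‖z‖ := by rw [hz]; positivity
  have hz0 : z ≠ 0 := norm_pos_iff.1 hz'
  set p : ℂ := c * ((1 - u) / z) with hp
  set q : ℂ := (c : ℂ)⁻¹ * ((1 - u) * z / u) with hq
  have hc0 : (c : ℂ) ≠ 0 := by exact_mod_cast hc.ne'
  set m := ‖(1 - u) ^ 2 / u‖ with hm
  have hpm : ‖p‖ ^ 2 = m := by
    rw [hp, hm, norm_mul, norm_div, norm_div, norm_pow, hz, Complex.norm_real, Real.norm_eq_abs,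
      abs_of_pos hc]
    field_simp
    rw [hR2]
  have hqm : ‖q‖ ^ 2 = m := by
    rw [hq, hm, norm_mul, norm_div, norm_div, norm_mul, norm_pow, hz, norm_inv, Complex.norm_real,
      Real.norm_eq_abs, abs_of_pos hc]
    field_simp
    rw [hR2]
  have hpq : p * q = (1 - u) ^ 2 / u := by
    rw [hp, hq]; field_simp
  have hef : ef γ u z = (1 / c - c : ℝ) * p + c * (p + q) - 4 * γ := by
    rw [ef, hp, hq]; push_cast; field_simp; ring
  have key := re_add_le hpm hqm
  rw [hpq] at key
  have hre : ((1 - u) ^ 2 / u).re = (Real.exp κ + Real.exp (-κ)) * Real.cos x - 2 := by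
    rw [hu, nu_eu, Complex.add_re, Complex.re_ofReal_mul, Complex.ofReal_re, Complex.I_re, mul_zero,
      add_zero]
  have hmv : m = (Real.exp κ + Real.exp (-κ)) - 2 * Real.cos x := by
    have h2 := two_le_exp_add κ
    have h3 := Real.cos_le_one x
    have h0 : 0 ≤ m := norm_nonneg _
    have : m ^ 2 = ((Real.exp κ + Real.exp (-κ)) - 2 * Real.cos x) ^ 2 := by
      rw [hm, hu, nu_eu, ← Complex.normSq_eq_norm_sq, Complex.normSq_add_mul_I]
      have e := Real.sin_sq_add_cos_sq x
      have e2 : Real.exp κ * Real.exp (-κ) = 1 := by rw [← Real.exp_add]; simp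
      have e3 : (Real.exp (-κ) - Real.exp κ) ^ 2 = (Real.exp κ + Real.exp (-κ)) ^ 2 - 4 := by
        linear_combination (-4) * e2
      rw [mul_pow, e3]
      linear_combination ((Real.exp κ + Real.exp (-κ)) ^ 2 - 4) * e
    exact (sq_eq_sq₀ h0 (by linarith)).1 this
  have hexp := exp_add_exp_neg_le hκ hκ1
  have h2 := two_le_exp_add κ
  have hc1' := Real.cos_le_one x
  have hc2' := Real.neg_one_le_cos x
  have h3 : p.re + q.re ≤ 3 * κ := by
    refine abs_le_of_sq_le_sq' (by nlinarith) (by positivity) |>.2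
  have h4 : p.re ≤ 3 := by
    have : p.re ≤ ‖p‖ := Complex.re_le_norm p
    have h5 : ‖p‖ ≤ 3 := by
      refine le_of_sq_le_sq ?_ (by norm_num)
      rw [hpm, hmv]
      nlinarith
    linarith
  have h6 : (ef γ u z).re = (1 / c - c) * p.re + c * (p.re + q.re) - 4 * γ := by
    rw [hef]
    simp only [Complex.sub_re, Complex.add_re, Complex.re_ofReal_mul]
    simp
  have h7 : 0 ≤ 1 / c - c := by
    have : 1 ≤ 1 / c := by rw [le_div_iff₀ hc]; linarith
    linarith
  rw [h6]
  have h8 : (1 / c - c) * p.re ≤ (1 / c - c) * 3 := by gcongr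
  have h9 : c * (p.re + q.re) ≤ 3 * κ := by
    calc c * (p.re + q.re) ≤ c * (3 * κ) := by gcongr
      _ ≤ 1 * (3 * κ) := by gcongr
      _ = _ := one_mul _
  linarith

theorem df_lower {γ κ x c δ : ℝ} (hγ : 0 < γ) (hκ : 0 < κ) (hκ1 : κ ≤ 1) (hc : 0 < c)
    (hc1 : c < 1) (hδ : 0 ≤ δ) {z : ℂ} (hz : ‖z‖ = c * √‖eu κ x‖)
    (hs : δ * √‖eu κ x‖ ≤ |‖z‖ - ‖zf γ (eu κ x)‖|) :
    κ * (δ * (1 - c) / 4) ≤ ‖df γ (eu κ x) z‖ := by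
  set u := eu κ x with hu
  have hu0 : u ≠ 0 := eu_ne κ x
  have hu' : 0 < ‖u‖ := norm_pos_iff.2 hu0
  have hu1 : ‖u‖ < 1 := norm_eu_lt hκ x
  have hR : 0 < √‖u‖ := Real.sqrt_pos.2 hu'
  have hR1 : √‖u‖ ≤ 1 := Real.sqrt_le_one.2 hu1.le
  have hR2 : √‖u‖ * √‖u‖ = ‖u‖ := Real.mul_self_sqrt hu'.le
  have hz' : 0 < ‖z‖ := by rw [hz]; positivity
  have hz0 : z ≠ 0 := norm_pos_iff.1 hz'
  have hf0 := norm_pos_iff.2 (zf_ne (u := u) hγ hu1)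
  have hle := norm_zf_le hγ hu0
  rw [df_factor hγ hu0 hu1 hz0, norm_mul, norm_neg, norm_div, norm_mul, norm_mul, norm_mul]
  have h1 : κ / 2 ≤ ‖1 - u‖ := by
    have := norm_sub_norm_le 1 u
    rw [norm_one, hu, norm_eu] at this
    exact (le_one_sub_norm_eu hκ hκ1).trans this
  have h2 : δ * √‖u‖ ≤ ‖z - zf γ u‖ := hs.trans (abs_norm_sub_norm_le _ _)
  have h3 : (1 - c) * √‖u‖ ≤ ‖z + u / zf γ u‖ := by
    have h4 : √‖u‖ ≤ ‖u / zf γ u‖ := by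
      rw [norm_div, le_div_iff₀ hf0]
      nlinarith
    have := norm_sub_le_norm_add (u / zf γ u) z
    rw [add_comm] at this
    linarith
  have h4 : ‖(2 : ℂ)‖ = 2 := by simp
  calc κ * (δ * (1 - c) / 4) ≤ (κ / 2) / (2 * ‖u‖ * 1) * ((δ * √‖u‖) * ((1 - c) * √‖u‖)) := by
        rw [show (δ * √‖u‖) * ((1 - c) * √‖u‖) = δ * (1 - c) * ‖u‖ by rw [mul_mul_mul_comm, hR2]]
        apply le_of_eq
        generalize ‖u‖ = n at hu'
        field_simp
        ring
    _ ≤ ‖1 - u‖ / (2 * ‖u‖ * ‖z‖) * ((δ * √‖u‖) * ((1 - c) * √‖u‖)) := by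
        have : 0 ≤ (1 - c) := by linarith
        have : ‖z‖ ≤ 1 := by rw [hz]; nlinarith
        gcongr
    _ ≤ _ := by
        rw [h4]
        have : 0 ≤ (1 - c) := by linarith
        gcongr

theorem inv_one_add_le {c Y : ℝ} (hc : 0 < c) (hY : 0 ≤ Y) :
    Real.exp (-(c * Y)) ≤ (1 + 1 / c) / (1 + Y) := by
  have h1 := Real.add_one_le_exp (c * Y)
  rw [Real.exp_neg, inv_eq_one_div, div_le_div_iff₀ (Real.exp_pos _) (by positivity)]
  calc 1 * (1 + Y) ≤ (1 + 1 / c) * (c * Y + 1) := by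
        have : (1 + 1 / c) * (c * Y + 1) = 1 + Y + (c * Y + 1 / c) := by field_simp; ring
        rw [this]
        have : 0 ≤ c * Y + 1 / c := by positivity
        linarith
    _ ≤ _ := by gcongr

set_option maxHeartbeats 400000 in
theorem sg_bound {γ β : ℝ} (hγ : 0 < γ) (hβ0 : 0 < β) (hβ : β < 1) :
    ∃ C, 0 < C ∧ ∀ t κ x : ℝ, 0 < t → 0 < κ → κ ≤ 1 → t * κ ^ 2 ≤ 1 → |x| ≤ Real.pi →
      ‖sg β t γ (eu κ x)‖ ≤ C / (1 + t * x ^ 2) := by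
  have hβ4 : β ^ 4 < 1 := pow_lt_one₀ hβ0.le hβ (by norm_num)
  set a0 := (1 - β ^ 4) * γ / 2 with ha0
  have ha0p : 0 < a0 := by
    have : 0 < 1 - β ^ 4 := by linarith
    positivity
  set K := 2 + 4 / a0 ^ 2 with hK
  have hpi := Real.pi_pos
  set c := 2 / (Real.pi ^ 2 * γ) with hc
  have hcp : 0 < c := by positivity
  refine ⟨Real.exp (K / (2 * γ)) * (1 + 1 / c) / a0, by positivity, ?_⟩
  intro t κ x ht hκ hκ1 htκ hx
  unfold sg
  split_ifs with hif
  swap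
  · rw [norm_zero]; positivity
  set u := eu κ x with hu
  have hu0 : u ≠ 0 := eu_ne κ x
  have hge := Tf_re_ge hγ hu0 hif
  rw [← ha0] at hge
  have hsq := Tf_sq γ u
  rw [hu, nu_eu, ← hu] at hsq
  set T := Tf γ u
  have hre := congrArg Complex.re hsq
  have him := congrArg Complex.im hsq
  have e4 : (4 * (γ : ℂ) ^ 2).re = 4 * γ ^ 2 ∧ (4 * (γ : ℂ) ^ 2).im = 0 := by
    have : (4 * (γ : ℂ) ^ 2) = ((4 * γ ^ 2 : ℝ) : ℂ) := by push_cast; ring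
    rw [this]
    exact ⟨Complex.ofReal_re _, Complex.ofReal_im _⟩
  rw [sq, Complex.mul_re, Complex.add_re, Complex.add_re, e4.1] at hre
  rw [sq, Complex.mul_im, Complex.add_im, Complex.add_im, e4.2] at him
  simp only [Complex.re_ofReal_mul, Complex.im_ofReal_mul, Complex.ofReal_re, Complex.ofReal_im,
    Complex.I_re, Complex.I_im, mul_zero, mul_one, add_zero, zero_add] at hre him
  have h1 := exp_add_exp_neg_le hκ hκ1
  have h2 := exp_sub_exp_neg_le hκ hκ1
  have h3 := two_le_exp_add κ
  have h4 : 0 ≤ Real.exp κ - Real.exp (-κ) := by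
    have : Real.exp (-κ) ≤ Real.exp κ := Real.exp_le_exp.2 (by linarith)
    linarith
  have hb : T.im ^ 2 ≤ 4 / a0 ^ 2 * κ ^ 2 := by
    have h5 : (2 * T.re * T.im) ^ 2 ≤ (4 * κ) ^ 2 := by
      rw [show 2 * T.re * T.im = (Real.exp (-κ) - Real.exp κ) * Real.sin x by linarith, mul_pow,
        show (Real.exp (-κ) - Real.exp κ) ^ 2 = (Real.exp κ - Real.exp (-κ)) ^ 2 by ring]
      have := Real.sin_sq_le_one x
      calc (Real.exp κ - Real.exp (-κ)) ^ 2 * Real.sin x ^ 2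
          ≤ (4 * κ) ^ 2 * 1 := by gcongr
        _ = _ := mul_one _
    have h6 : a0 ^ 2 * T.im ^ 2 ≤ 4 * κ ^ 2 := by
      have : a0 ^ 2 ≤ T.re ^ 2 := by gcongr
      nlinarith [sq_nonneg T.im]
    rw [div_mul_eq_mul_div, le_div_iff₀ (by positivity)]
    linarith
  have hcos := Real.cos_le_one_sub_mul_cos_sq hx
  have hy : T.re ^ 2 ≤ 4 * γ ^ 2 + (-(4 / Real.pi ^ 2) * x ^ 2 + K * κ ^ 2) := by
    have h7 : (Real.exp κ + Real.exp (-κ)) * Real.cos x - 2 ≤ 2 * Real.cos x - 2 + 2 * κ ^ 2 := by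
      have := Real.cos_le_one x
      nlinarith
    have h8 : 2 * Real.cos x - 2 ≤ -(4 / Real.pi ^ 2) * x ^ 2 := by
      have : 4 / Real.pi ^ 2 = 2 * (2 / Real.pi ^ 2) := by ring
      rw [this]; linarith
    rw [hK]
    nlinarith
  set y := -(4 / Real.pi ^ 2) * x ^ 2 + K * κ ^ 2 with hyd
  clear_value y T
  have h9 : T.re ≤ 2 * γ + y / (4 * γ) := by
    have h10 : -(4 * γ ^ 2) ≤ y := by nlinarith [sq_nonneg T.re]
    have h11 : 0 ≤ 2 * γ + y / (4 * γ) := by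
      have : -γ ≤ y / (4 * γ) := by
        rw [le_div_iff₀ (by positivity)]; linarith
      linarith
    refine le_of_sq_le_sq (hy.trans ?_) h11
    have : (2 * γ + y / (4 * γ)) ^ 2 = 4 * γ ^ 2 + y + (y / (4 * γ)) ^ 2 := by
      field_simp; ring
    rw [this]
    exact le_add_of_nonneg_right (sq_nonneg _)
  rw [norm_div, Complex.norm_exp]
  have h12 : (t * (2 * T - 4 * γ) : ℂ).re = t * (2 * T.re - 4 * γ) := by
    rw [Complex.re_ofReal_mul]; simp
  have h13 : t * (2 * T.re - 4 * γ) ≤ K / (2 * γ) + -(c * (t * x ^ 2)) := by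
    calc t * (2 * T.re - 4 * γ) ≤ t * (y / (2 * γ)) := by
          gcongr
          have : y / (2 * γ) = 2 * (y / (4 * γ)) := by field_simp; ring
          linarith
      _ = (K / (2 * γ)) * (t * κ ^ 2) + -(c * (t * x ^ 2)) := by
          rw [hyd, hc]; field_simp; ring
      _ ≤ (K / (2 * γ)) * 1 + -(c * (t * x ^ 2)) := by gcongr
      _ = _ := by rw [mul_one]
  have h14 : a0 ≤ ‖T‖ := hge.trans (Complex.re_le_norm T)
  rw [h12]
  calc Real.exp (t * (2 * T.re - 4 * γ)) / ‖T‖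
      ≤ Real.exp (K / (2 * γ) + -(c * (t * x ^ 2))) / a0 := by gcongr
    _ = Real.exp (K / (2 * γ)) * Real.exp (-(c * (t * x ^ 2))) / a0 := by rw [Real.exp_add]
    _ ≤ Real.exp (K / (2 * γ)) * ((1 + 1 / c) / (1 + t * x ^ 2)) / a0 := by
        gcongr
        exact inv_one_add_le hcp (by positivity)
    _ = _ := by field_simp

theorem rd_bound {γ b β b' : ℝ} (hγ : 0 < γ) (hb : 0 < b) (hbβ : b < β) (hβb : β < b')
    (hb1 : b' < 1) (hbγ : 3 * (1 / b - b) ≤ γ) :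
    ∃ C, 0 < C ∧ ∀ t κ x : ℝ, 0 < t → 0 < κ → κ ≤ 1 → 3 * κ ≤ γ → ∀ z : ℂ,
      ‖z‖ = rd b β b' γ (eu κ x) → ‖Complex.exp (t * ef γ (eu κ x) z)‖ ≤ Real.exp (-2 * γ * t) ∧
        df γ (eu κ x) z ≠ 0 ∧ ‖(df γ (eu κ x) z)⁻¹‖ ≤ C / κ := by
  set δ := min (β - b) (b' - β) with hδ
  have hδ0 : 0 < δ := lt_min (by linarith) (by linarith)
  have hb1' : 0 < 1 - b' := by linarith
  refine ⟨(δ * (1 - b') / 4)⁻¹, by positivity, ?_⟩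
  intro t κ x ht hκ hκ1 hκγ z hz
  have hR : 0 < √‖eu κ x‖ := Real.sqrt_pos.2 (norm_pos_iff.2 (eu_ne κ x))
  have main : ∃ c, b ≤ c ∧ c ≤ b' ∧ ‖z‖ = c * √‖eu κ x‖ ∧
      δ * √‖eu κ x‖ ≤ |‖z‖ - ‖zf γ (eu κ x)‖| := by
    unfold rd at hz
    split_ifs at hz with hif
    · refine ⟨b', by linarith, le_rfl, hz, ?_⟩
      calc δ * √‖eu κ x‖ ≤ (b' - β) * √‖eu κ x‖ := by gcongr; exact min_le_right _ _
        _ ≤ ‖z‖ - ‖zf γ (eu κ x)‖ := by rw [hz]; linarith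
        _ ≤ _ := le_abs_self _
    · refine ⟨b, le_rfl, by linarith, hz, ?_⟩
      calc δ * √‖eu κ x‖ ≤ (β - b) * √‖eu κ x‖ := by gcongr; exact min_le_left _ _
        _ ≤ -(‖z‖ - ‖zf γ (eu κ x)‖) := by rw [hz]; linarith
        _ ≤ _ := neg_le_abs _
  obtain ⟨c, h1, h2, h3, h4⟩ := main
  have hc : 0 < c := hb.trans_le h1
  have hcγ : 3 * (1 / c - c) ≤ γ := by
    have : 1 / c ≤ 1 / b := one_div_le_one_div_of_le hb h1
    linarith
  have h5 : κ * (δ * (1 - b') / 4) ≤ ‖df γ (eu κ x) z‖ := by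
    refine le_trans ?_ (df_lower hγ hκ hκ1 hc (by linarith) hδ0.le h3 h4)
    gcongr
  have h6 : 0 < κ * (δ * (1 - b') / 4) := by positivity
  refine ⟨?_, norm_pos_iff.1 (h6.trans_le h5), ?_⟩
  · rw [Complex.norm_exp, Complex.re_ofReal_mul]
    have := re_ef_le (x := x) hκ hκ1 hκγ hc (by linarith) hcγ h3
    apply Real.exp_le_exp.2
    nlinarith
  · rw [norm_inv]
    calc ‖df γ (eu κ x) z‖⁻¹ ≤ (κ * (δ * (1 - b') / 4))⁻¹ := inv_anti₀ h6 h5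
      _ = _ := by rw [mul_inv]; field_simp

section

variable {γ b β b' : ℝ} {u : ℂ}

theorem rd_ge (hbβ : b < β) (hβb : β < b') : b * √‖u‖ ≤ rd b β b' γ u := by
  unfold rd
  split_ifs
  · gcongr; linarith
  · exact le_rfl

theorem rd_le (hbβ : b < β) (hβb : β < b') : rd b β b' γ u ≤ b' * √‖u‖ := by
  unfold rd
  split_ifs
  · exact le_rfl
  · gcongr; linarith

theorem norm_zf_le_of_sg {t : ℝ} (h : sg β t γ u ≠ 0) : ‖zf γ u‖ ≤ β * √‖u‖ := by
  by_contra h0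
  exact h (by simp [sg, h0])

theorem lt_norm_zf {s : ℝ} (hγ : 0 < γ) (hu : u ≠ 0) (hu1 : ‖u‖ < 1)
    (hd : ∀ z, z ≠ 0 → ‖z‖ ≤ s → df γ u z ≠ 0) : s < ‖zf γ u‖ := by
  by_contra hcon
  exact hd _ (zf_ne hγ hu1) (not_lt.1 hcon) (df_zf hγ hu hu1)

end

theorem cint_swap_residue {s₁ s₃ ρ : ℝ} (h1 : 0 < s₁) (h3 : 0 < s₃) (hρ : 0 < ρ) {H : ℂ → ℂ}
    {K : ℂ → ℂ → ℂ} {S z : ℂ}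
    (c3 : Continuous fun p : ℝ × ℝ =>
      H (circleMap 0 s₃ p.1) * K (circleMap 0 s₁ p.2) (circleMap 0 s₃ p.1))
    (cr : Continuous fun p : ℝ × ℝ =>
      H (circleMap 0 ρ p.1) * K (circleMap 0 s₁ p.2) (circleMap 0 ρ p.1))
    (kz : S ≠ 0 → Continuous fun θ => K (circleMap 0 s₁ θ) z)
    (st : ∀ a, ‖a‖ = s₁ → cint s₃ (fun c => H c * K a c) = S * K a z +
      cint ρ (fun c => H c * K a c)) :
    cint s₃ (fun c => cint s₁ fun a => H c * K a c) = S * cint s₁ (fun a => K a z) +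
      cint ρ (fun c => H c * cint s₁ fun a => K a c) := by
  have k1 : Continuous fun θ => S * K (circleMap 0 s₁ θ) z := by
    by_cases h0 : S = 0
    · simp only [h0, zero_mul]
      exact continuous_const
    · exact continuous_const.mul (kz h0)
  have k2 := continuous_cint (X := ℝ) (F := fun θ c => H c * K (circleMap 0 s₁ θ) c) hρ
    (cr.comp continuous_swap)
  have sw := cint_comm (f := fun c a => H c * K a c) hρ h1 cr
  have sw' := cint_comm (f := fun c a => H c * K a c) h3 h1 c3
  rw [sw', cint_congr h1 st]
  refine (cint_add (f := fun a => S * K a z) h1 k1 k2).trans ?_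
  rw [cint_const_mul h1]
  congr 1
  refine sw.symm.trans ?_
  exact cint_congr hρ fun c _ => cint_const_mul h1 _ _

theorem cint_pair2 {γ t b β b' s₁ s₃ : ℝ} (hγ : 0 < γ) {v : ℂ} (hv : v ≠ 0) (hv1 : ‖v‖ < 1)
    (hb : 0 < b) (hbβ : b < β) (hβb : β < b') (hb1 : b' < 1) (hs1 : 0 < s₁)
    (hs : 0 < s₃) (hsb : s₃ ≤ b * √‖v‖) (hd : ∀ z, z ≠ 0 → ‖z‖ ≤ s₃ → df γ v z ≠ 0)
    (hrd : ∀ z, ‖z‖ = rd b β b' γ v → df γ v z ≠ 0) {K : ℂ → ℂ → ℂ}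
    (hK : ∀ a c, ‖a‖ = s₁ → s₃ ≤ ‖c‖ → ‖c‖ ≤ b' * √‖v‖ →
      DifferentiableAt ℂ (fun p : ℂ × ℂ => K p.1 p.2) (a, c)) :
    cint s₃ (fun c => cint s₁ fun a =>
        Complex.exp (t * ef γ v c) * (1 + 2 * γ * (df γ v c)⁻¹) * K a c) =
      2 * γ * sg β t γ v * cint s₁ (fun a => K a (zf γ v)) +
        cint (rd b β b' γ v) (fun c => Complex.exp (t * ef γ v c) * (1 + 2 * γ * (df γ v c)⁻¹) *
          cint s₁ fun a => K a c) := by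
  have hR : 0 < √‖v‖ := Real.sqrt_pos.2 (norm_pos_iff.2 hv)
  have hr1 := rd_ge (γ := γ) (u := v) hbβ hβb
  have hr2 := rd_le (γ := γ) (u := v) hbβ hβb
  have hr0 : 0 < rd b β b' γ v := lt_of_lt_of_le (by positivity) hr1
  have cK : ∀ c, s₃ ≤ ‖c‖ → ‖c‖ ≤ b' * √‖v‖ →
      Continuous fun θ => K (circleMap 0 s₁ θ) c := by
    intro c h1 h2
    refine continuous_circle_of_forall (f := fun a => K a c) hs1 fun a ha => ?_
    exact ContinuousAt.comp (f := fun a => (a, c)) (hK a c ha h1 h2).continuousAt (by fun_prop)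
  have cc : ∀ ρ, 0 < ρ → s₃ ≤ ρ → ρ ≤ b' * √‖v‖ → (∀ z, ‖z‖ = ρ → df γ v z ≠ 0) →
      Continuous fun p : ℝ × ℝ => Complex.exp (t * ef γ v (circleMap 0 ρ p.1)) *
        (1 + 2 * γ * (df γ v (circleMap 0 ρ p.1))⁻¹) *
          K (circleMap 0 s₁ p.2) (circleMap 0 ρ p.1) := by
    intro ρ h0 h1 h2 h3
    refine continuous_iff_continuousAt.2 fun p => ?_
    have e1 := norm_circleMap_pos h0 p.1
    have e2 := norm_circleMap_pos hs1 p.2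
    have h4 : circleMap 0 ρ p.1 ≠ 0 := norm_pos_iff.1 (by rw [e1]; exact h0)
    have h5 := h3 _ e1
    have h6 := (hK _ (circleMap 0 ρ p.1) e2 (by rw [e1]; exact h1)
      (by rw [e1]; exact h2)).continuousAt
    have h7 : DifferentiableAt ℂ (fun c => Complex.exp (t * ef γ v c) *
      (1 + 2 * γ * (df γ v c)⁻¹)) (circleMap 0 ρ p.1) := by fun_prop (disch := assumption)
    refine ContinuousAt.mul ?_ ?_
    · exact ContinuousAt.comp (f := fun p : ℝ × ℝ => circleMap 0 ρ p.1) h7.continuousAt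
        (by fun_prop)
    · exact ContinuousAt.comp (f := fun p : ℝ × ℝ => (circleMap 0 s₁ p.2, circleMap 0 ρ p.1)) h6
        (by fun_prop)
  have hsr : s₃ ≤ rd b β b' γ v := hsb.trans hr1
  have c3 := cc s₃ hs le_rfl (hsr.trans hr2) (fun z hz => hd z (norm_pos_iff.1 (by rw [hz]; exact hs)) hz.le)
  have cr := cc _ hr0 hsr hr2 hrd
  have st : ∀ a, ‖a‖ = s₁ →
      cint s₃ (fun c => Complex.exp (t * ef γ v c) * (1 + 2 * γ * (df γ v c)⁻¹) * K a c) =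
        2 * γ * sg β t γ v * K a (zf γ v) + cint (rd b β b' γ v)
          (fun c => Complex.exp (t * ef γ v c) * (1 + 2 * γ * (df γ v c)⁻¹) * K a c) := by
    intro a ha
    have P := pair_residue (t := t) hγ hv hv1 hb hbβ hβb hb1 hs hsb hd (g := fun c => K a c)
      (h := fun c => 2 * γ * K a c)
      (fun z h1 h2 => DifferentiableAt.comp (f := fun c => (a, c)) z (hK a z ha h1 h2)
        (by fun_prop))
      (fun z h1 h2 => (DifferentiableAt.comp (f := fun c => (a, c)) z (hK a z ha h1 h2)
        (by fun_prop)).const_mul _)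
    have e : ∀ c, Complex.exp (t * ef γ v c) * (1 + 2 * γ * (df γ v c)⁻¹) * K a c =
        Complex.exp (t * ef γ v c) * (K a c + 2 * γ * K a c * (df γ v c)⁻¹) := fun c => by ring
    simp only [e]
    rw [P]
    ring
  have kz : sg β t γ v ≠ 0 → Continuous fun θ => K (circleMap 0 s₁ θ) (zf γ v) := by
    intro h0
    refine cK _ (lt_norm_zf hγ hv hv1 hd).le ?_
    have := norm_zf_le_of_sg h0
    have : β * √‖v‖ ≤ b' * √‖v‖ := by gcongr
    linarith
  refine cint_swap_residue (H := fun c => Complex.exp (t * ef γ v c) *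
    (1 + 2 * γ * (df γ v c)⁻¹)) hs1 hs hr0 c3 cr (fun h0 => kz ?_) st
  exact right_ne_zero_of_mul h0

/-- Intermediate radii close to one. -/
noncomputable def aj (γ j : ℝ) : ℝ := 1 - (9 - j) / 8 * (γ / (6 + γ))

section

variable {γ : ℝ} (hγ : 0 < γ)
include hγ

theorem aj_lt {j k : ℝ} (h : j < k) : aj γ j < aj γ k := by
  have : 0 < γ / (6 + γ) := by positivity
  unfold aj
  nlinarith

theorem aj_pos {j : ℝ} (h : 1 ≤ j) : 0 < aj γ j := by
  have h0 : 0 < γ / (6 + γ) := by positivity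
  have h1 : γ / (6 + γ) < 1 := by rw [div_lt_one (by positivity)]; linarith
  unfold aj
  nlinarith

theorem aj_lt_one {j : ℝ} (h : j < 9) : aj γ j < 1 := by
  have h0 : 0 < γ / (6 + γ) := by positivity
  unfold aj
  nlinarith

theorem aj_gap {j : ℝ} (h : 1 ≤ j) : 3 * (1 / aj γ j - aj γ j) ≤ γ := by
  have h0 := aj_pos hγ h
  have h1 : 6 / (6 + γ) ≤ aj γ j := by
    have h0 : 0 < γ / (6 + γ) := by positivity
    have : 6 / (6 + γ) = 1 - γ / (6 + γ) := by field_simp; ring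
    unfold aj
    rw [this]
    nlinarith
  set a := aj γ j
  rw [div_le_iff₀ (by positivity)] at h1
  have h2 : 1 / a - a ≤ γ / 3 := by
    rw [div_sub' h0.ne', div_le_iff₀ h0]
    rcases le_total a 1 with h3 | h3 <;> nlinarith
  linarith

end

/-- The radius `exp (-κ)` is at the natural distance `t ^ (-1/2)` from one. -/
structure Scl (γ t κ : ℝ) : Prop where
  hγ : 0 < γ
  ht : 1 ≤ t
  hκ : 0 < κ
  hκ1 : κ ≤ 1
  hκγ : 3 * κ ≤ γ
  up : t * κ ^ 2 ≤ 1
  dn : 1 ≤ 4 * t * κ ^ 2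

theorem Scl.ht0 {γ t κ : ℝ} (h : Scl γ t κ) : 0 < t := lt_of_lt_of_le one_pos h.ht

theorem Scl.inv_le {γ t κ : ℝ} (h : Scl γ t κ) : 1 / κ ≤ 2 * t := by
  have := h.hκ
  have := h.ht
  have := h.dn
  rw [div_le_iff₀ h.hκ]
  by_contra hc
  nlinarith [mul_pos h.ht0 h.hκ]

theorem exp_mul_pow_le {c t : ℝ} (hc : 0 < c) (ht : 0 ≤ t) (k : ℕ) :
    Real.exp (-(c * t)) * t ^ k ≤ k.factorial / c ^ k := by
  have h := Real.pow_div_factorial_le_exp (c * t) (by positivity) k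
  rw [Real.exp_neg, inv_mul_eq_div, div_le_div_iff₀ (Real.exp_pos _) (by positivity), mul_comm, ← mul_pow]
  rw [div_le_iff₀ (by positivity)] at h
  linarith

theorem absorb {γ : ℝ} (hγ : 0 < γ) (k : ℕ) : ∃ C, 0 < C ∧ ∀ t κ x : ℝ, Scl γ t κ →
    |x| ≤ Real.pi → Real.exp (-γ * t) * (1 / κ) ^ k ≤ C / (1 + t * x ^ 2) := by
  refine ⟨11 * 2 ^ k * ((k + 1).factorial / γ ^ (k + 1)), by positivity, ?_⟩
  intro t κ x h hx
  have h1 := h.inv_le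
  have h2 := exp_mul_pow_le hγ h.ht0.le (k + 1)
  have hp : x ^ 2 ≤ 10 := by
    have h3 : x ^ 2 ≤ Real.pi ^ 2 := by rw [← sq_abs]; gcongr
    nlinarith [Real.pi_pos, Real.pi_lt_d2]
  have ht := h.ht
  have ht0 := h.ht0
  have hκ := h.hκ
  rw [le_div_iff₀ (by positivity)]
  calc Real.exp (-γ * t) * (1 / κ) ^ k * (1 + t * x ^ 2)
      ≤ Real.exp (-γ * t) * (2 * t) ^ k * (11 * t) := by
        gcongr
        nlinarith
    _ = 11 * 2 ^ k * (Real.exp (-(γ * t)) * t ^ (k + 1)) := by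
        rw [neg_mul, mul_pow]; ring
    _ ≤ _ := by gcongr

/-- Bounds on the pair integral, with the residue and the remaining integral together. -/
theorem pair_bound {γ b β b' : ℝ} (hγ : 0 < γ) (hb : 0 < b) (hbβ : b < β) (hβb : β < b')
    (hb1 : b' < 1) (hbγ : 3 * (1 / b - b) ≤ γ) :
    ∃ C, 0 < C ∧ ∀ t κ x : ℝ, Scl γ t κ → |x| ≤ Real.pi →
      ‖sg β t γ (eu κ x)‖ ≤ C / (1 + t * x ^ 2) ∧
      ∀ z, ‖z‖ = rd b β b' γ (eu κ x) →
        df γ (eu κ x) z ≠ 0 ∧ ∀ (M : ℝ) (g h : ℂ), ‖g‖ ≤ M → ‖h‖ ≤ M →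
          ‖Complex.exp (t * ef γ (eu κ x) z) * (g + h * (df γ (eu κ x) z)⁻¹)‖ ≤
            Real.exp (-γ * t) * (C / (1 + t * x ^ 2)) * M := by
  obtain ⟨C1, p1, h1⟩ := sg_bound (β := β) hγ (hb.trans hbβ) (hβb.trans hb1)
  obtain ⟨C2, p2, h2⟩ := rd_bound hγ hb hbβ hβb hb1 hbγ
  obtain ⟨C3, p3, h3⟩ := absorb hγ 1
  refine ⟨max C1 ((1 + C2) * C3), by positivity, fun t κ x S hx => ⟨?_, fun z hz => ?_⟩⟩
  · refine (h1 t κ x S.ht0 S.hκ S.hκ1 S.up hx).trans ?_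
    have := S.ht0
    gcongr
    exact le_max_left _ _
  obtain ⟨e1, e2, e3⟩ := h2 t κ x S.ht0 S.hκ S.hκ1 S.hκγ z hz
  refine ⟨e2, fun M g h hg hh => ?_⟩
  have hM : 0 ≤ M := (norm_nonneg _).trans hg
  have hκ := S.hκ
  have ht := S.ht0
  have h4 := h3 t κ x S hx
  rw [norm_mul]
  have h5 : ‖g + h * (df γ (eu κ x) z)⁻¹‖ ≤ M * ((1 + C2) * (1 / κ)) := by
    refine (norm_add_le _ _).trans ?_
    rw [norm_mul]
    have : 1 ≤ 1 / κ := by rw [le_div_iff₀ hκ]; linarith [S.hκ1]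
    calc ‖g‖ + ‖h‖ * ‖(df γ (eu κ x) z)⁻¹‖ ≤ M * (1 / κ) + M * (C2 / κ) := by
          gcongr
          nlinarith
      _ = _ := by ring
  calc _ ≤ Real.exp (-2 * γ * t) * (M * ((1 + C2) * (1 / κ))) := by gcongr
    _ = Real.exp (-γ * t) * ((1 + C2) * (Real.exp (-γ * t) * (1 / κ) ^ 1)) * M := by
        rw [show -2 * γ * t = -γ * t + -γ * t by ring, Real.exp_add]; ring
    _ ≤ Real.exp (-γ * t) * ((1 + C2) * (C3 / (1 + t * x ^ 2))) * M := by gcongr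
    _ ≤ _ := by
        rw [← mul_div_assoc]
        gcongr
        exact le_max_right _ _

theorem circleMap_eu (κ x : ℝ) : circleMap 0 (Real.exp (-κ)) x = eu κ x := by
  rw [circleMap, eu, Complex.exp_add]
  push_cast
  ring

theorem cint_eu (κ : ℝ) (f : ℂ → ℂ) :
    cint (Real.exp (-κ)) f = (2 * Real.pi : ℂ)⁻¹ * ∫ x in -Real.pi..Real.pi, f (eu κ x) := by
  rw [cint_eq_shift (Real.exp_ne_zero _) f (-Real.pi)]
  simp only [circleMap_eu]
  congr 2
  ring

theorem cint_eu_scaled {κ t : ℝ} (ht : 0 < t) (f : ℂ → ℂ) :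
    (√t : ℂ) * cint (Real.exp (-κ)) f = (2 * Real.pi : ℂ)⁻¹ *
      ∫ X, (Set.Ioc (-Real.pi * √t) (Real.pi * √t)).indicator (fun X => f (eu κ (X / √t))) X := by
  have hs : 0 < √t := Real.sqrt_pos.2 ht
  rw [cint_eu, MeasureTheory.integral_indicator measurableSet_Ioc,
    ← intervalIntegral.integral_of_le (by nlinarith [Real.pi_pos]),
    intervalIntegral.integral_comp_div (fun X => f (eu κ X)) hs.ne',
    mul_div_cancel_right₀ _ hs.ne', mul_div_cancel_right₀ _ hs.ne', Complex.real_smul]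
  ring

theorem integrable_dom (C : ℝ) : MeasureTheory.Integrable fun X : ℝ => C / (1 + X ^ 2) := by
  simpa only [div_eq_mul_inv] using integrable_inv_one_add_sq.const_mul C

theorem norm_scaled_le {κ t C : ℝ} {f : ℂ → ℂ} (ht : 0 < t) (hC : 0 ≤ C)
    (h : ∀ x, |x| ≤ Real.pi → ‖f (eu κ x)‖ ≤ C / (1 + t * x ^ 2)) (X : ℝ) :
    ‖(Set.Ioc (-Real.pi * √t) (Real.pi * √t)).indicator (fun X => f (eu κ (X / √t))) X‖ ≤
      C / (1 + X ^ 2) := by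
  have hs : 0 < √t := Real.sqrt_pos.2 ht
  by_cases hX : X ∈ Set.Ioc (-Real.pi * √t) (Real.pi * √t)
  · rw [Set.indicator_of_mem hX]
    refine (h _ (abs_le.2 ⟨?_, ?_⟩)).trans_eq ?_
    · rw [le_div_iff₀ hs]; exact hX.1.le
    · rw [div_le_iff₀ hs]; exact hX.2
    · rw [div_pow, Real.sq_sqrt ht.le]
      field_simp
  · rw [Set.indicator_of_notMem hX, norm_zero]
    positivity

theorem norm_cint_eu_le {t κ C : ℝ} {f : ℂ → ℂ} (ht : 0 < t) (hC : 0 ≤ C)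
    (h : ∀ x, |x| ≤ Real.pi → ‖f (eu κ x)‖ ≤ C / (1 + t * x ^ 2)) :
    ‖cint (Real.exp (-κ)) f‖ ≤ C / √t := by
  have hs : 0 < √t := Real.sqrt_pos.2 ht
  rw [le_div_iff₀ hs]
  have e : ‖(√t : ℂ) * cint (Real.exp (-κ)) f‖ = ‖cint (Real.exp (-κ)) f‖ * √t := by
    rw [norm_mul, Complex.norm_real, Real.norm_eq_abs, abs_of_pos hs, mul_comm]
  rw [← e, cint_eu_scaled ht, norm_mul]
  have h1 := MeasureTheory.norm_integral_le_of_norm_le (integrable_dom C)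
    (Eventually.of_forall (norm_scaled_le ht hC h))
  simp only [div_eq_mul_inv C] at h1
  rw [MeasureTheory.integral_const_mul, integral_univ_inv_one_add_sq] at h1
  have h2 : ‖(2 * Real.pi : ℂ)⁻¹‖ = (2 * Real.pi)⁻¹ := by
    rw [norm_inv, norm_mul, Complex.norm_real, Real.norm_eq_abs, abs_of_pos Real.pi_pos]
    simp
  have hp := Real.pi_pos
  rw [h2]
  calc _ ≤ (2 * Real.pi)⁻¹ * (C * Real.pi) := by gcongr
    _ = C / 2 := by field_simp
    _ ≤ C := by linarith

theorem tendsto_cint_eu {κ : ℝ → ℝ} {F : ℝ → ℂ → ℂ} {G : ℝ → ℂ} {C : ℝ} (hC : 0 ≤ C)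
    (hc : ∀ᶠ t in atTop, Continuous fun x => F t (eu (κ t) x))
    (hb : ∀ᶠ t in atTop, ∀ x, |x| ≤ Real.pi → ‖F t (eu (κ t) x)‖ ≤ C / (1 + t * x ^ 2))
    (hl : ∀ X : ℝ, Tendsto (fun t => F t (eu (κ t) (X / √t))) atTop (nhds (G X))) :
    Tendsto (fun t : ℝ => (√t : ℂ) * cint (Real.exp (-κ t)) (F t)) atTop
      (nhds ((2 * Real.pi : ℂ)⁻¹ * ∫ X, G X)) := by
  have ev : ∀ᶠ t : ℝ in atTop, (2 * Real.pi : ℂ)⁻¹ * (∫ X,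
      (Set.Ioc (-Real.pi * √t) (Real.pi * √t)).indicator (fun X => F t (eu (κ t) (X / √t))) X) =
      (√t : ℂ) * cint (Real.exp (-κ t)) (F t) := by
    filter_upwards [eventually_gt_atTop 0] with t ht
    exact (cint_eu_scaled ht _).symm
  refine Tendsto.congr' ev (Tendsto.const_mul _ ?_)
  refine MeasureTheory.tendsto_integral_filter_of_dominated_convergence _ ?_ ?_
    (integrable_dom C) ?_
  · filter_upwards [hc] with t h
    exact ((h.comp (continuous_id.div_const _)).aestronglyMeasurable).indicator measurableSet_Ioc
  · filter_upwards [hb, eventually_gt_atTop 0] with t h ht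
    exact Eventually.of_forall (norm_scaled_le ht hC h)
  · refine Eventually.of_forall fun X => Tendsto.congr' ?_ (hl X)
    have h1 : Tendsto (fun t => Real.pi * √t) atTop atTop :=
      Tendsto.const_mul_atTop Real.pi_pos Real.tendsto_sqrt_atTop
    filter_upwards [h1.eventually_gt_atTop |X|] with t ht
    have := abs_lt.1 ht
    rw [Set.indicator_of_mem]
    exact ⟨by linarith, this.2.le⟩

theorem norm_om_le {γ t κ : ℝ} (S : Scl γ t κ) {w : ℂ} (hw : ‖w‖ ≤ Real.exp (-κ)) :
    ‖om w‖ ≤ 16 * t := by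
  have h1 := le_one_sub_norm_eu S.hκ S.hκ1
  have h2 : κ / 2 ≤ ‖1 - w‖ := by
    have := norm_sub_norm_le (1 : ℂ) w
    rw [norm_one] at this
    linarith
  have hκ := S.hκ
  have h3 : ‖w‖ ≤ 1 := hw.trans (by linarith)
  have h4 := S.dn
  rw [om, norm_div, norm_pow]
  have h5 : (κ / 2) ^ 2 ≤ ‖1 - w‖ ^ 2 := by gcongr
  rw [div_le_iff₀ (by nlinarith)]
  nlinarith [S.ht0]

theorem norm_div_one_sub_le {a c : ℂ} {β : ℝ} (hβ : β < 1) (ha : ‖a‖ ≤ β) (hc : ‖c‖ ≤ 1) :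
    ‖(c - a) / (1 - a * c)‖ ≤ 2 / (1 - β) := by
  have h1 : ‖a * c‖ ≤ β := by
    rw [norm_mul]
    calc _ ≤ ‖a‖ * 1 := by gcongr
      _ ≤ _ := by linarith
  have h2 : 1 - β ≤ ‖1 - a * c‖ := by
    have := norm_sub_norm_le (1 : ℂ) (a * c)
    rw [norm_one] at this
    linarith
  have h3 : ‖c - a‖ ≤ 2 := (norm_sub_le _ _).trans (by linarith)
  have : 0 < 1 - β := by linarith
  rw [norm_div]
  gcongr

theorem exp_neg_mul_le_one {γ t : ℝ} (hγ : 0 < γ) (ht : 0 < t) : Real.exp (-γ * t) ≤ 1 := by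
  rw [Real.exp_le_one_iff]; nlinarith

theorem sqrt_norm_eu_lt {κ : ℝ} (hκ : 0 < κ) (x : ℝ) : √‖eu κ x‖ < 1 := by
  rw [Real.sqrt_lt' one_pos]
  simpa using norm_eu_lt hκ x

theorem pair_single {γ b β b' : ℝ} (hγ : 0 < γ) (hb : 0 < b) (hbβ : b < β) (hβb : β < b')
    (hb1 : b' < 1) (hbγ : 3 * (1 / b - b) ≤ γ) :
    ∃ C, 0 < C ∧ ∀ t κ x s M : ℝ, Scl γ t κ → |x| ≤ Real.pi → 0 < s → s ≤ b * √‖eu κ x‖ →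
      (∀ z, z ≠ 0 → ‖z‖ ≤ s → df γ (eu κ x) z ≠ 0) → ∀ g h : ℂ → ℂ,
      (∀ z, s ≤ ‖z‖ → ‖z‖ ≤ b' * √‖eu κ x‖ → DifferentiableAt ℂ g z ∧ DifferentiableAt ℂ h z ∧
        ‖g z‖ ≤ M ∧ ‖h z‖ ≤ M) →
      ‖cint s (fun z => Complex.exp (t * ef γ (eu κ x) z) * (g z + h z * (df γ (eu κ x) z)⁻¹))‖ ≤
        C / (1 + t * x ^ 2) * M := by
  obtain ⟨C, hC, h0⟩ := pair_bound hγ hb hbβ hβb hb1 hbγ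
  refine ⟨2 * C, by positivity, fun t κ x s M S hx hs hsb hd g h H => ?_⟩
  obtain ⟨h1, h2⟩ := h0 t κ x S hx
  have hu := eu_ne κ x
  have hu1 := norm_eu_lt S.hκ x
  have hR : 0 < √‖eu κ x‖ := Real.sqrt_pos.2 (norm_pos_iff.2 hu)
  have q1 := rd_ge (γ := γ) (u := eu κ x) hbβ hβb
  have q2 := rd_le (γ := γ) (u := eu κ x) hbβ hβb
  have q0 : 0 < rd b β b' γ (eu κ x) := lt_of_lt_of_le (by positivity) q1
  rw [pair_residue hγ hu hu1 hb hbβ hβb hb1 hs hsb hd (fun z p q => (H z p q).1)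
    (fun z p q => (H z p q).2.1)]
  have ht := S.ht0
  have hM : 0 ≤ M := by
    have := (H ((rd b β b' γ (eu κ x) : ℝ) : ℂ) (by
      rw [Complex.norm_real, Real.norm_eq_abs, abs_of_pos q0]; linarith) (by
      rw [Complex.norm_real, Real.norm_eq_abs, abs_of_pos q0]; linarith)).2.2.1
    exact (norm_nonneg _).trans this
  have hC' : 0 ≤ C / (1 + t * x ^ 2) := by positivity
  have B : ‖sg β t γ (eu κ x) * h (zf γ (eu κ x))‖ ≤ C / (1 + t * x ^ 2) * M := by
    by_cases hz : sg β t γ (eu κ x) = 0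
    · rw [hz, zero_mul, norm_zero]; positivity
    · rw [norm_mul]
      have p1 := lt_norm_zf hγ hu hu1 hd
      have p2 := norm_zf_le_of_sg hz
      have p3 : β * √‖eu κ x‖ ≤ b' * √‖eu κ x‖ := by gcongr
      have := (H _ p1.le (p2.trans p3)).2.2.2
      gcongr
  refine (norm_add_le _ _).trans ?_
  have A : ‖cint (rd b β b' γ (eu κ x)) (fun z => Complex.exp (t * ef γ (eu κ x) z) *
      (g z + h z * (df γ (eu κ x) z)⁻¹))‖ ≤ C / (1 + t * x ^ 2) * M := by
    refine norm_cint_le q0 fun z hz => ?_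
    obtain ⟨-, h3⟩ := h2 z hz
    obtain ⟨-, -, h4, h5⟩ := H z (by rw [hz]; linarith) (by rw [hz]; linarith)
    refine (h3 M _ _ h4 h5).trans ?_
    have := exp_neg_mul_le_one hγ ht
    rw [mul_assoc]
    exact mul_le_of_le_one_left (by positivity) this
  calc _ ≤ C / (1 + t * x ^ 2) * M + C / (1 + t * x ^ 2) * M := add_le_add B A
    _ = _ := by ring

theorem N_inner {γ : ℝ} (hγ : 0 < γ) : ∃ C, 0 < C ∧ ∀ t κ x y s : ℝ, Scl γ t κ →
    |x| ≤ Real.pi → |y| ≤ Real.pi → 0 < s → s ≤ aj γ 1 * √‖eu κ x‖ → s ≤ aj γ 1 * √‖eu κ y‖ →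
    (∀ z, z ≠ 0 → ‖z‖ ≤ s → df γ (eu κ x) z ≠ 0) →
    (∀ z, z ≠ 0 → ‖z‖ ≤ s → df γ (eu κ y) z ≠ 0) →
    ‖cint s (fun c => cint s fun a => PN t γ a c (eu κ y) (eu κ x))‖ ≤
      C * t / (1 + t * x ^ 2) / (1 + t * y ^ 2) := by
  have l0 := aj_pos hγ (le_refl 1)
  have l1 : aj γ 1 < aj γ 2 := aj_lt hγ (by norm_num)
  have l2 : aj γ 2 < aj γ 3 := aj_lt hγ (by norm_num)
  have l3 : aj γ 3 < 1 := aj_lt_one hγ (by norm_num)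
  have l4 := aj_gap hγ (le_refl 1)
  obtain ⟨C1, p1, B1⟩ := pair_bound hγ l0 l1 l2 l3 l4
  obtain ⟨C2, p2, B2⟩ := pair_single hγ l0 l1 l2 l3 l4
  set D := 1 + 2 * γ + 2 * (2 / (1 - aj γ 3)) with hD
  have pD : 0 < D := by
    have : 0 < 1 - aj γ 3 := by linarith
    positivity
  refine ⟨16 * ((1 + 2 * γ) * (2 * C1)) * C2 * D, by positivity, ?_⟩
  intro t κ x y s S hx hy hs hsx hsy hdx hdy
  have hu := eu_ne κ x
  have hv := eu_ne κ y
  have hu1 := norm_eu_lt S.hκ x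
  have hv1 := norm_eu_lt S.hκ y
  have ht := S.ht0
  have hRu := sqrt_norm_eu_lt S.hκ x
  have hRv := sqrt_norm_eu_lt S.hκ y
  have hRv0 : 0 < √‖eu κ y‖ := Real.sqrt_pos.2 (norm_pos_iff.2 hv)
  have hRu0 : 0 < √‖eu κ x‖ := Real.sqrt_pos.2 (norm_pos_iff.2 hu)
  set K : ℂ → ℂ → ℂ := fun a c => Complex.exp (t * ef γ (eu κ x) a) *
    (1 + (2 * γ + 2 * ((c - a) / (1 - a * c))) * (df γ (eu κ x) a)⁻¹) with hK
  have lt3 : ∀ {R : ℝ} {c : ℂ}, R < 1 → 0 < R → ‖c‖ ≤ aj γ 3 * R → ‖c‖ ≤ aj γ 3 := by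
    intro R c h1 h2 h3
    have : 0 < aj γ 3 := by linarith
    nlinarith
  have dne : ∀ {a c : ℂ}, ‖a‖ ≤ aj γ 3 → ‖c‖ ≤ aj γ 3 → 1 - a * c ≠ 0 := by
    intro a c h1 h2
    refine one_sub_ne ?_
    rw [norm_mul]
    nlinarith [norm_nonneg a, norm_nonneg c]
  have hsx3 : s ≤ aj γ 3 := by nlinarith
  have rf : ∀ a c, Complex.exp (t * ef γ (eu κ x) a) * Complex.exp (t * ef γ (eu κ y) c) =
      Complex.exp (t * (ef γ (eu κ x) a + ef γ (eu κ y) c)) := by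
    intro a c
    rw [← Complex.exp_add]; congr 1; ring
  have e : (fun c => cint s fun a => PN t γ a c (eu κ y) (eu κ x)) = fun c =>
      om (eu κ x * eu κ y) * cint s fun a => Complex.exp (t * ef γ (eu κ y) c) *
        (1 + 2 * γ * (df γ (eu κ y) c)⁻¹) * K a c := by
    funext c
    rw [← cint_const_mul hs]
    congr 1
    funext a
    simp only [PN, hK, ← rf]
    ring
  have FK : ∀ c, s ≤ ‖c‖ → ‖c‖ ≤ aj γ 3 * √‖eu κ y‖ → ‖cint s fun a => K a c‖ ≤
      C2 / (1 + t * x ^ 2) * D := by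
    intro c h1 h2
    refine B2 t κ x s D S hx hs hsx hdx (fun _ => 1) (fun a => 2 * γ + 2 * ((c - a) / (1 - a * c)))
      fun z h3 h4 => ⟨by fun_prop, ?_, ?_, ?_⟩
    · have := dne (lt3 hRu hRu0 h4) (lt3 hRv hRv0 h2)
      fun_prop (disch := assumption)
    · rw [norm_one, hD]
      have : 0 < 1 - aj γ 3 := by linarith
      have : 0 ≤ 2 * γ + 2 * (2 / (1 - aj γ 3)) := by positivity
      linarith
    · have := norm_div_one_sub_le l3 (lt3 hRu hRu0 h4) ((lt3 hRv hRv0 h2).trans l3.le)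
      refine (norm_add_le _ _).trans ?_
      rw [norm_mul, norm_mul]
      simp only [Complex.norm_ofNat, Complex.norm_real, Real.norm_eq_abs, abs_of_pos hγ]
      linarith
  obtain ⟨A1, A2⟩ := B1 t κ y S hy
  have P := cint_pair2 (t := t) hγ hv hv1 l0 l1 l2 l3 hs hs hsy hdy (fun z hz => (A2 z hz).1)
    (K := K) (by
      intro a c h1 h2 h3
      have q1 := dne (a := a) (c := c) (by rw [h1]; exact hsx3) (lt3 hRv hRv0 h3)
      have q0 : a ≠ 0 := norm_pos_iff.1 (by rw [h1]; exact hs)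
      have q2 := hdx a q0 h1.le
      simp only [hK]
      fun_prop (disch := assumption))
  rw [e, cint_const_mul hs, norm_mul, P]
  have hom := norm_om_le S (w := eu κ x * eu κ y) (by
    rw [norm_mul, norm_eu, norm_eu]
    have : Real.exp (-κ) ≤ 1 := by rw [Real.exp_le_one_iff]; linarith [S.hκ]
    nlinarith [Real.exp_pos (-κ)])
  have q1 := rd_ge (γ := γ) (u := eu κ y) l1 l2
  have q2 := rd_le (γ := γ) (u := eu κ y) l1 l2
  have q0 : 0 < rd (aj γ 1) (aj γ 2) (aj γ 3) γ (eu κ y) := lt_of_lt_of_le (by positivity) q1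
  have T1 : ‖2 * γ * sg (aj γ 2) t γ (eu κ y) * cint s (fun a => K a (zf γ (eu κ y)))‖ ≤
      2 * γ * (C1 / (1 + t * y ^ 2)) * (C2 / (1 + t * x ^ 2) * D) := by
    by_cases hz : sg (aj γ 2) t γ (eu κ y) = 0
    · rw [hz, mul_zero, zero_mul, norm_zero]; positivity
    · have w1 := lt_norm_zf hγ hv hv1 hdy
      have w2 := norm_zf_le_of_sg hz
      have w3 : aj γ 2 * √‖eu κ y‖ ≤ aj γ 3 * √‖eu κ y‖ := by gcongr
      have := FK _ w1.le (w2.trans w3)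
      rw [norm_mul, norm_mul, norm_mul]
      simp only [Complex.norm_ofNat, Complex.norm_real, Real.norm_eq_abs, abs_of_pos hγ]
      gcongr
  have T2 : ‖cint (rd (aj γ 1) (aj γ 2) (aj γ 3) γ (eu κ y)) (fun c =>
      Complex.exp (t * ef γ (eu κ y) c) * (1 + 2 * γ * (df γ (eu κ y) c)⁻¹) *
        cint s fun a => K a c)‖ ≤
      (C1 / (1 + t * y ^ 2)) * (1 + 2 * γ) * (C2 / (1 + t * x ^ 2) * D) := by
    refine norm_cint_le q0 fun z hz => ?_
    rw [norm_mul]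
    have w1 := (A2 z hz).2 (1 + 2 * γ) 1 (2 * γ) (by rw [norm_one]; linarith) (by
      rw [norm_mul, Complex.norm_ofNat, Complex.norm_real, Real.norm_eq_abs, abs_of_pos hγ]
      linarith)
    have w2 := FK z (by rw [hz]; linarith) (by rw [hz]; linarith)
    have w3 := exp_neg_mul_le_one hγ ht
    have w4 : Real.exp (-γ * t) * (C1 / (1 + t * y ^ 2)) * (1 + 2 * γ) ≤
        (C1 / (1 + t * y ^ 2)) * (1 + 2 * γ) := by
      rw [mul_assoc]
      exact mul_le_of_le_one_left (by positivity) w3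
    exact mul_le_mul (w1.trans w4) w2 (norm_nonneg _) (by positivity)
  have T3 := (norm_add_le _ _).trans (add_le_add T1 T2)
  calc _ ≤ 16 * t * (2 * γ * (C1 / (1 + t * y ^ 2)) * (C2 / (1 + t * x ^ 2) * D) +
        (C1 / (1 + t * y ^ 2)) * (1 + 2 * γ) * (C2 / (1 + t * x ^ 2) * D)) := by
        gcongr
    _ ≤ 16 * t * ((1 + 2 * γ) * (C1 / (1 + t * y ^ 2)) * (C2 / (1 + t * x ^ 2) * D) +
        (C1 / (1 + t * y ^ 2)) * (1 + 2 * γ) * (C2 / (1 + t * x ^ 2) * D)) := by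
        gcongr
        linarith
    _ = _ := by field_simp; ring

theorem tiny_facts {γ κ x b s : ℝ} (hγ : 0 < γ) (hκ : 0 < κ) (hb : b ≤ 1) (hb0 : 0 < b)
    (hs : s ≤ b * Real.exp (-κ)) (ht : 4 * γ < (1 - Real.exp (-κ)) * (s⁻¹ - 1)) :
    s ≤ b * √‖eu κ x‖ ∧ ∀ z, z ≠ 0 → ‖z‖ ≤ s → df γ (eu κ x) z ≠ 0 := by
  have h0 := Real.exp_pos (-κ)
  have h1 : Real.exp (-κ) < 1 := by simpa using hκ
  constructor
  · refine hs.trans ?_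
    rw [norm_eu]
    gcongr
    exact Real.le_sqrt_of_sq_le (by nlinarith)
  · intro z hz hzs
    refine df_ne_of_tiny hγ h0 (hs.trans ?_) h1 ht hz hzs (norm_eu κ x).ge (norm_eu κ x).le
    nlinarith

theorem N_bound {γ : ℝ} (hγ : 0 < γ) : ∃ C, 0 < C ∧ ∀ t κ r : ℝ, Scl γ t κ → SmallRad γ r →
    r ≤ Real.exp (-κ) → ‖cint4 (r ^ 3) (r ^ 2) (r ^ 1) (r ^ 0) (GN t γ)‖ ≤ C := by
  obtain ⟨C, hC, B⟩ := N_inner hγ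
  refine ⟨C, hC, fun t κ r S h hr => ?_⟩
  have l0 := aj_pos hγ (le_refl 1)
  have l1 : aj γ 1 < 1 := aj_lt_one hγ (by norm_num)
  have h1 : Real.exp (-κ) < 1 := by simpa using S.hκ
  have h0 := h.2.1
  obtain ⟨s, s0, s1, s2⟩ := exists_tiny (γ := γ) (q := min (r ^ 5) (aj γ 1 * Real.exp (-κ)))
    (lt_min (by positivity) (by positivity)) h1
  have s3 := s1.trans (min_le_left _ _)
  have s4 := s1.trans (min_le_right _ _)
  have ht := S.ht0
  rw [cint4_PN h t hr h1 s0 s3 s2, cint4]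
  have hst : 0 < √t := Real.sqrt_pos.2 ht
  have : C = C * √t / √t := by field_simp
  rw [this]
  refine norm_cint_eu_le ht (by positivity) fun y hy => ?_
  have e : C * √t / (1 + t * y ^ 2) = C * t / (1 + t * y ^ 2) / √t := by
    rw [div_div, div_eq_div_iff (by positivity) (by positivity)]
    have := Real.mul_self_sqrt ht.le
    linear_combination (C * (1 + t * y ^ 2)) * this
  rw [e]
  refine norm_cint_eu_le ht (by positivity) fun x hx => ?_
  obtain ⟨f1, f2⟩ := tiny_facts (x := x) hγ S.hκ l1.le l0 s4 s2
  obtain ⟨f3, f4⟩ := tiny_facts (x := y) hγ S.hκ l1.le l0 s4 s2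
  refine (B t κ x y s S hx hy s0 f1 f3 f2 f4).trans_eq ?_
  ring

theorem eu_div (k X t : ℝ) :
    eu (k / √t) (X / √t) = Complex.exp ((-k + X * Complex.I) / (√t : ℂ)) := by
  rw [eu]; congr 1; push_cast; ring

theorem tendsto_inv_sqrt : Tendsto (fun t : ℝ => ((√t : ℂ))⁻¹) atTop (nhds 0) := by
  have h : Tendsto (fun t : ℝ => (√t)⁻¹) atTop (nhds 0) :=
    tendsto_inv_atTop_zero.comp Real.tendsto_sqrt_atTop
  have := (Complex.continuous_ofReal.tendsto 0).comp h
  simpa [Function.comp_def] using this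

theorem tendsto_exp_div (w : ℂ) :
    Tendsto (fun t : ℝ => Complex.exp (w / (√t : ℂ))) atTop (nhds 1) := by
  have h : Tendsto (fun t : ℝ => w / (√t : ℂ)) atTop (nhds 0) := by
    simpa [div_eq_mul_inv] using tendsto_inv_sqrt.const_mul w
  simpa [Function.comp_def] using (Complex.continuous_exp.tendsto 0).comp h

theorem tendsto_sqrt_mul_one_sub (w : ℂ) :
    Tendsto (fun t : ℝ => (√t : ℂ) * (1 - Complex.exp (w / (√t : ℂ)))) atTop (nhds (-w)) := by
  have hd : HasDerivAt (fun z : ℂ => Complex.exp (w * z)) w 0 := by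
    have := ((hasDerivAt_id (0 : ℂ)).const_mul w).cexp
    simpa using this
  have hs := hasDerivAt_iff_tendsto_slope_zero.1 hd
  have hn : Tendsto (fun t : ℝ => ((√t : ℂ))⁻¹) atTop (nhdsWithin 0 {0}ᶜ) := by
    refine tendsto_nhdsWithin_iff.2 ⟨tendsto_inv_sqrt, ?_⟩
    filter_upwards [eventually_gt_atTop 0] with t ht
    have : √t ≠ 0 := (Real.sqrt_pos.2 ht).ne'
    simpa using this
  have := (hs.comp hn).neg
  refine this.congr fun t => ?_
  simp [div_eq_mul_inv]
  ring

theorem sq_sqrt_ofReal {t : ℝ} (ht : 0 < t) : (√t : ℂ) ^ 2 = t := by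
  rw [← Complex.ofReal_pow, Real.sq_sqrt ht.le]

theorem tendsto_om_div {w : ℂ} (hw : w ≠ 0) :
    Tendsto (fun t : ℝ => om (Complex.exp (w / (√t : ℂ))) / t) atTop (nhds (1 / w ^ 2)) := by
  have h := (tendsto_exp_div w).div ((tendsto_sqrt_mul_one_sub w).pow 2)
    (pow_ne_zero 2 (neg_ne_zero.2 hw))
  rw [neg_sq] at h
  refine h.congr' ?_
  filter_upwards [eventually_gt_atTop 0] with t ht
  simp only [Pi.div_apply, om]
  rw [mul_pow, sq_sqrt_ofReal ht, div_div, mul_comm]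

theorem tendsto_Tf {γ : ℝ} (hγ : 0 < γ) (w : ℂ) :
    Tendsto (fun t : ℝ => Tf γ (Complex.exp (w / (√t : ℂ)))) atTop (nhds (2 * γ)) := by
  have h0 := tendsto_exp_div w
  have h1 : Tendsto (fun t : ℝ => 4 * (γ : ℂ) ^ 2 + (1 - Complex.exp (w / (√t : ℂ))) ^ 2 /
      Complex.exp (w / (√t : ℂ))) atTop (nhds (4 * (γ : ℂ) ^ 2)) := by
    have := (tendsto_const_nhds (x := 4 * (γ : ℂ) ^ 2)).add
      (((tendsto_const_nhds (x := (1 : ℂ))).sub h0).pow 2 |>.div h0 one_ne_zero)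
    simpa using this
  have e : (4 * (γ : ℂ) ^ 2) = ((4 * γ ^ 2 : ℝ) : ℂ) := by push_cast; ring
  have h2 : (4 * (γ : ℂ) ^ 2) ∈ Complex.slitPlane := by
    rw [e]; exact Or.inl (by rw [Complex.ofReal_re]; positivity)
  have h3 := h1.cpow (tendsto_const_nhds (x := (2⁻¹ : ℂ))) h2
  have h4 : (4 * (γ : ℂ) ^ 2) ^ (2⁻¹ : ℂ) = 2 * γ := by
    have h5 : (4 * (γ : ℂ) ^ 2) = (2 * γ : ℂ) ^ ((2 : ℕ) : ℂ) := by
      rw [Complex.cpow_natCast]; ring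
    have h6 : Complex.arg (2 * γ : ℂ) = 0 := by
      rw [show (2 * γ : ℂ) = ((2 * γ : ℝ) : ℂ) by push_cast; ring]
      exact Complex.arg_ofReal_of_nonneg (by positivity)
    have := Complex.pow_cpow_nat_inv (x := (2 * γ : ℂ)) (n := 2) two_ne_zero
      (by rw [h6]; have := Real.pi_pos; simp only [Nat.cast_ofNat]; linarith)
      (by rw [h6]; have := Real.pi_pos; simp only [Nat.cast_ofNat]; linarith)
    rw [show (4 * (γ : ℂ) ^ 2) = (2 * γ : ℂ) ^ 2 by ring]
    exact_mod_cast this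
  rw [h4] at h3
  exact h3

theorem tendsto_ef_zf {γ : ℝ} (hγ : 0 < γ) (w : ℂ) :
    Tendsto (fun t : ℝ => t * (2 * Tf γ (Complex.exp (w / (√t : ℂ))) - 4 * γ)) atTop
      (nhds (w ^ 2 / (2 * γ))) := by
  have hγ' : (γ : ℂ) ≠ 0 := Complex.ofReal_ne_zero.2 hγ.ne'
  have h := ((((tendsto_sqrt_mul_one_sub w).pow 2).div (tendsto_exp_div w) one_ne_zero).div
    ((tendsto_const_nhds (x := (2 * γ : ℂ))).add (tendsto_Tf hγ w))
    (by rw [← two_mul]; simpa using hγ')).const_mul 2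
  refine (h.congr' ?_).trans_eq ?_
  · filter_upwards [eventually_gt_atTop 0] with t ht
    have h1 := Tf_sq γ (Complex.exp (w / (√t : ℂ)))
    have h2 := Tf_add_ne (u := Complex.exp (w / (√t : ℂ))) hγ
    simp only [Pi.div_apply]
    rw [mul_pow, sq_sqrt_ofReal ht, mul_div_assoc, mul_div_assoc, show
      (1 - Complex.exp (w / (√t : ℂ))) ^ 2 / Complex.exp (w / (√t : ℂ)) =
      (2 * γ + Tf γ (Complex.exp (w / (√t : ℂ)))) * (Tf γ (Complex.exp (w / (√t : ℂ))) - 2 * γ) by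
        linear_combination -h1, mul_div_cancel_left₀ _ h2]
    ring
  · congr 1
    field_simp
    ring

theorem tendsto_zf_scaled {γ : ℝ} (hγ : 0 < γ) (w : ℂ) :
    Tendsto (fun t : ℝ => (√t : ℂ) * zf γ (Complex.exp (w / (√t : ℂ)))) atTop
      (nhds (-w / (4 * γ))) := by
  have hγ' : (γ : ℂ) ≠ 0 := Complex.ofReal_ne_zero.2 hγ.ne'
  have h := ((tendsto_sqrt_mul_one_sub w)).div
    ((tendsto_const_nhds (x := (2 * γ : ℂ))).add (tendsto_Tf hγ w))
    (by rw [← two_mul]; simpa using hγ')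
  rw [show (2 * γ : ℂ) + 2 * γ = 4 * γ by ring] at h
  refine h.congr fun t => ?_
  simp only [Pi.div_apply, zf, mul_div_assoc]

theorem tendsto_zf {γ : ℝ} (hγ : 0 < γ) (w : ℂ) :
    Tendsto (fun t : ℝ => zf γ (Complex.exp (w / (√t : ℂ)))) atTop (nhds 0) := by
  have h := (tendsto_zf_scaled hγ w).mul tendsto_inv_sqrt
  rw [mul_zero] at h
  refine h.congr' ?_
  filter_upwards [eventually_gt_atTop 0] with t ht
  have : (√t : ℂ) ≠ 0 := Complex.ofReal_ne_zero.2 (Real.sqrt_pos.2 ht).ne'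
  field_simp

theorem eventually_zf_le {γ β : ℝ} (hγ : 0 < γ) (hβ : 0 < β) (w : ℂ) :
    ∀ᶠ t : ℝ in atTop, ‖zf γ (Complex.exp (w / (√t : ℂ)))‖ ≤
      β * √‖Complex.exp (w / (√t : ℂ))‖ := by
  have h1 := (tendsto_zf hγ w).norm
  have h2 := ((Real.continuous_sqrt.tendsto _).comp (tendsto_exp_div w).norm).const_mul β
  simp only [norm_zero, norm_one, Real.sqrt_one, mul_one] at h1 h2
  exact (h1.eventually_lt h2 hβ).mono fun t h => h.le

theorem tendsto_sg {γ β : ℝ} (hγ : 0 < γ) (hβ : 0 < β) (w : ℂ) :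
    Tendsto (fun t : ℝ => sg β t γ (Complex.exp (w / (√t : ℂ)))) atTop
      (nhds (Complex.exp (w ^ 2 / (2 * γ)) / (2 * γ))) := by
  have hγ' : (γ : ℂ) ≠ 0 := Complex.ofReal_ne_zero.2 hγ.ne'
  have h := ((Complex.continuous_exp.tendsto _).comp (tendsto_ef_zf hγ w)).div (tendsto_Tf hγ w)
    (by simpa using hγ')
  refine h.congr' ?_
  filter_upwards [eventually_zf_le hγ hβ w] with t ht
  simp only [Pi.div_apply, Function.comp_apply, sg, if_pos ht]

theorem eventually_scl {γ k : ℝ} (hγ : 0 < γ) (hk : 1 / 2 ≤ k) (hk1 : k ≤ 1) :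
    ∀ᶠ t : ℝ in atTop, Scl γ t (k / √t) := by
  have h0 : Tendsto (fun t : ℝ => k / √t) atTop (nhds 0) :=
    Real.tendsto_sqrt_atTop.const_div_atTop k
  filter_upwards [eventually_ge_atTop 1, h0.eventually_le_const one_pos,
    h0.eventually_le_const (show 0 < γ / 3 by positivity)] with t ht h1 h2
  have hs : 0 < √t := Real.sqrt_pos.2 (by linarith)
  have e : t * (k / √t) ^ 2 = k ^ 2 := by
    rw [div_pow, Real.sq_sqrt (by linarith)]; field_simp
  exact ⟨hγ, ht, by positivity, h1, by linarith, by rw [e]; nlinarith,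
    by rw [mul_assoc, e]; nlinarith⟩

theorem eventually_le_exp {k r : ℝ} (hr : r < 1) :
    ∀ᶠ t : ℝ in atTop, r ≤ Real.exp (-(k / √t)) := by
  have h0 : Tendsto (fun t : ℝ => k / √t) atTop (nhds 0) :=
    Real.tendsto_sqrt_atTop.const_div_atTop k
  have := (Real.continuous_exp.tendsto _).comp h0.neg
  rw [neg_zero, Real.exp_zero] at this
  exact this.eventually_const_le hr

theorem continuous_cint_PY {γ t κ s : ℝ} (hκ : 0 < κ) (hs : 0 < s)
    (hd : ∀ x z, z ≠ 0 → ‖z‖ ≤ s → df (2 * γ) (eu κ x) z ≠ 0) :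
    Continuous fun x : ℝ => cint s fun a => PY t γ a (eu κ x) := by
  refine continuous_cint (X := ℝ) (F := fun x a => PY t γ a (eu κ x)) hs ?_
  refine continuous_iff_continuousAt.2 fun p => ?_
  have e1 := norm_circleMap_pos hs p.2
  have h1 : circleMap 0 s p.2 ≠ 0 := norm_pos_iff.1 (by rw [e1]; exact hs)
  have h2 := hd p.1 _ h1 e1.le
  have h3 := eu_ne κ p.1
  have h4 := one_sub_ne (norm_eu_lt hκ p.1)
  have h5 : DifferentiableAt ℂ (fun q : ℂ × ℂ => PY t γ q.1 q.2)
      (circleMap 0 s p.2, eu κ p.1) := by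
    unfold PY om
    fun_prop (disch := first | assumption | exact pow_ne_zero 2 h4)
  refine ContinuousAt.comp (f := fun p : ℝ × ℝ => (circleMap 0 s p.2, eu κ p.1))
    h5.continuousAt ?_
  refine Continuous.continuousAt ?_
  unfold eu
  fun_prop

theorem tendsto_Y {γ r : ℝ} (h : SmallRad γ r) (h2 : SmallRad (2 * γ) r) :
    Tendsto (fun t : ℝ => (cint (r ^ 3) fun a => cint 1 fun d => GY2 t γ a d) / (√t : ℂ)) atTop
      (nhds ((2 * Real.pi : ℂ)⁻¹ * ∫ X : ℝ, -(Complex.exp (-((X + Complex.I) ^ 2) / (4 * γ)) /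
        (X + Complex.I) ^ 2))) := by
  have hγ : 0 < 2 * γ := h2.1
  have hγ' : (γ : ℂ) ≠ 0 := Complex.ofReal_ne_zero.2 h.1.ne'
  have hr0 := h.2.1
  have l0 := aj_pos hγ (le_refl 1)
  have l1 : aj (2 * γ) 1 < aj (2 * γ) 2 := aj_lt hγ (by norm_num)
  have l2 : aj (2 * γ) 2 < aj (2 * γ) 3 := aj_lt hγ (by norm_num)
  have l3 : aj (2 * γ) 3 < 1 := aj_lt_one hγ (by norm_num)
  have l4 := aj_gap hγ (le_refl 1)
  obtain ⟨C1, p1, B1⟩ := pair_bound hγ l0 l1 l2 l3 l4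
  obtain ⟨C2, p2, B2⟩ := pair_single hγ l0 l1 l2 l3 l4
  have hs : ∀ t : ℝ, ∃ s, 0 < t → 0 < s ∧ s ≤ min (r ^ 3) (aj (2 * γ) 1 * Real.exp (-(1 / √t))) ∧
      4 * (2 * γ) < (1 - Real.exp (-(1 / √t))) * (s⁻¹ - 1) := by
    intro t
    by_cases ht : 0 < t
    · have : Real.exp (-(1 / √t)) < 1 := by simpa using ht
      obtain ⟨s, h1⟩ := exists_tiny (γ := 2 * γ)
        (q := min (r ^ 3) (aj (2 * γ) 1 * Real.exp (-(1 / √t)))) (lt_min (by positivity) (by positivity)) this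
      exact ⟨s, fun _ => h1⟩
    · exact ⟨0, fun h => absurd h ht⟩
  choose s hs using hs
  have ev := (eventually_scl hγ (k := 1) (by norm_num) le_rfl).and
    (eventually_le_exp (k := 1) h.lt_one)
  have fac : ∀ t : ℝ, Scl (2 * γ) t (1 / √t) → ∀ x, s t ≤ aj (2 * γ) 1 * √‖eu (1 / √t) x‖ ∧
      ∀ z, z ≠ 0 → ‖z‖ ≤ s t → df (2 * γ) (eu (1 / √t) x) z ≠ 0 := fun t S x =>
    tiny_facts hγ S.hκ (l1.le.trans (l2.le.trans l3.le)) l0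
      ((hs t S.ht0).2.1.trans (min_le_right _ _)) (hs t S.ht0).2.2
  have nC : ‖(4 * γ : ℂ)‖ = 4 * γ := by
    rw [norm_mul, Complex.norm_ofNat, Complex.norm_real, Real.norm_eq_abs, abs_of_pos h.1]
  set F : ℝ → ℂ → ℂ := fun t u => (t : ℂ)⁻¹ * cint (s t) fun a => PY t γ a u with hF
  have rw1 : ∀ t, 0 < s t → ∀ u, F t u = (t : ℂ)⁻¹ * (om u * cint (s t) fun a =>
      Complex.exp (t * ef (2 * γ) u a) * (0 + 4 * γ * (df (2 * γ) u a)⁻¹)) := by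
    intro t ht u
    rw [← cint_const_mul ht]
    simp only [hF, PY]
    congr 2
    funext a
    ring
  have main := tendsto_cint_eu (κ := fun t => 1 / √t) (F := F)
    (G := fun X : ℝ => -(Complex.exp (-((X + Complex.I) ^ 2) / (4 * γ)) / (X + Complex.I) ^ 2))
    (C := 16 * C2 * (4 * γ)) (by have := h.1; positivity) ?_ ?_ ?_
  · refine main.congr' ?_
    filter_upwards [ev] with t ⟨S, hr⟩
    have ht := S.ht0
    have hst : (√t : ℂ) ≠ 0 := Complex.ofReal_ne_zero.2 (Real.sqrt_pos.2 ht).ne'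
    obtain ⟨q1, q2, q3⟩ := hs t ht
    have : Real.exp (-(1 / √t)) < 1 := by simpa using ht
    rw [cint_PY h t h2 hr this q1 (q2.trans (min_le_left _ _)) q3]
    simp only [hF]
    rw [cint_const_mul (Real.exp_pos _), ← sq_sqrt_ofReal ht]
    field_simp
  · filter_upwards [ev] with t ⟨S, hr⟩
    exact continuous_const.mul (continuous_cint_PY S.hκ (hs t S.ht0).1 fun x => (fac t S x).2)
  · filter_upwards [ev] with t ⟨S, hr⟩ x hx
    have ht := S.ht0
    rw [rw1 t (hs t ht).1, norm_mul, norm_mul]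
    have b1 := norm_om_le S (norm_eu (1 / √t) x).le
    have b2 := B2 t (1 / √t) x (s t) (4 * γ) S hx (hs t ht).1 (fac t S x).1 (fac t S x).2
      (fun _ => 0) (fun _ => 4 * γ) fun z _ _ => ⟨by fun_prop, by fun_prop, by
        rw [norm_zero]; linarith [h.1], nC.le⟩
    rw [norm_inv, Complex.norm_real, Real.norm_eq_abs, abs_of_pos ht]
    calc _ ≤ t⁻¹ * (16 * t * (C2 / (1 + t * x ^ 2) * (4 * γ))) := by gcongr
      _ = _ := by field_simp
  · intro X
    set w : ℂ := -(1 : ℝ) + X * Complex.I with hw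
    have hw0 : w ≠ 0 := by
      intro h0
      have := congrArg Complex.re h0
      simp [hw] at this
    have ww : w ^ 2 = -((X + Complex.I) ^ 2) := by
      rw [hw]; push_cast; linear_combination (X ^ 2 + 1 : ℂ) * Complex.I_sq
    have L1 := tendsto_om_div hw0
    have L2 := (tendsto_sg (β := aj (2 * γ) 2) hγ (l0.trans l1) w).const_mul (4 * γ : ℂ)
    set R : ℝ → ℂ := fun t => cint (rd (aj (2 * γ) 1) (aj (2 * γ) 2) (aj (2 * γ) 3) (2 * γ)
      (eu (1 / √t) (X / √t))) (fun z => Complex.exp (t * ef (2 * γ) (eu (1 / √t) (X / √t)) z) *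
        (0 + 4 * γ * (df (2 * γ) (eu (1 / √t) (X / √t)) z)⁻¹)) with hR
    have hX : ∀ᶠ t : ℝ in atTop, |X / √t| ≤ Real.pi := by
      have h0 : Tendsto (fun t : ℝ => |X / √t|) atTop (nhds 0) := by
        simpa using (Real.tendsto_sqrt_atTop.const_div_atTop X).abs
      exact h0.eventually_le_const Real.pi_pos
    have L3 : Tendsto R atTop (nhds 0) := by
      have hz : Tendsto (fun t : ℝ => Real.exp (-(2 * γ) * t) * (C1 * (4 * γ))) atTop (nhds 0) := by
        have : Tendsto (fun t : ℝ => (2 * γ) * t) atTop atTop :=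
          tendsto_id.const_mul_atTop hγ
        have := (Real.tendsto_exp_neg_atTop_nhds_zero.comp this).mul_const (C1 * (4 * γ))
        simpa [Function.comp_def] using this
      refine squeeze_zero_norm' ?_ hz
      filter_upwards [ev, hX] with t ⟨S, hr⟩ hx
      have ht := S.ht0
      have hu := eu_ne (1 / √t) (X / √t)
      have q1 := rd_ge (γ := 2 * γ) (u := eu (1 / √t) (X / √t)) l1 l2
      have q0 : 0 < rd (aj (2 * γ) 1) (aj (2 * γ) 2) (aj (2 * γ) 3) (2 * γ)
          (eu (1 / √t) (X / √t)) :=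
        lt_of_lt_of_le (mul_pos l0 (Real.sqrt_pos.2 (norm_pos_iff.2 hu))) q1
      refine norm_cint_le q0 fun z hz => ?_
      have b := ((B1 t _ _ S hx).2 z hz).2 (4 * γ) 0 (4 * γ) (by rw [norm_zero]; linarith [h.1]) nC.le
      refine b.trans ?_
      rw [mul_assoc]
      have := h.1
      gcongr
      refine div_le_self p1.le ?_
      have : 0 ≤ t * (X / √t) ^ 2 := by positivity
      linarith
    have L4 := L1.mul (L2.add L3)
    refine (L4.congr' ?_).trans_eq ?_
    · filter_upwards [ev] with t ⟨S, hr⟩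
      have ht := S.ht0
      have htc : (t : ℂ) ≠ 0 := Complex.ofReal_ne_zero.2 ht.ne'
      rw [rw1 t (hs t ht).1, pair_residue (g := fun _ => 0) (h := fun _ => 4 * γ) hγ (eu_ne _ _) (norm_eu_lt S.hκ _) l0 l1 l2 l3
        (hs t ht).1 (fac t S _).1 (fac t S _).2 (by fun_prop) (by fun_prop)]
      simp only [hR, eu_div, ← hw]
      ring
    · congr 1
      rw [ww, add_zero]
      have : (X + Complex.I : ℂ) ≠ 0 := by
        intro h0
        rw [h0] at ww
        exact hw0 (by simpa using ww)
      push_cast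
      field_simp
      ring_nf

theorem joukowski_sum {z : ℂ} (hz : z ≠ 0) :
    ‖cfun z - 1‖ + ‖cfun z + 1‖ = ‖z‖ + 1 / ‖z‖ := by
  have e1 : cfun z - 1 = (z - 1) ^ 2 / (2 * z) := by unfold cfun; field_simp; ring
  have e2 : cfun z + 1 = (z + 1) ^ 2 / (2 * z) := by unfold cfun; field_simp; ring
  have h := parallelogram_law_with_norm ℝ z 1
  have hz' : 0 < ‖z‖ := norm_pos_iff.2 hz
  rw [norm_one] at h
  rw [e1, e2, norm_div, norm_div, norm_pow, norm_pow, norm_mul, Complex.norm_ofNat]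
  field_simp
  linarith

theorem joukowski_gap {p z w d : ℂ} {g : ℝ} (hp : p ≠ 0) (hz : z ≠ 0) (hw : w ≠ 0)
    (h1 : cfun p = d + cfun z + 2 * g) (h2 : cfun z = cfun w + 2 * g) :
    2 * (‖z‖ + 1 / ‖z‖) - (‖w‖ + 1 / ‖w‖) - (‖p‖ + 1 / ‖p‖) ≤ 2 * ‖d‖ := by
  rw [← joukowski_sum hz, ← joukowski_sum hw, ← joukowski_sum hp]
  have key : ∀ s : ℂ, 2 * ‖cfun z + s‖ ≤ ‖cfun p + s‖ + ‖cfun w + s‖ + ‖d‖ := by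
    intro s
    have : 2 * (cfun z + s) = (cfun p + s) + (cfun w + s) - d := by
      linear_combination -h1 + h2
    calc 2 * ‖cfun z + s‖ = ‖2 * (cfun z + s)‖ := by rw [norm_mul, Complex.norm_ofNat]
      _ ≤ _ := by
        rw [this]
        exact (norm_sub_le _ _).trans (by gcongr; exact norm_add_le _ _)
  have k1 := key 1
  have k2 := key (-1)
  simp only [← sub_eq_add_neg] at k2
  linarith

theorem df_string {γ : ℝ} {u z : ℂ} (hu : u ≠ 0) (hz : z ≠ 0) :
    df γ u (u * z) = cfun (u * z) - cfun z - 2 * γ := by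
  unfold df cfun
  field_simp
  ring

theorem zf_string {γ : ℝ} (hγ : 0 < γ) {v : ℂ} (hv : v ≠ 0) (hv1 : ‖v‖ < 1) :
    cfun (zf γ v) = cfun (v / zf γ v) + 2 * γ := by
  have h := df_zf hγ hv hv1
  have hz := zf_ne (u := v) hγ hv1
  unfold df at h
  unfold cfun
  rw [sub_eq_zero] at h
  rw [← h]
  field_simp
  ring

theorem string_lower_real {κ β a n d : ℝ} (hκ : 0 < κ) (hκ1 : κ ≤ 1) (hβ : 0 < β) (hβ1 : β < 1)
    (hκβ : 10 * κ ≤ 1 - β ^ 2) (a0 : 0 < a) (a1 : a ≤ β) (hu : Real.exp (-(κ / 2)) ≤ n)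
    (hu1 : n * a ≤ 1) (G : 2 * (a + 1 / a) - (Real.exp (-κ) / a + 1 / (Real.exp (-κ) / a)) -
      (n * a + 1 / (n * a)) ≤ 2 * d) : κ * (1 - β ^ 2) / (8 * a) ≤ d := by
  have n0 : 0 < n := (Real.exp_pos _).trans_le hu
  have E1 := abs_le.1 (Real.abs_exp_sub_one_sub_id_le (x := κ) (by rw [abs_of_pos hκ]; exact hκ1))
  have E2 := abs_le.1 (Real.abs_exp_sub_one_sub_id_le (x := -κ) (by rw [abs_neg, abs_of_pos hκ]; exact hκ1))
  have E3 := abs_le.1 (Real.abs_exp_sub_one_sub_id_le (x := κ / 2) (by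
    rw [abs_of_pos (by positivity)]; linarith))
  have E4 := abs_le.1 (Real.abs_exp_sub_one_sub_id_le (x := -(κ / 2)) (by
    rw [abs_neg, abs_of_pos (by positivity)]; linarith))
  have hp : n * a + 1 / (n * a) ≤ Real.exp (-(κ / 2)) * a + Real.exp (κ / 2) / a := by
    have e : Real.exp (κ / 2) = 1 / Real.exp (-(κ / 2)) := by rw [Real.exp_neg, one_div, inv_inv]
    rw [e, div_div]
    set q := Real.exp (-(κ / 2)) * a with hq
    have q0 : 0 < q := mul_pos (Real.exp_pos _) a0
    have hqn : q ≤ n * a := by rw [hq]; gcongr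
    set P := n * a with hP
    clear_value q P
    have P0 : 0 < P := q0.trans_le hqn
    have : 1 / q - 1 / P = (P - q) / (q * P) := by field_simp
    have h3 : P - q ≤ (P - q) / (q * P) := by
      rw [le_div_iff₀ (by positivity)]
      have : q * P ≤ 1 := by nlinarith
      nlinarith
    linarith
  have hw : Real.exp (-κ) / a + 1 / (Real.exp (-κ) / a) = Real.exp (-κ) / a + a * Real.exp κ := by
    rw [one_div_div, Real.exp_neg, div_inv_eq_mul]
  rw [hw] at G
  rw [div_le_iff₀ (by positivity)]
  have h4 : (2 - Real.exp (-κ) - Real.exp (κ / 2)) - a ^ 2 * (Real.exp κ + Real.exp (-(κ / 2)) - 2) ≤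
      2 * d * a := by
    have h5 : 2 * (a + 1 / a) - (Real.exp (-κ) / a + a * Real.exp κ) -
      (Real.exp (-(κ / 2)) * a + Real.exp (κ / 2) / a) ≤ 2 * d := by linarith
    have h6 := mul_le_mul_of_nonneg_right h5 a0.le
    have : (2 * (a + 1 / a) - (Real.exp (-κ) / a + a * Real.exp κ) -
      (Real.exp (-(κ / 2)) * a + Real.exp (κ / 2) / a)) * a = (2 - Real.exp (-κ) - Real.exp (κ / 2)) - a ^ 2 * (Real.exp κ + Real.exp (-(κ / 2)) - 2) := by
      field_simp; ring
    linarith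
  have h7 : a ^ 2 * (Real.exp κ + Real.exp (-(κ / 2)) - 2) ≤ β ^ 2 * (κ / 2) + 5 / 4 * κ ^ 2 := by
    have h8 : Real.exp κ + Real.exp (-(κ / 2)) - 2 ≤ κ / 2 + 5 / 4 * κ ^ 2 := by linarith
    have h9 : a ^ 2 ≤ β ^ 2 := by gcongr
    have h10 : β ^ 2 ≤ 1 := by nlinarith
    calc _ ≤ a ^ 2 * (κ / 2 + 5 / 4 * κ ^ 2) := by gcongr
      _ ≤ β ^ 2 * (κ / 2 + 5 / 4 * κ ^ 2) := by gcongr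
      _ ≤ β ^ 2 * (κ / 2) + 1 * (5 / 4 * κ ^ 2) := by rw [mul_add]; gcongr
      _ = _ := by ring
  nlinarith

theorem df_string_lower {γ κ y β : ℝ} (hγ : 0 < γ) (hκ : 0 < κ) (hβ : 0 < β) (hβ1 : β < 1)
    (hκβ : 10 * κ ≤ 1 - β ^ 2) (hz : ‖zf γ (eu κ y)‖ ≤ β * √‖eu κ y‖) {u : ℂ}
    (hu : Real.exp (-(κ / 2)) ≤ ‖u‖) (hu1 : ‖u‖ * ‖zf γ (eu κ y)‖ ≤ 1) :
    κ * (1 - β ^ 2) / (8 * ‖zf γ (eu κ y)‖) ≤ ‖df γ u (u * zf γ (eu κ y))‖ := by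
  have hv := eu_ne κ y
  have hv1 := norm_eu_lt hκ y
  have hz0 := zf_ne (u := eu κ y) hγ hv1
  have hu0 : u ≠ 0 := norm_pos_iff.1 ((Real.exp_pos _).trans_le hu)
  have G := joukowski_gap (mul_ne_zero hu0 hz0) hz0 (div_ne_zero hv hz0)
    (d := df γ u (u * zf γ (eu κ y))) (g := γ) (by rw [df_string hu0 hz0]; ring)
    (zf_string hγ hv hv1)
  have hRv := sqrt_norm_eu_lt hκ y
  rw [norm_div, norm_eu, norm_mul] at G
  refine string_lower_real hκ (by nlinarith) hβ hβ1 hκβ (norm_pos_iff.2 hz0)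
    (hz.trans (by nlinarith)) hu hu1 G

theorem norm_Tf_le {γ κ x : ℝ} (hκ : 0 < κ) (hκ1 : κ ≤ 1) : ‖Tf γ (eu κ x)‖ ≤ 2 * |γ| + 4 := by
  have h := Tf_sq γ (eu κ x)
  have hu := norm_eu_lt hκ x
  have e : ‖Tf γ (eu κ x)‖ ^ 2 ≤ 4 * γ ^ 2 + 12 := by
    rw [← norm_pow, h]
    refine (norm_add_le _ _).trans ?_
    rw [norm_div, norm_mul, norm_pow, norm_pow, Complex.norm_ofNat, Complex.norm_real,
      Real.norm_eq_abs, sq_abs]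
    gcongr
    rw [norm_eu] at hu ⊢
    have h1 : ‖1 - eu κ x‖ ≤ 2 := by
      refine (norm_sub_le _ _).trans ?_
      rw [norm_one, norm_eu]; linarith
    have h2 : 1 / 3 ≤ Real.exp (-κ) := by
      have h3 : Real.exp κ ≤ 3 := by
        have := Real.exp_one_lt_d9
        have : Real.exp κ ≤ Real.exp 1 := Real.exp_le_exp.2 hκ1
        linarith
      rw [Real.exp_neg, one_div]
      exact inv_anti₀ (Real.exp_pos _) h3
    rw [div_le_iff₀ (Real.exp_pos _)]
    nlinarith [norm_nonneg (1 - eu κ x)]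
  have hg := abs_nonneg γ
  rw [← sq_abs γ] at e
  nlinarith [norm_nonneg (Tf γ (eu κ x))]

noncomputable def mf (u a c : ℂ) : ℂ := (u - a * c) / (a - u * c)

/-- The contribution of the moving pole `a = u * z`. -/
noncomputable def hst (t γ : ℝ) (z u : ℂ) : ℂ :=
  (z⁻¹ - z) * (Complex.exp (t * ef γ u (u * z)) * (df γ u (u * z))⁻¹)

theorem string_residue {γ t b β b' s : ℝ} (hγ : 0 < γ) {u : ℂ} (hu : u ≠ 0) (hu1 : ‖u‖ < 1)
    (hb : 0 < b) (hbβ : b < β) (hβb : β < b') (hb1 : b' < 1) (hs : 0 < s) (hsb : s ≤ b * √‖u‖)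
    (hd : ∀ z, z ≠ 0 → ‖z‖ ≤ s → df γ u z ≠ 0)
    (hrd : ∀ z, ‖z‖ = rd b β b' γ u → df γ u z ≠ 0) {z : ℂ} (hz : z ≠ 0)
    (hsz : s < ‖u * z‖) (hzb : ‖u * z‖ < b * √‖u‖) (hdz : df γ u (u * z) ≠ 0) :
    cint s (fun a => Complex.exp (t * ef γ u a) * (0 + mf u a z * (df γ u a)⁻¹)) =
      sg β t γ u * mf u (zf γ u) z - hst t γ z u +
        cint (rd b β b' γ u)
          (fun a => Complex.exp (t * ef γ u a) * (0 + mf u a z * (df γ u a)⁻¹)) := by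
  have hu' := norm_pos_iff.2 hu
  have hR : 0 < √‖u‖ := Real.sqrt_pos.2 hu'
  have hR2 : √‖u‖ * √‖u‖ = ‖u‖ := Real.mul_self_sqrt hu'.le
  have hz0 := zf_ne (u := u) hγ hu1
  have hz0' := norm_pos_iff.2 hz0
  have hle := norm_zf_le hγ hu
  have hu2 := one_sub_ne hu1
  have q1 := rd_ge (γ := γ) (u := u) hbβ hβb
  have q2 := rd_le (γ := γ) (u := u) hbβ hβb
  have q0 : 0 < rd b β b' γ u := lt_of_lt_of_le (by positivity) q1
  have far : ∀ a : ℂ, ‖a‖ ≤ b' * √‖u‖ → a + u / zf γ u ≠ 0 := by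
    intro z hz h0
    have e : ‖z‖ = ‖u‖ / ‖zf γ u‖ := by
      rw [← norm_div, eq_neg_of_add_eq_zero_left h0, norm_neg]
    have : √‖u‖ ≤ ‖u‖ / ‖zf γ u‖ := by
      rw [le_div_iff₀ hz0']
      nlinarith
    nlinarith
  set z0 := zf γ u with hz0d
  set p := u * z with hp
  have hp0 : p ≠ 0 := mul_ne_zero hu hz
  have hpz : z0 - p ≠ 0 := by
    intro h0
    rw [sub_eq_zero] at h0
    exact hdz (by rw [← h0]; exact df_zf hγ hu hu1)
  set H : ℂ → ℂ := fun a => Complex.exp (t * ef γ u a) *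
    (2 * u ^ 2 * a * (1 - z ^ 2) / ((1 - u) * (a + u / z0) * (z0 - p))) with hH
  have hHd : ∀ a, s ≤ ‖a‖ → ‖a‖ ≤ rd b β b' γ u → DifferentiableAt ℂ H a := by
    intro a h1 h2
    have h3 := far a (h2.trans q2)
    have h4 : a ≠ 0 := norm_pos_iff.1 (hs.trans_le h1)
    have h5 : (1 - u) * (a + u / z0) * (z0 - p) ≠ 0 := mul_ne_zero (mul_ne_zero hu2 h3) hpz
    simp only [hH]
    fun_prop (disch := assumption)
  have dec : ∀ a, a ≠ 0 → ‖a‖ ≤ b' * √‖u‖ → a ≠ p → df γ u a ≠ 0 →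
      Complex.exp (t * ef γ u a) * (0 + mf u a z * (df γ u a)⁻¹) =
      Complex.exp (t * ef γ u a) * (0 + mf u z0 z * (df γ u a)⁻¹) + H a / (a - p) := by
    intro a h1 h2 h3 h4
    have h5 := far a h2
    have h6 : a - z0 ≠ 0 := by
      intro h0
      rw [sub_eq_zero] at h0
      exact h4 (by rw [h0]; exact df_zf hγ hu hu1)
    have h7 : a - p ≠ 0 := sub_ne_zero.2 h3
    have e1 : mf u a z - mf u z0 z = (a - z0) * (-(u * (1 - z ^ 2)) / ((a - p) * (z0 - p))) := by
      unfold mf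
      rw [← hp, div_sub_div _ _ h7 hpz, mul_div_assoc']
      congr 1
      rw [hp]; ring
    have e2 : (a - z0) * (df γ u a)⁻¹ = -(2 * u * a / ((1 - u) * (a + u / z0))) := by
      rw [df_factor hγ hu hu1 h1, ← hz0d]
      generalize a + u / z0 = f at h5
      field_simp
    have e3 : H a / (a - p) = Complex.exp (t * ef γ u a) *
        ((mf u a z - mf u z0 z) * (df γ u a)⁻¹) := by
      rw [e1, mul_right_comm, e2]
      simp only [hH]
      generalize a + u / z0 = f at h5
      generalize z0 - p = f2 at hpz
      generalize a - p = f3 at h7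
      field_simp
    rw [e3]
    ring
  have L : ∀ ρ, 0 < ρ → ρ ≤ b' * √‖u‖ → s ≤ ρ → ρ ≤ rd b β b' γ u → ρ ≠ ‖p‖ →
      (∀ a, ‖a‖ = ρ → df γ u a ≠ 0) →
      cint ρ (fun a => Complex.exp (t * ef γ u a) * (0 + mf u a z * (df γ u a)⁻¹)) =
      cint ρ (fun a => Complex.exp (t * ef γ u a) * (0 + mf u z0 z * (df γ u a)⁻¹)) +
        cint ρ (fun a => H a / (a - p)) := by
    intro ρ h0 h1 h2 h2' h3 h4
    rw [← cint_add h0]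
    · refine cint_congr h0 fun a ha => dec a (norm_pos_iff.1 (by rw [ha]; exact h0))
        (by rw [ha]; exact h1) ?_ (h4 a ha)
      intro h5
      exact h3 (by rw [← ha, h5])
    · refine continuous_circle_of_forall (f := fun a => Complex.exp (t * ef γ u a) *
        (0 + mf u z0 z * (df γ u a)⁻¹)) h0 fun a ha => ?_
      have h5 : a ≠ 0 := norm_pos_iff.1 (by rw [ha]; exact h0)
      have h6 := h4 a ha
      have : DifferentiableAt ℂ (fun a => Complex.exp (t * ef γ u a) *
        (0 + mf u z0 z * (df γ u a)⁻¹)) a := by fun_prop (disch := assumption)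
      exact this.continuousAt
    · refine continuous_circle_of_forall (f := fun a => H a / (a - p)) h0 fun a ha => ?_
      have h5 := hHd a (by rw [ha]; exact h2) (by rw [ha]; exact h2')
      have h6 : a - p ≠ 0 := sub_ne_zero.2 fun h5 => h3 (by rw [← ha, h5])
      have : DifferentiableAt ℂ (fun a => H a / (a - p)) a := by fun_prop (disch := assumption)
      exact this.continuousAt
  have hsr : s ≤ rd b β b' γ u := hsb.trans q1
  rw [L s hs (hsr.trans q2) le_rfl hsr hsz.ne (fun a ha => hd a (norm_pos_iff.1 (by rw [ha]; exact hs)) ha.le),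
    L _ q0 q2 hsr le_rfl (hzb.trans_le q1).ne' hrd,
    pair_residue (g := fun _ => 0) (h := fun _ => mf u z0 z) hγ hu hu1 hb hbβ hβb hb1 hs hsb hd
      (by fun_prop) (by fun_prop), cint_pole hs hsz (hzb.trans_le q1) hHd]
  have res : H p / p = hst t γ z u := by
    have h5 := far p (hzb.le.trans (q1.trans q2))
    have h6 : p - z0 ≠ 0 := by rw [← neg_sub]; exact neg_ne_zero.2 hpz
    have e2 : (df γ u p)⁻¹ = -(2 * u * p / ((1 - u) * (p + u / z0))) * (p - z0)⁻¹ := by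
      rw [df_factor hγ hu hu1 hp0, ← hz0d]
      generalize p + u / z0 = f at h5
      field_simp
    unfold hst
    rw [← hp, e2]
    simp only [hH]
    rw [show z0 - p = -(p - z0) by ring]
    generalize p + u / z0 = f at h5
    generalize p - z0 = f2 at h6
    generalize Complex.exp (t * ef γ u p) = E
    rw [hp]
    field_simp
  rw [res]
  ring

theorem norm_mf_le {u a c : ℂ} {δ : ℝ} (hδ : 0 < δ) (hu : ‖u‖ ≤ 1) (ha : ‖a‖ ≤ 1) (hc : ‖c‖ ≤ 1)
    (h : δ ≤ ‖a - u * c‖) : ‖mf u a c‖ ≤ 2 / δ := by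
  rw [mf, norm_div]
  have h1 : ‖u - a * c‖ ≤ 2 := by
    refine (norm_sub_le _ _).trans ?_
    rw [norm_mul]
    nlinarith [norm_nonneg a, norm_nonneg c]
  gcongr

theorem sqrt_norm_eu (κ x : ℝ) : √‖eu κ x‖ = Real.exp (-(κ / 2)) := by
  rw [norm_eu, show -κ = -(κ / 2) + -(κ / 2) by ring, Real.exp_add,
    Real.sqrt_mul_self (Real.exp_pos _).le]

/-- The inner contour integral at a point `c` outside the moving pole. -/
theorem J_outside {γ : ℝ} (hγ : 0 < γ) : ∃ C, 0 < C ∧ ∃ κ₀, 0 < κ₀ ∧ ∀ t κ x y s : ℝ,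
    Scl γ t (κ / 2) → κ ≤ κ₀ → |x| ≤ Real.pi → 0 < s → s ≤ aj γ 1 * √‖eu (κ / 2) x‖ →
    (∀ z, z ≠ 0 → ‖z‖ ≤ s → df γ (eu (κ / 2) x) z ≠ 0) → ∀ c : ℂ,
    aj γ 4 * √‖eu κ y‖ ≤ ‖c‖ → ‖c‖ ≤ 1 →
    ‖cint s (fun a => Complex.exp (t * ef γ (eu (κ / 2) x) a) *
      (0 + mf (eu (κ / 2) x) a c * (df γ (eu (κ / 2) x) a)⁻¹))‖ ≤ C / (1 + t * x ^ 2) := by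
  have l0 := aj_pos hγ (le_refl 1)
  have l1 : aj γ 1 < aj γ 2 := aj_lt hγ (by norm_num)
  have l2 : aj γ 2 < aj γ 3 := aj_lt hγ (by norm_num)
  have l3 : aj γ 3 < 1 := aj_lt_one hγ (by norm_num)
  have l5 : aj γ 3 < aj γ 4 := aj_lt hγ (by norm_num)
  have l6 : aj γ 4 < 1 := aj_lt_one hγ (by norm_num)
  have l4 := aj_gap hγ (le_refl 1)
  obtain ⟨C2, p2, B2⟩ := pair_single hγ l0 l1 l2 l3 l4
  have hδ : 0 < (aj γ 4 - aj γ 3) / 2 := by linarith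
  set M := 2 / ((aj γ 4 - aj γ 3) / 2) with hM
  have hM0 : 0 < M := by positivity
  refine ⟨C2 * M, by positivity, (aj γ 4 - aj γ 3) / 2, hδ, ?_⟩
  intro t κ x y s S hκ0 hx hs hsx hd c hc1 hc2
  have hR1 : √‖eu (κ / 2) x‖ < 1 := sqrt_norm_eu_lt S.hκ x
  have hu1 := norm_eu_lt S.hκ x
  have low : aj γ 4 - (aj γ 4 - aj γ 3) / 2 ≤ ‖eu (κ / 2) x * c‖ := by
    rw [norm_mul, norm_eu]
    rw [sqrt_norm_eu] at hc1
    have h1 : 1 - κ ≤ Real.exp (-κ) := by linarith [Real.add_one_le_exp (-κ)]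
    have h2 : Real.exp (-κ) = Real.exp (-(κ / 2)) * Real.exp (-(κ / 2)) := by
      rw [← Real.exp_add]; ring_nf
    have h3 := Real.exp_pos (-(κ / 2))
    have hκ : 0 < κ := by linarith [S.hκ]
    calc _ ≤ aj γ 4 * (1 - κ) := by nlinarith
      _ ≤ aj γ 4 * Real.exp (-κ) := by gcongr; linarith
      _ = Real.exp (-(κ / 2)) * (aj γ 4 * Real.exp (-(κ / 2))) := by rw [h2]; ring
      _ ≤ _ := by gcongr
  have key : ∀ a : ℂ, ‖a‖ ≤ aj γ 3 * √‖eu (κ / 2) x‖ → ‖a‖ ≤ 1 ∧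
      (aj γ 4 - aj γ 3) / 2 ≤ ‖a - eu (κ / 2) x * c‖ := by
    intro a ha
    have h1 : ‖a‖ ≤ aj γ 3 := ha.trans (by nlinarith)
    have h2 := norm_sub_norm_le (eu (κ / 2) x * c) a
    rw [norm_sub_rev] at h2
    exact ⟨by linarith, by linarith⟩
  refine (B2 t (κ / 2) x s M S hx hs hsx hd (fun _ => 0) (fun a => mf (eu (κ / 2) x) a c)
    fun a h3 h4 => ?_).trans_eq (by ring)
  obtain ⟨k1, k2⟩ := key a h4
  refine ⟨by fun_prop, ?_, by simpa using hM0.le, norm_mf_le hδ hu1.le k1 hc2 k2⟩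
  have : a - eu (κ / 2) x * c ≠ 0 := norm_pos_iff.1 (hδ.trans_le k2)
  unfold mf
  fun_prop (disch := assumption)

/-- The inner contour integral at a point `z` inside the moving pole. -/
theorem J_inside {γ : ℝ} (hγ : 0 < γ) : ∃ C, 0 < C ∧ ∀ t κ x y s : ℝ,
    Scl γ t (κ / 2) → |x| ≤ Real.pi → 0 < s → s ≤ aj γ 1 * √‖eu (κ / 2) x‖ →
    (∀ z, z ≠ 0 → ‖z‖ ≤ s → df γ (eu (κ / 2) x) z ≠ 0) → ∀ z : ℂ, z ≠ 0 →
    ‖z‖ ≤ aj γ 5 * √‖eu κ y‖ → s < ‖eu (κ / 2) x * z‖ →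
    df γ (eu (κ / 2) x) (eu (κ / 2) x * z) ≠ 0 →
    ‖cint s (fun a => Complex.exp (t * ef γ (eu (κ / 2) x) a) *
      (0 + mf (eu (κ / 2) x) a z * (df γ (eu (κ / 2) x) a)⁻¹)) + hst t γ z (eu (κ / 2) x) -
        sg (aj γ 8) t γ (eu (κ / 2) x) * mf (eu (κ / 2) x) (zf γ (eu (κ / 2) x)) z‖ ≤
      Real.exp (-γ * t) * (C / (1 + t * x ^ 2)) := by
  have l0 : 0 < aj γ 7 := aj_pos hγ (by norm_num)
  have l1 : aj γ 7 < aj γ 8 := aj_lt hγ (by norm_num)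
  have l2 : aj γ 8 < aj γ (17 / 2) := aj_lt hγ (by norm_num)
  have l3 : aj γ (17 / 2) < 1 := aj_lt_one hγ (by norm_num)
  have l5 : aj γ 5 < aj γ 7 := aj_lt hγ (by norm_num)
  have l6 : aj γ 1 < aj γ 7 := aj_lt hγ (by norm_num)
  have l7 : 0 < aj γ 5 := aj_pos hγ (by norm_num)
  have l4 : 3 * (1 / aj γ 7 - aj γ 7) ≤ γ := aj_gap hγ (by norm_num)
  obtain ⟨C, p, B⟩ := pair_bound hγ l0 l1 l2 l3 l4
  have hδ : 0 < (aj γ 7 - aj γ 5) / 2 := by linarith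
  set M := 2 / ((aj γ 7 - aj γ 5) / 2) with hM
  have hM0 : 0 < M := by positivity
  refine ⟨C * M, by positivity, ?_⟩
  intro t κ x y s S hx hs hsx hd z hz hzy hsz hdz
  obtain ⟨-, A⟩ := B t (κ / 2) x S hx
  have hu := eu_ne (κ / 2) x
  have hu1 := norm_eu_lt S.hκ x
  have hR1 : √‖eu (κ / 2) x‖ < 1 := sqrt_norm_eu_lt S.hκ x
  have hR0 : 0 < √‖eu (κ / 2) x‖ := Real.sqrt_pos.2 (norm_pos_iff.2 hu)
  have q1 := rd_ge (γ := γ) (u := eu (κ / 2) x) l1 l2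
  have q2 := rd_le (γ := γ) (u := eu (κ / 2) x) l1 l2
  have q0 : 0 < rd (aj γ 7) (aj γ 8) (aj γ (17 / 2)) γ (eu (κ / 2) x) :=
    lt_of_lt_of_le (by positivity) q1
  have hz1 : √‖eu κ y‖ ≤ 1 := (sqrt_norm_eu_lt (κ := κ) (by linarith [S.hκ]) y).le
  have hR2 : √‖eu (κ / 2) x‖ * √‖eu (κ / 2) x‖ = ‖eu (κ / 2) x‖ := Real.mul_self_sqrt (norm_nonneg _)
  have hhalf : 1 / 2 ≤ √‖eu (κ / 2) x‖ := by
    rw [sqrt_norm_eu]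
    linarith [Real.add_one_le_exp (-(κ / 2 / 2)), S.hκ1]
  have hz5 : ‖z‖ ≤ aj γ 5 := hzy.trans (by nlinarith)
  have hp : ‖eu (κ / 2) x * z‖ ≤ aj γ 5 * √‖eu (κ / 2) x‖ := by
    rw [norm_mul]
    nlinarith [norm_nonneg z, mul_nonneg hR0.le (norm_nonneg z)]
  rw [string_residue hγ hu hu1 l0 l1 l2 l3 hs (hsx.trans (by gcongr)) hd (fun a ha => (A a ha).1) hz
    hsz (hp.trans_lt (by gcongr)) hdz]
  have e : ∀ p q w : ℂ, p - q + w + q - p = w := fun p q w => by ring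
  rw [e]
  refine norm_cint_le q0 fun a ha => ?_
  have ha1 : ‖a‖ ≤ 1 := by rw [ha]; nlinarith
  have hb : ‖mf (eu (κ / 2) x) a z‖ ≤ M := by
    refine norm_mf_le hδ hu1.le ha1 (hz5.trans (by linarith)) ?_
    have := norm_sub_norm_le a (eu (κ / 2) x * z)
    rw [ha] at this
    nlinarith
  exact ((A a ha).2 M 0 _ (by simpa using hM0.le) hb).trans_eq (by ring)

/-- The conditions on the radii of the two inner circles. -/
structure Inn (γ t κ x y r s₃ s₁ : ℝ) : Prop where
  S : Scl γ t κ
  S' : Scl γ t (κ / 2)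
  hx : |x| ≤ Real.pi
  hy : |y| ≤ Real.pi
  h₃ : 0 < s₃
  h₁ : 0 < s₁
  h₁₃ : s₁ < r * s₃
  hr : r ≤ Real.exp (-(κ / 2))
  b₃ : s₃ ≤ aj γ 4 * √‖eu κ y‖
  b₁ : s₁ ≤ aj γ 1 * √‖eu (κ / 2) x‖
  d₃ : ∀ z, z ≠ 0 → ‖z‖ ≤ s₃ → df γ (eu κ y) z ≠ 0
  d₁ : ∀ z, z ≠ 0 → ‖z‖ ≤ s₁ → df γ (eu (κ / 2) x) z ≠ 0

theorem Inn.sub_ne {γ t κ x y r s₃ s₁ : ℝ} (I : Inn γ t κ x y r s₃ s₁) {a c : ℂ} (ha : ‖a‖ = s₁)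
    (hc : s₃ ≤ ‖c‖) : a - eu (κ / 2) x * c ≠ 0 := by
  intro h0
  rw [sub_eq_zero] at h0
  have := congrArg (‖·‖) h0
  simp only [norm_mul, norm_eu, ha] at this
  have h1 := I.h₁₃
  have h2 := I.hr
  have h3 := I.h₃
  have : r * s₃ ≤ s₁ := by
    rw [this]
    have := Real.exp_pos (-(κ / 2))
    gcongr
  linarith

/-- The inner double integral, without the prefactor. -/
noncomputable def jin (t γ s₃ s₁ : ℝ) (v u : ℂ) : ℂ :=
  cint s₃ fun c => cint s₁ fun a => Complex.exp (t * ef γ v c) * (1 + 2 * γ * (df γ v c)⁻¹) *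
    (Complex.exp (t * ef γ u a) * (0 + mf u a c * (df γ u a)⁻¹))

theorem cint_PJ {t γ s₃ s₁ : ℝ} (h₃ : 0 < s₃) (h₁ : 0 < s₁) (v u : ℂ) :
    (cint s₃ fun c => cint s₁ fun a => PJ t γ a c v u) = om (u * v) * jin t γ s₃ s₁ v u := by
  rw [jin, ← cint_const_mul h₃]
  congr 1
  funext c
  rw [← cint_const_mul h₁]
  congr 1
  funext a
  simp only [PJ, mf]
  rw [show (t : ℂ) * (ef γ u a + ef γ v c) = t * ef γ u a + t * ef γ v c by ring, Complex.exp_add]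
  ring

theorem J_split {γ : ℝ} (hγ : 0 < γ) : ∃ C, 0 < C ∧ ∃ κ₀, 0 < κ₀ ∧ ∀ t κ x y r s₃ s₁ : ℝ,
    Inn γ t κ x y r s₃ s₁ → κ ≤ κ₀ →
    ‖jin t γ s₃ s₁ (eu κ y) (eu (κ / 2) x) +
      2 * γ * sg (aj γ 5) t γ (eu κ y) * hst t γ (zf γ (eu κ y)) (eu (κ / 2) x) -
      2 * γ * sg (aj γ 5) t γ (eu κ y) * (sg (aj γ 8) t γ (eu (κ / 2) x) *
        mf (eu (κ / 2) x) (zf γ (eu (κ / 2) x)) (zf γ (eu κ y)))‖ ≤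
      Real.exp (-γ * t) * (C / (1 + t * x ^ 2) / (1 + t * y ^ 2)) := by
  have l0 : 0 < aj γ 4 := aj_pos hγ (by norm_num)
  have l1 : aj γ 4 < aj γ 5 := aj_lt hγ (by norm_num)
  have l2 : aj γ 5 < aj γ 6 := aj_lt hγ (by norm_num)
  have l3 : aj γ 6 < 1 := aj_lt_one hγ (by norm_num)
  have l4 : 3 * (1 / aj γ 4 - aj γ 4) ≤ γ := aj_gap hγ (by norm_num)
  obtain ⟨C1, p1, B1⟩ := pair_bound hγ l0 l1 l2 l3 l4
  obtain ⟨C2, p2, κ₁, pκ, B2⟩ := J_outside hγ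
  obtain ⟨C3, p3, B3⟩ := J_inside hγ
  have l5 : 0 < 1 - aj γ 5 ^ 2 := by nlinarith
  refine ⟨2 * γ * C1 * C3 + C1 * (1 + 2 * γ) * C2, by positivity, min κ₁ ((1 - aj γ 5 ^ 2) / 10),
    by positivity, ?_⟩
  intro t κ x y r s₃ s₁ I hκ0
  have hκ1 := hκ0.trans (min_le_left _ _)
  have hκ2 := hκ0.trans (min_le_right _ _)
  have S := I.S
  have hu := eu_ne (κ / 2) x
  have hv := eu_ne κ y
  have hu1 := norm_eu_lt I.S'.hκ x
  have hv1 := norm_eu_lt S.hκ y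
  have ht := S.ht0
  have hRv := sqrt_norm_eu_lt S.hκ y
  have hRv0 : 0 < √‖eu κ y‖ := Real.sqrt_pos.2 (norm_pos_iff.2 hv)
  obtain ⟨A1, A2⟩ := B1 t κ y S I.hy
  have P := cint_pair2 (t := t) hγ hv hv1 l0 l1 l2 l3 I.h₁ I.h₃ I.b₃ I.d₃ (fun z hz => (A2 z hz).1)
    (K := fun a c => Complex.exp (t * ef γ (eu (κ / 2) x) a) *
      (0 + mf (eu (κ / 2) x) a c * (df γ (eu (κ / 2) x) a)⁻¹)) (by
      intro a c h1 h2 h3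
      have q0 : a ≠ 0 := norm_pos_iff.1 (by rw [h1]; exact I.h₁)
      have q1 := I.sub_ne h1 h2
      have q2 := I.d₁ a q0 h1.le
      simp only [mf]
      fun_prop (disch := assumption))
  rw [jin, P]
  have q1 := rd_ge (γ := γ) (u := eu κ y) l1 l2
  have q2 := rd_le (γ := γ) (u := eu κ y) l1 l2
  have q0 : 0 < rd (aj γ 4) (aj γ 5) (aj γ 6) γ (eu κ y) := lt_of_lt_of_le (by positivity) q1
  have T2 : ‖cint (rd (aj γ 4) (aj γ 5) (aj γ 6) γ (eu κ y)) (fun c =>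
      Complex.exp (t * ef γ (eu κ y) c) * (1 + 2 * γ * (df γ (eu κ y) c)⁻¹) *
        cint s₁ fun a => Complex.exp (t * ef γ (eu (κ / 2) x) a) *
      (0 + mf (eu (κ / 2) x) a c * (df γ (eu (κ / 2) x) a)⁻¹))‖ ≤
      Real.exp (-γ * t) * (C1 / (1 + t * y ^ 2)) * (1 + 2 * γ) * (C2 / (1 + t * x ^ 2)) := by
    refine norm_cint_le q0 fun z hz => ?_
    rw [norm_mul]
    have w1 := (A2 z hz).2 (1 + 2 * γ) 1 (2 * γ) (by rw [norm_one]; linarith) (by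
      rw [norm_mul, Complex.norm_ofNat, Complex.norm_real, Real.norm_eq_abs, abs_of_pos hγ]
      linarith)
    have w2 := B2 t κ x y s₁ I.S' hκ1 I.hx I.h₁ I.b₁ I.d₁ z (by rw [hz]; exact q1)
      (by rw [hz]; nlinarith)
    exact mul_le_mul w1 w2 (norm_nonneg _) (by positivity)
  generalize cint (rd (aj γ 4) (aj γ 5) (aj γ 6) γ (eu κ y)) _ = W at T2
  have T1 : ‖2 * γ * sg (aj γ 5) t γ (eu κ y) * (cint s₁ (fun a =>
      Complex.exp (t * ef γ (eu (κ / 2) x) a) *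
      (0 + mf (eu (κ / 2) x) a (zf γ (eu κ y)) * (df γ (eu (κ / 2) x) a)⁻¹)) +
      hst t γ (zf γ (eu κ y)) (eu (κ / 2) x) -
        sg (aj γ 8) t γ (eu (κ / 2) x) *
          mf (eu (κ / 2) x) (zf γ (eu (κ / 2) x)) (zf γ (eu κ y)))‖ ≤
      2 * γ * (C1 / (1 + t * y ^ 2)) * (Real.exp (-γ * t) * (C3 / (1 + t * x ^ 2))) := by
    by_cases hz : sg (aj γ 5) t γ (eu κ y) = 0
    · rw [hz, mul_zero, zero_mul, norm_zero]; positivity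
    · have w1 := lt_norm_zf hγ hv hv1 I.d₃
      have w2 := norm_zf_le_of_sg hz
      have hz0 := zf_ne (u := eu κ y) hγ hv1
      have hz1 : ‖zf γ (eu κ y)‖ ≤ 1 := w2.trans (by nlinarith)
      have w3 : s₁ < ‖eu (κ / 2) x * zf γ (eu κ y)‖ := by
        rw [norm_mul, norm_eu]
        calc s₁ < r * s₃ := I.h₁₃
          _ ≤ Real.exp (-(κ / 2)) * s₃ := mul_le_mul_of_nonneg_right I.hr I.h₃.le
          _ ≤ _ := by gcongr
      have w4 := df_string_lower hγ S.hκ (l0.trans l1) (l2.trans l3) (by linarith) w2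
        (u := eu (κ / 2) x) (by rw [norm_eu]) (by nlinarith [norm_nonneg (zf γ (eu κ y))])
      have w5 : df γ (eu (κ / 2) x) (eu (κ / 2) x * zf γ (eu κ y)) ≠ 0 := by
        refine norm_pos_iff.1 (lt_of_lt_of_le ?_ w4)
        have := S.hκ
        have := norm_pos_iff.2 hz0
        positivity
      have := B3 t κ x y s₁ I.S' I.hx I.h₁ I.b₁ I.d₁ _ hz0 w2 w3 w5
      rw [norm_mul, norm_mul, norm_mul]
      simp only [Complex.norm_ofNat, Complex.norm_real, Real.norm_eq_abs, abs_of_pos hγ]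
      gcongr
  have e : ∀ s F W h m : ℂ, s * F + W + s * h - s * m = s * (F + h - m) + W := by
    intros; ring
  rw [e]
  refine (norm_add_le _ _).trans ((add_le_add T1 T2).trans_eq ?_)
  have : 0 < 1 + t * x ^ 2 := by positivity
  have : 0 < 1 + t * y ^ 2 := by positivity
  field_simp

theorem mf_zf {γ : ℝ} (hγ : 0 < γ) {u : ℂ} (hu : u ≠ 0) (hu1 : ‖u‖ < 1) {z : ℂ} (hz : z ≠ 0)
    (hd : df γ u (u * z) ≠ 0) :
    mf u (zf γ u) z = (u - zf γ u * z) * (2 * γ + Tf γ u) * (1 + zf γ u * z) /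
      (2 * u * (z * df γ u (u * z))) := by
  have h0 := zf_ne (u := u) hγ hu1
  have h1 := zf_mul (u := u) hγ
  have h2 := df_factor hγ hu hu1 (mul_ne_zero hu hz)
  have h3 : zf γ u - u * z ≠ 0 := by
    intro h4
    rw [sub_eq_zero] at h4
    exact hd (by rw [← h4]; exact df_zf hγ hu hu1)
  rw [mf, div_eq_div_iff h3 (by simp [hu, hz, hd])]
  have h5 : 2 * u * (z * df γ u (u * z)) =
      (2 * γ + Tf γ u) * (1 + zf γ u * z) * (zf γ u - u * z) := by
    rw [h2, ← h1]
    field_simp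
    ring
  rw [h5]
  ring

/-- Everything that is needed about the small zero `zf γ (eu κ y)`. -/
structure Stg (γ κ y β : ℝ) : Prop where
  hγ : 0 < γ
  hκ : 0 < κ
  hκ1 : κ ≤ 1
  hβ : 0 < β
  hβ1 : β < 1
  hκβ : 10 * κ ≤ 1 - β ^ 2
  hz : ‖zf γ (eu κ y)‖ ≤ β * √‖eu κ y‖

theorem Stg.ne {γ κ y β : ℝ} (s : Stg γ κ y β) : zf γ (eu κ y) ≠ 0 :=
  zf_ne s.hγ (norm_eu_lt s.hκ y)

theorem Stg.le {γ κ y β : ℝ} (s : Stg γ κ y β) : ‖zf γ (eu κ y)‖ ≤ β := by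
  have := sqrt_norm_eu_lt s.hκ y
  have := s.hβ
  exact s.hz.trans (by nlinarith)

theorem Stg.lower {γ κ y β : ℝ} (s : Stg γ κ y β) {u : ℂ} (hu : Real.exp (-(κ / 2)) ≤ ‖u‖)
    (hu1 : ‖u‖ * ‖zf γ (eu κ y)‖ ≤ 1) :
    κ * (1 - β ^ 2) / 8 ≤ ‖zf γ (eu κ y)‖ * ‖df γ u (u * zf γ (eu κ y))‖ := by
  have h := df_string_lower s.hγ s.hκ s.hβ s.hβ1 s.hκβ s.hz hu hu1
  have h0 := norm_pos_iff.2 s.ne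
  rw [← div_div, div_le_iff₀ h0] at h
  linarith

theorem Stg.df_ne {γ κ y β : ℝ} (s : Stg γ κ y β) {u : ℂ} (hu : Real.exp (-(κ / 2)) ≤ ‖u‖)
    (hu1 : ‖u‖ * ‖zf γ (eu κ y)‖ ≤ 1) : df γ u (u * zf γ (eu κ y)) ≠ 0 := by
  have h := s.lower hu hu1
  have h1 := s.hβ
  have h2 := s.hβ1
  have h3 : 0 < 1 - β ^ 2 := by nlinarith
  have h4 := s.hκ
  have h5 : 0 < κ * (1 - β ^ 2) / 8 := by positivity
  exact norm_pos_iff.1 (pos_of_mul_pos_right (h5.trans_le h) (norm_nonneg _))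

theorem Stg.norm_mf_le {γ κ y β : ℝ} (s : Stg γ κ y β) (x : ℝ) :
    ‖mf (eu (κ / 2) x) (zf γ (eu (κ / 2) x)) (zf γ (eu κ y))‖ ≤
      32 * (4 * γ + 4) / (1 - β ^ 2) * (1 / κ) := by
  have hκ := s.hκ
  have hγ := s.hγ
  have hκ' : 0 < κ / 2 := by linarith
  have hu := eu_ne (κ / 2) x
  have hu1 := norm_eu_lt hκ' x
  have hz1 := s.le.trans s.hβ1.le
  have h1 : ‖eu (κ / 2) x‖ * ‖zf γ (eu κ y)‖ ≤ 1 := by nlinarith [norm_nonneg (zf γ (eu κ y))]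
  have h2 : Real.exp (-(κ / 2)) ≤ ‖eu (κ / 2) x‖ := (norm_eu _ _).ge
  rw [mf_zf hγ hu hu1 s.ne (s.df_ne h2 h1)]
  have h3 := s.lower h2 h1
  have h4 : ‖zf γ (eu (κ / 2) x)‖ ≤ 1 :=
    (norm_zf_le hγ hu).trans (sqrt_norm_eu_lt hκ' x).le
  have h5 : ‖2 * γ + Tf γ (eu (κ / 2) x)‖ ≤ 4 * γ + 4 := by
    refine (norm_add_le _ _).trans ?_
    have := norm_Tf_le (γ := γ) (x := x) hκ' (by linarith [s.hκ1])
    rw [norm_mul, Complex.norm_ofNat, Complex.norm_real, Real.norm_eq_abs]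
    rw [abs_of_pos hγ] at *
    linarith
  have h6 : 1 / 2 ≤ ‖eu (κ / 2) x‖ := by
    rw [norm_eu]
    linarith [Real.add_one_le_exp (-(κ / 2)), s.hκ1]
  have h7 : ‖zf γ (eu (κ / 2) x) * zf γ (eu κ y)‖ ≤ 1 := by
    rw [norm_mul]
    nlinarith [norm_nonneg (zf γ (eu (κ / 2) x)), norm_nonneg (zf γ (eu κ y))]
  have h8 : ‖eu (κ / 2) x - zf γ (eu (κ / 2) x) * zf γ (eu κ y)‖ ≤ 2 :=
    (norm_sub_le _ _).trans (by linarith)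
  have h9 : ‖1 + zf γ (eu (κ / 2) x) * zf γ (eu κ y)‖ ≤ 2 :=
    (norm_add_le _ _).trans (by rw [norm_one]; linarith)
  have hβ : 0 < 1 - β ^ 2 := by nlinarith [s.hβ, s.hβ1]
  have h10 : κ * (1 - β ^ 2) / 8 ≤ ‖2 * eu (κ / 2) x * (zf γ (eu κ y) *
      df γ (eu (κ / 2) x) (eu (κ / 2) x * zf γ (eu κ y)))‖ := by
    rw [norm_mul, norm_mul, norm_mul, Complex.norm_ofNat]
    have : 0 < κ * (1 - β ^ 2) / 8 := by positivity
    nlinarith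
  rw [norm_div, norm_mul, norm_mul]
  calc _ ≤ 2 * (4 * γ + 4) * 2 / (κ * (1 - β ^ 2) / 8) := by gcongr
    _ = _ := by field_simp; ring

theorem J_main {γ : ℝ} (hγ : 0 < γ) : ∃ C, 0 < C ∧ ∃ κ₀, 0 < κ₀ ∧ ∀ t κ x y r s₃ s₁ : ℝ,
    Inn γ t κ x y r s₃ s₁ → κ ≤ κ₀ →
    ‖jin t γ s₃ s₁ (eu κ y) (eu (κ / 2) x) +
      2 * γ * sg (aj γ 5) t γ (eu κ y) * hst t γ (zf γ (eu κ y)) (eu (κ / 2) x)‖ ≤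
      C * (1 / κ) / (1 + t * x ^ 2) / (1 + t * y ^ 2) := by
  have l0 : 0 < aj γ 5 := aj_pos hγ (by norm_num)
  have l1 : aj γ 5 < aj γ 6 := aj_lt hγ (by norm_num)
  have l3 : aj γ 5 < 1 := aj_lt_one hγ (by norm_num)
  have k0 : 0 < aj γ 8 := aj_pos hγ (by norm_num)
  have k3 : aj γ 8 < 1 := aj_lt_one hγ (by norm_num)
  obtain ⟨C0, p0, κ₁, pκ, B0⟩ := J_split hγ
  obtain ⟨C1, p1, B1⟩ := sg_bound hγ l0 l3
  obtain ⟨C2, p2, B2⟩ := sg_bound hγ k0 k3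
  have l5 : 0 < 1 - aj γ 5 ^ 2 := by nlinarith
  set D := 32 * (4 * γ + 4) / (1 - aj γ 5 ^ 2) with hD
  have pD : 0 < D := by positivity
  refine ⟨C0 + 2 * γ * C1 * (C2 * D), by positivity, min κ₁ ((1 - aj γ 5 ^ 2) / 10),
    by positivity, ?_⟩
  intro t κ x y r s₃ s₁ I hκ0
  have hκ1 := hκ0.trans (min_le_left _ _)
  have hκ2 := hκ0.trans (min_le_right _ _)
  have S := I.S
  have hκ := S.hκ
  have ht := S.ht0
  have h0 := B0 t κ x y r s₃ s₁ I hκ1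
  have h1 := B1 t κ y ht hκ S.hκ1 S.up I.hy
  have h2 := B2 t (κ / 2) x ht I.S'.hκ I.S'.hκ1 I.S'.up I.hx
  have hm : ‖2 * γ * sg (aj γ 5) t γ (eu κ y) * (sg (aj γ 8) t γ (eu (κ / 2) x) *
      mf (eu (κ / 2) x) (zf γ (eu (κ / 2) x)) (zf γ (eu κ y)))‖ ≤
      2 * γ * (C1 / (1 + t * y ^ 2)) * (C2 / (1 + t * x ^ 2) * (D * (1 / κ))) := by
    by_cases hz : sg (aj γ 5) t γ (eu κ y) = 0
    · rw [hz, mul_zero, zero_mul, norm_zero]; positivity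
    · have st : Stg γ κ y (aj γ 5) := ⟨hγ, hκ, S.hκ1, l0, l3, by linarith, norm_zf_le_of_sg hz⟩
      have h3 := st.norm_mf_le x
      rw [norm_mul, norm_mul, norm_mul, norm_mul]
      simp only [Complex.norm_ofNat, Complex.norm_real, Real.norm_eq_abs, abs_of_pos hγ]
      gcongr
  have h4 : 1 ≤ 1 / κ := by rw [le_div_iff₀ hκ]; linarith [S.hκ1]
  have h5 := exp_neg_mul_le_one hγ ht
  have h6 : Real.exp (-γ * t) * (C0 / (1 + t * x ^ 2) / (1 + t * y ^ 2)) ≤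
      1 / κ * (C0 / (1 + t * x ^ 2) / (1 + t * y ^ 2)) := by
    have : 0 ≤ C0 / (1 + t * x ^ 2) / (1 + t * y ^ 2) := by positivity
    exact mul_le_mul_of_nonneg_right (h5.trans h4) this
  refine (norm_le_norm_sub_add _ (2 * γ * sg (aj γ 5) t γ (eu κ y) * (sg (aj γ 8) t γ (eu (κ / 2) x) *
      mf (eu (κ / 2) x) (zf γ (eu (κ / 2) x)) (zf γ (eu κ y))))).trans
    ((add_le_add (h0.trans h6) hm).trans_eq ?_)
  have : 0 < 1 + t * x ^ 2 := by positivity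
  have : 0 < 1 + t * y ^ 2 := by positivity
  field_simp

theorem om_mul_eq {a u : ℂ} (ha : a ≠ 0) (hu : u ≠ a) : om (u * a⁻¹) = u * a / (u - a) ^ 2 := by
  have h1 : u - a ≠ 0 := sub_ne_zero.2 hu
  have h2 : 1 - u * a⁻¹ ≠ 0 := by
    intro h
    apply h1
    have : (1 - u * a⁻¹) * a = a - u := by field_simp
    rw [h, zero_mul] at this
    rw [← neg_sub, ← this, neg_zero]
  have h3 : (1 - u * a⁻¹) = -(u - a) / a := by field_simp; ring
  rw [om, h3]
  field_simp

theorem om_differentiableAt {w : ℂ} (hw : 1 - w ≠ 0) : DifferentiableAt ℂ om w := by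
  have : (1 - w) ^ 2 ≠ 0 := pow_ne_zero 2 hw
  unfold om
  fun_prop (disch := assumption)

/-- A double pole outside of the contour. -/
theorem norm_cint_om_le {ρ₁ ρ₂ B M : ℝ} {a : ℂ} {h : ℂ → ℂ} {s : Set ℂ} (hs : IsOpen s)
    (hh : DifferentiableOn ℂ h s) (hsub : ∀ u : ℂ, ρ₁ ≤ ‖u‖ → ‖u‖ ≤ ρ₂ → u ∈ s)
    (h0 : 0 < ρ₁) (h1 : ρ₁ < ‖a‖) (h2 : ‖a‖ < ρ₂) (hB : ∀ u, ‖u‖ = ρ₂ → ‖om (u * a⁻¹)‖ ≤ B)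
    (hM : ∀ u, ‖u‖ = ρ₂ → ‖h u‖ ≤ M) (hMa : ‖h a‖ ≤ M) :
    ‖cint ρ₁ fun u => om (u * a⁻¹) * h u‖ ≤ B * (2 * M) + ‖a‖ * ‖deriv h a‖ := by
  have ha : a ≠ 0 := norm_pos_iff.1 (h0.trans h1)
  have has : a ∈ s := hsub a h1.le h2.le
  have hn := hs.mem_nhds has
  have hd : DifferentiableOn ℂ (dslope h a) s := (Complex.differentiableOn_dslope hn).2 hh
  have h3 : 0 < ρ₂ := h0.trans (h1.trans h2)
  have ne1 : ∀ u : ℂ, ‖u‖ ≤ ρ₁ → 1 - u * a⁻¹ ≠ 0 := by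
    intro u hu
    refine one_sub_ne ?_
    rw [norm_mul, norm_inv, ← div_eq_mul_inv, div_lt_one (h0.trans h1)]
    exact hu.trans_lt h1
  have z0 : cint ρ₁ (fun u => om (u * a⁻¹)) = 0 := by
    rw [cint_disc h0]
    · simp [om]
    · intro u hu
      have := om_differentiableAt (ne1 u hu)
      exact this.comp u (f := fun u => u * a⁻¹) (by fun_prop)
  have key : ∀ u, u ≠ a → om (u * a⁻¹) * (h u - h a) = u * a * dslope h a u / (u - a) := by
    intro u hu
    have : u - a ≠ 0 := sub_ne_zero.2 hu
    rw [om_mul_eq ha hu, dslope_of_ne _ hu, slope_def_field]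
    field_simp
  have hc : ∀ u, ‖u‖ = ρ₁ → ContinuousAt (fun u => om (u * a⁻¹)) u := by
    intro u hu
    have := om_differentiableAt (ne1 u hu.le)
    exact (this.comp u (f := fun u => u * a⁻¹) (by fun_prop)).continuousAt
  have e1 : cint ρ₁ (fun u => om (u * a⁻¹) * h u) =
      cint ρ₁ (fun u => u * a * dslope h a u / (u - a)) := by
    have : cint ρ₁ (fun u => u * a * dslope h a u / (u - a)) =
        cint ρ₁ (fun u => om (u * a⁻¹) * h u - om (u * a⁻¹) * h a) := by
      refine cint_congr h0 fun u hu => ?_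
      rw [← key u (fun e => by rw [e] at hu; exact h1.ne' hu)]
      ring
    rw [this, cint_sub h0, cint_mul_const h0, z0, zero_mul, sub_zero]
    · refine continuous_circle_of_forall (f := fun u => om (u * a⁻¹) * h u) h0 fun u hu => ?_
      refine (hc u hu).mul (hh.differentiableAt (hs.mem_nhds (hsub u hu.ge ?_))).continuousAt
      rw [hu]; exact (h1.trans h2).le
    · refine continuous_circle_of_forall (f := fun u => om (u * a⁻¹) * h a) h0 fun u hu => ?_
      exact (hc u hu).mul continuousAt_const
  rw [e1, cint_pole h0 h1 h2 (h := fun u => u * a * dslope h a u)]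
  · rw [dslope_same, show a * a * deriv h a / a = a * deriv h a by field_simp, ← norm_mul]
    refine (norm_sub_le _ _).trans ?_
    gcongr
    refine norm_cint_le h3 fun u hu => ?_
    rw [← key u (fun e => by rw [e] at hu; exact h2.ne hu), norm_mul]
    have h5 : ‖h u - h a‖ ≤ 2 * M := (norm_sub_le _ _).trans (by linarith [hM u hu])
    have h6 := hB u hu
    have := (norm_nonneg _).trans h6
    gcongr
  · intro u hu1 hu2
    have := hd.differentiableAt (hs.mem_nhds (hsub u hu1 hu2))
    fun_prop (disch := assumption)

theorem norm_om_far_le {w : ℂ} {m : ℝ} (hm : 0 < m) (hm1 : m ≤ 1) (hw : 1 + m ≤ ‖w‖) :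
    ‖om w‖ ≤ 2 / m ^ 2 := by
  have h1 : ‖w‖ - 1 ≤ ‖1 - w‖ := by
    have := norm_sub_norm_le w 1
    rw [norm_sub_rev, norm_one] at this
    exact this
  have h2 : (‖w‖ - 1) ^ 2 ≤ ‖1 - w‖ ^ 2 := by gcongr; linarith
  rw [om, norm_div, norm_pow, div_le_div_iff₀ (by nlinarith) (by positivity)]
  generalize ‖w‖ = R at *
  nlinarith [mul_nonneg hm.le (sub_nonneg.2 hw), mul_nonneg (sub_nonneg.2 hm1) (sub_nonneg.2 hw), mul_nonneg (sub_nonneg.2 hw) (sub_nonneg.2 hw), mul_nonneg hm.le (mul_nonneg (sub_nonneg.2 hm1) (sub_nonneg.2 hw)), sq_nonneg m]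

theorem zf_sub_inv {γ : ℝ} (hγ : 0 < γ) {v : ℂ} (hv : v ≠ 0) (hv1 : ‖v‖ < 1) :
    zf γ v - (zf γ v)⁻¹ = -Tf γ v - 2 * γ * ((1 + v) / (1 - v)) := by
  have h0 := zf_ne (u := v) hγ hv1
  have h1 := zf_mul (u := v) hγ
  have h2 := zf_mul' hγ hv
  have h3 := one_sub_ne hv1
  have e1 : (zf γ v)⁻¹ = (2 * γ + Tf γ v) / (1 - v) := by
    rw [← h1, eq_div_iff (by rw [h1]; exact h3), inv_mul_cancel_left₀ h0]
  have e2 : zf γ v = v * (Tf γ v - 2 * γ) / (1 - v) := by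
    rw [← h2, mul_div_cancel_left₀ _ h3]
  rw [e1]
  nth_rewrite 1 [e2]
  field_simp
  ring

theorem zf_inv {γ : ℝ} (hγ : 0 < γ) {v : ℂ} (hv1 : ‖v‖ < 1) :
    (zf γ v)⁻¹ = (2 * γ + Tf γ v) / (1 - v) := by
  have h0 := zf_ne (u := v) hγ hv1
  have h1 := zf_mul (u := v) hγ
  have h3 := one_sub_ne hv1
  rw [← h1, eq_div_iff (by rw [h1]; exact h3), inv_mul_cancel_left₀ h0]

theorem ef_string {γ : ℝ} {u z : ℂ} (hu : u ≠ 0) (hz : z ≠ 0) :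
    ef γ u (u * z) = (u * z)⁻¹ - u * z + (z - z⁻¹) - 4 * γ := by
  unfold ef
  field_simp
  ring

theorem ef_string_add {γ : ℝ} (hγ : 0 < γ) {u v : ℂ} (hu : u ≠ 0) (hv : v ≠ 0) (hv1 : ‖v‖ < 1) :
    ef γ u (u * zf γ v) + (2 * Tf γ v - 4 * γ) =
      ((u * zf γ v)⁻¹ - u * zf γ v) + Tf γ v - 2 * γ * ((1 + v) / (1 - v)) - 8 * γ := by
  rw [ef_string hu (zf_ne hγ hv1), zf_sub_inv hγ hv hv1]
  ring

theorem ef_string_pole {γ : ℝ} (hγ : 0 < γ) {v : ℂ} (hv : v ≠ 0) (hv1 : ‖v‖ < 1) :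
    ef γ v⁻¹ (v⁻¹ * zf γ v) + (2 * Tf γ v - 4 * γ) = -8 * γ := by
  rw [ef_string_add hγ (inv_ne_zero hv) hv hv1]
  have h0 := zf_ne (u := v) hγ hv1
  have h1 := zf_mul (u := v) hγ
  have h2 := zf_mul' hγ hv
  have h3 := one_sub_ne hv1
  have e2 : v⁻¹ * zf γ v = (Tf γ v - 2 * γ) / (1 - v) := by
    rw [eq_div_iff h3, mul_assoc, mul_comm (zf γ v), h2, inv_mul_cancel_left₀ hv]
  rw [mul_inv, inv_inv, zf_inv hγ hv1, e2]
  field_simp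
  ring

theorem df_string_pole {γ : ℝ} (hγ : 0 < γ) {v : ℂ} (hv : v ≠ 0) (hv1 : ‖v‖ < 1) :
    df γ v⁻¹ (v⁻¹ * zf γ v) = -4 * γ := by
  have h0 := zf_ne (u := v) hγ hv1
  have h := df_zf hγ hv hv1
  have : df γ v⁻¹ (v⁻¹ * zf γ v) = -df γ v (zf γ v) - 4 * γ := by
    unfold df
    field_simp
    ring
  rw [this, h]
  ring

theorem cayley_re_nonneg {v : ℂ} (hv1 : ‖v‖ < 1) : 0 ≤ ((1 + v) / (1 - v)).re := by
  have h : Complex.normSq v ≤ 1 := by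
    rw [Complex.normSq_eq_norm_sq]; nlinarith [norm_nonneg v]
  rw [Complex.normSq_apply] at h
  rw [Complex.div_re, ← add_div]
  refine div_nonneg ?_ (Complex.normSq_nonneg _)
  simp
  nlinarith

theorem inv_sub_self_re {p : ℂ} (hp : ‖p‖ = 1) : (p⁻¹ - p).re = 0 := by
  rw [Complex.inv_def, Complex.normSq_eq_norm_sq, hp]
  simp

theorem norm_exp_ofReal_mul (t : ℝ) (w : ℂ) : ‖Complex.exp (t * w)‖ = Real.exp (t * w.re) := by
  rw [Complex.norm_exp]; simp

theorem norm_sg {β t γ : ℝ} {v : ℂ} (h : sg β t γ v ≠ 0) :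
    ‖sg β t γ v‖ = Real.exp (t * (2 * Tf γ v - 4 * γ).re) / ‖Tf γ v‖ := by
  have : ‖zf γ v‖ ≤ β * √‖v‖ := norm_zf_le_of_sg h
  rw [sg, if_pos this, norm_div, norm_exp_ofReal_mul]

theorem exp_Tf_le {β t γ K : ℝ} {v : ℂ} (h : sg β t γ v ≠ 0)
    (hT : Tf γ v ≠ 0) (hK : ‖sg β t γ v‖ * ‖Tf γ v‖ ≤ K) :
    Real.exp (t * ((Tf γ v).re - 8 * γ)) ≤ (1 + K) * Real.exp (-6 * γ * t) := by
  rw [norm_sg h, div_mul_cancel₀ _ (norm_ne_zero_iff.2 hT)] at hK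
  have e : t * (2 * Tf γ v - 4 * γ).re = t * ((Tf γ v).re - 2 * γ) + t * ((Tf γ v).re - 2 * γ) := by
    simp; ring
  rw [e, Real.exp_add] at hK
  have h1 : Real.exp (t * ((Tf γ v).re - 2 * γ)) ≤ 1 + K := by
    nlinarith [sq_nonneg (Real.exp (t * ((Tf γ v).re - 2 * γ)) - 1)]
  rw [show t * ((Tf γ v).re - 8 * γ) = t * ((Tf γ v).re - 2 * γ) + -6 * γ * t by ring, Real.exp_add]
  gcongr

theorem norm_sg_mul_exp {β t γ : ℝ} {v w : ℂ} (h : sg β t γ v ≠ 0) :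
    ‖sg β t γ v‖ * ‖Complex.exp (t * w)‖ =
      Real.exp (t * (w + (2 * Tf γ v - 4 * γ)).re) / ‖Tf γ v‖ := by
  rw [norm_sg h, norm_exp_ofReal_mul, Complex.add_re, mul_add, Real.exp_add]
  ring

theorem string_exponent {γ : ℝ} (hγ : 0 < γ) {u v : ℂ} (hu : u ≠ 0) (hv : v ≠ 0) (hv1 : ‖v‖ < 1)
    (h : ‖u * zf γ v‖ = 1 ∨ u = v⁻¹) :
    (ef γ u (u * zf γ v) + (2 * Tf γ v - 4 * γ)).re ≤ (Tf γ v).re - 8 * γ := by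
  rcases h with h | h
  · rw [ef_string_add hγ hu hv hv1]
    have h1 := inv_sub_self_re h
    have h2 := cayley_re_nonneg hv1
    have e : (2 * γ * ((1 + v) / (1 - v))).re = 2 * γ * ((1 + v) / (1 - v)).re := by
      rw [show (2 * γ : ℂ) = ((2 * γ : ℝ) : ℂ) by push_cast; ring, Complex.re_ofReal_mul]
    have e8 : (8 * (γ : ℂ)).re = 8 * γ := by simp
    rw [Complex.sub_re, Complex.sub_re, Complex.add_re, h1, e, e8]
    nlinarith [mul_nonneg hγ.le h2]
  · rw [h, ef_string_pole hγ hv hv1]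
    have := Tf_re_nonneg γ v
    simp
    linarith

theorem hst_hasDerivAt {t γ : ℝ} {z u : ℂ} (hz : z ≠ 0) (hu : u ≠ 0) (hd : df γ u (u * z) ≠ 0) :
    HasDerivAt (hst t γ z) ((z⁻¹ - z) * (Complex.exp (t * ef γ u (u * z)) *
      (t * (-(u ^ 2)⁻¹ * z⁻¹ - z)) * (df γ u (u * z))⁻¹ + Complex.exp (t * ef γ u (u * z)) *
      (-((z - (u ^ 2)⁻¹ * z⁻¹) / 2) / (df γ u (u * z)) ^ 2))) u := by
  have h1 : HasDerivAt (fun u => ef γ u (u * z)) (-(u ^ 2)⁻¹ * z⁻¹ - z) u := by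
    have h : HasDerivAt (fun u => u⁻¹ * z⁻¹ - u * z + (z - z⁻¹) - 4 * (γ : ℂ))
        (-(u ^ 2)⁻¹ * z⁻¹ - 1 * z) u :=
      ((((hasDerivAt_inv hu).mul_const z⁻¹).sub ((hasDerivAt_id u).mul_const z)).add_const _).sub_const _
    rw [one_mul] at h
    refine h.congr_of_eventuallyEq ?_
    filter_upwards [isOpen_ne.mem_nhds hu] with w hw
    rw [ef_string hw hz, mul_inv]
  have h2 : HasDerivAt (fun u => df γ u (u * z)) ((z - (u ^ 2)⁻¹ * z⁻¹) / 2) u := by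
    have h : HasDerivAt (fun u => (u * z + u⁻¹ * z⁻¹) / 2 - cfun z - 2 * (γ : ℂ))
        ((1 * z + -(u ^ 2)⁻¹ * z⁻¹) / 2) u :=
      (((((hasDerivAt_id u).mul_const z).add ((hasDerivAt_inv hu).mul_const z⁻¹)).div_const 2).sub_const
        _).sub_const _
    have e : (1 * z + -(u ^ 2)⁻¹ * z⁻¹) / 2 = (z - (u ^ 2)⁻¹ * z⁻¹) / 2 := by ring
    rw [e] at h
    refine h.congr_of_eventuallyEq ?_
    filter_upwards [isOpen_ne.mem_nhds hu] with w hw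
    rw [df_string hw hz, cfun, mul_inv]
  exact (((h1.const_mul (t : ℂ)).cexp).mul (h2.inv hd)).const_mul (z⁻¹ - z)

section

variable {γ κ y β t a₀ P : ℝ} (s : Stg γ κ y β) (ha₀ : 0 < a₀)
  (hT : a₀ ≤ ‖Tf γ (eu κ y)‖) (h0 : sg β t γ (eu κ y) ≠ 0) (ht : 0 ≤ t)
  (hP : Real.exp (t * ((Tf γ (eu κ y)).re - 8 * γ)) ≤ P)
include s ha₀ hT h0 ht hP

theorem norm_sg_exp_le {u : ℂ} (hu0 : u ≠ 0) (h : ‖u * zf γ (eu κ y)‖ = 1 ∨ u = (eu κ y)⁻¹) :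
    ‖sg β t γ (eu κ y)‖ * ‖Complex.exp (t * ef γ u (u * zf γ (eu κ y)))‖ ≤ P / a₀ := by
  rw [norm_sg_mul_exp h0]
  have h1 := string_exponent s.hγ hu0 (eu_ne κ y) (norm_eu_lt s.hκ y) h
  have h2 : Real.exp (t * (ef γ u (u * zf γ (eu κ y)) + (2 * Tf γ (eu κ y) - 4 * γ)).re) ≤ P := by
    refine le_trans ?_ hP
    gcongr
  have := (Real.exp_pos _).le.trans h2
  gcongr

omit ha₀ hT h0 ht hP in
theorem Stg.inv_le : ‖(zf γ (eu κ y))⁻¹‖ ≤ 8 * (γ + 1) * (1 / κ) := by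
  have hκ := s.hκ
  have hγ := s.hγ
  rw [zf_inv s.hγ (norm_eu_lt s.hκ y), norm_div]
  have h1 : ‖2 * γ + Tf γ (eu κ y)‖ ≤ 4 * γ + 4 := by
    refine (norm_add_le _ _).trans ?_
    have := norm_Tf_le (γ := γ) (x := y) s.hκ s.hκ1
    rw [norm_mul, Complex.norm_ofNat, Complex.norm_real, Real.norm_eq_abs]
    rw [abs_of_pos s.hγ] at *
    linarith
  have h2 : κ / 2 ≤ ‖1 - eu κ y‖ := by
    have h3 := norm_sub_norm_le (1 : ℂ) (eu κ y)
    rw [norm_one, norm_eu] at h3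
    linarith [le_one_sub_norm_eu s.hκ s.hκ1]
  calc _ ≤ (4 * γ + 4) / (κ / 2) := by gcongr
    _ = _ := by field_simp; ring

omit ha₀ hT h0 ht hP in
theorem Stg.le_inv : ‖zf γ (eu κ y)‖ ≤ ‖(zf γ (eu κ y))⁻¹‖ := by
  have h1 := s.le.trans s.hβ1.le
  have h2 := norm_pos_iff.2 s.ne
  rw [norm_inv]
  exact h1.trans ((one_le_inv₀ h2).2 h1)

theorem norm_sg_hst_le {u : ℂ} (hu : Real.exp (-(κ / 2)) ≤ ‖u‖)
    (hu1 : ‖u‖ * ‖zf γ (eu κ y)‖ ≤ 1) (h : ‖u * zf γ (eu κ y)‖ = 1 ∨ u = (eu κ y)⁻¹) :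
    ‖sg β t γ (eu κ y) * hst t γ (zf γ (eu κ y)) u‖ ≤ 16 * P / (a₀ * (1 - β ^ 2)) * (1 / κ) := by
  have hu0 : u ≠ 0 := norm_pos_iff.1 ((Real.exp_pos _).trans_le hu)
  have h1 := norm_sg_exp_le s ha₀ hT h0 ht hP hu0 h
  have h2 := s.lower hu hu1
  have h3 := norm_pos_iff.2 s.ne
  have h4 := s.le_inv
  have hβ : 0 < 1 - β ^ 2 := by nlinarith [s.hβ, s.hβ1]
  have hκ := s.hκ
  have h5 : ‖(zf γ (eu κ y))⁻¹ - zf γ (eu κ y)‖ ≤ 2 * ‖zf γ (eu κ y)‖⁻¹ := by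
    refine (norm_sub_le _ _).trans ?_
    rw [norm_inv] at *
    linarith
  have h6 : ‖(df γ u (u * zf γ (eu κ y)))⁻¹‖ ≤ 8 * ‖zf γ (eu κ y)‖ / (κ * (1 - β ^ 2)) := by
    have h7 : 0 < κ * (1 - β ^ 2) / 8 := by positivity
    have h8 : 0 < ‖df γ u (u * zf γ (eu κ y))‖ :=
      pos_of_mul_pos_right (h7.trans_le h2) h3.le
    rw [norm_inv, inv_le_comm₀ h8 (by positivity), inv_div, div_le_iff₀ (by positivity)]
    linarith
  have hP0 := (Real.exp_pos _).le.trans hP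
  rw [hst, norm_mul, norm_mul, norm_mul]
  calc ‖sg β t γ (eu κ y)‖ * (‖(zf γ (eu κ y))⁻¹ - zf γ (eu κ y)‖ *
        (‖Complex.exp (t * ef γ u (u * zf γ (eu κ y)))‖ * ‖(df γ u (u * zf γ (eu κ y)))⁻¹‖))
      = ‖(zf γ (eu κ y))⁻¹ - zf γ (eu κ y)‖ * ‖(df γ u (u * zf γ (eu κ y)))⁻¹‖ *
        (‖sg β t γ (eu κ y)‖ * ‖Complex.exp (t * ef γ u (u * zf γ (eu κ y)))‖) := by ring
    _ ≤ (2 * ‖zf γ (eu κ y)‖⁻¹) * (8 * ‖zf γ (eu κ y)‖ / (κ * (1 - β ^ 2))) * (P / a₀) := by gcongr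
    _ = _ := by field_simp; ring

theorem norm_deriv_sg_hst_le :
    ‖deriv (fun u => sg β t γ (eu κ y) * hst t γ (zf γ (eu κ y)) u) (eu κ y)⁻¹‖ ≤
      P / a₀ * (2 * (8 * (γ + 1) * (1 / κ)) * ((8 * (γ + 1) * (1 / κ)) *
        (t / (2 * γ) + 1 / (16 * γ ^ 2)))) := by
  have hv := eu_ne κ y
  have hv1 := norm_eu_lt s.hκ y
  have hγ := s.hγ
  have hD := df_string_pole hγ hv hv1
  have hD0 : df γ (eu κ y)⁻¹ ((eu κ y)⁻¹ * zf γ (eu κ y)) ≠ 0 := by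
    rw [hD]; simp [hγ.ne']
  have h1 := norm_sg_exp_le s ha₀ hT h0 ht hP (inv_ne_zero hv) (Or.inr rfl)
  have h2 := s.inv_le
  have h3 := s.le_inv
  have hP0 := (Real.exp_pos _).le.trans hP
  rw [((hst_hasDerivAt s.ne (inv_ne_zero hv) hD0).const_mul _).deriv, hD, inv_pow, inv_inv]
  set Z := 8 * (γ + 1) * (1 / κ) with hZ
  set z := zf γ (eu κ y) with hz
  set X := Complex.exp (t * ef γ (eu κ y)⁻¹ ((eu κ y)⁻¹ * z)) with hX
  have hZ0 : 0 ≤ Z := (norm_nonneg _).trans h2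
  have e : sg β t γ (eu κ y) * ((z⁻¹ - z) * (X * (t * (-eu κ y ^ 2 * z⁻¹ - z)) * (-4 * (γ : ℂ))⁻¹ +
      X * (-((z - eu κ y ^ 2 * z⁻¹) / 2) / (-4 * (γ : ℂ)) ^ 2))) =
      (sg β t γ (eu κ y) * X) * ((z⁻¹ - z) * ((eu κ y ^ 2 * z⁻¹ + z) * ((t / (4 * γ) : ℝ) : ℂ) +
        (eu κ y ^ 2 * z⁻¹ - z) * ((1 / (32 * γ ^ 2) : ℝ) : ℂ))) := by
    have : (γ : ℂ) ≠ 0 := by exact_mod_cast hγ.ne'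
    push_cast
    field_simp
    ring
  rw [e, norm_mul, norm_mul, norm_mul]
  have n1 : ‖eu κ y ^ 2 * z⁻¹‖ ≤ Z := by
    rw [norm_mul, norm_pow]
    have : ‖eu κ y‖ ^ 2 ≤ 1 := by nlinarith [norm_nonneg (eu κ y)]
    calc _ ≤ 1 * Z := by gcongr
      _ = Z := one_mul _
  have n2 := h3.trans h2
  have n3 : ‖z⁻¹ - z‖ ≤ 2 * Z := (norm_sub_le _ _).trans (by linarith)
  have n4 : ‖eu κ y ^ 2 * z⁻¹ - z‖ ≤ 2 * Z := (norm_sub_le _ _).trans (by linarith)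
  have n5 : ‖eu κ y ^ 2 * z⁻¹ + z‖ ≤ 2 * Z := (norm_add_le _ _).trans (by linarith)
  have n6 : ‖(eu κ y ^ 2 * z⁻¹ + z) * ((t / (4 * γ) : ℝ) : ℂ) +
        (eu κ y ^ 2 * z⁻¹ - z) * ((1 / (32 * γ ^ 2) : ℝ) : ℂ)‖ ≤
      Z * (t / (2 * γ) + 1 / (16 * γ ^ 2)) := by
    refine (norm_add_le _ _).trans ?_
    rw [norm_mul, norm_mul, Complex.norm_real, Complex.norm_real, Real.norm_of_nonneg (by positivity),
      Real.norm_of_nonneg (by positivity)]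
    calc _ ≤ 2 * Z * (t / (4 * γ)) + 2 * Z * (1 / (32 * γ ^ 2)) := by gcongr
      _ = _ := by ring
  gcongr

omit ha₀ hT h0 ht hP in
theorem Stg.norm_lt (low : β + β * ((1 - β) / 2) ≤ Real.exp (-(κ / 2))) :
    ‖zf γ (eu κ y)‖ < ‖eu κ y‖ ∧ 1 + (1 - β) / 2 ≤ ‖zf γ (eu κ y)‖⁻¹ * ‖eu κ y‖ := by
  have hz := norm_pos_iff.2 s.ne
  have hz2 := s.hz
  rw [sqrt_norm_eu] at hz2
  have ev : ‖eu κ y‖ = Real.exp (-(κ / 2)) * Real.exp (-(κ / 2)) := by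
    rw [norm_eu, ← Real.exp_add]; ring_nf
  have hx := Real.exp_pos (-(κ / 2))
  have hβ := s.hβ
  have hβ1 := s.hβ1
  rw [ev, inv_mul_eq_div, le_div_iff₀ hz]
  generalize Real.exp (-(κ / 2)) = x at *
  have hb : β < x := lt_of_lt_of_le (by nlinarith) low
  refine ⟨hz2.trans_lt (by gcongr), ?_⟩
  calc (1 + (1 - β) / 2) * ‖zf γ (eu κ y)‖ ≤ (1 + (1 - β) / 2) * (β * x) := by
        gcongr
    _ = (β + β * ((1 - β) / 2)) * x := by ring
    _ ≤ x * x := by gcongr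

omit ha₀ hT h0 ht hP in
theorem Stg.isOpen_string : IsOpen {u : ℂ | u ≠ 0 ∧ df γ u (u * zf γ (eu κ y)) ≠ 0} := by
  have : ContinuousOn (fun u => df γ u (u * zf γ (eu κ y))) {u | u ≠ 0} := by
    intro u hu
    have h1 : u ≠ 0 := hu
    have h2 : u * zf γ (eu κ y) ≠ 0 := mul_ne_zero h1 s.ne
    have : DifferentiableAt ℂ (fun u => df γ u (u * zf γ (eu κ y))) u := by
      fun_prop (disch := assumption)
    exact this.continuousAt.continuousWithinAt
  exact this.isOpen_inter_preimage isOpen_ne isOpen_ne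

theorem norm_sg_cint_hst_le (low : β + β * ((1 - β) / 2) ≤ Real.exp (-(κ / 2))) :
    ‖sg β t γ (eu κ y) * cint (Real.exp (-(κ / 2)))
      (fun u => om (u * eu κ y) * hst t γ (zf γ (eu κ y)) u)‖ ≤
    2 / ((1 - β) / 2) ^ 2 * (2 * (16 * P / (a₀ * (1 - β ^ 2)) * (1 / κ))) +
      3 * (P / a₀ * (2 * (8 * (γ + 1) * (1 / κ)) * ((8 * (γ + 1) * (1 / κ)) *
        (t / (2 * γ) + 1 / (16 * γ ^ 2))))) := by
  have hκ := s.hκ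
  have hz := norm_pos_iff.2 s.ne
  have hv := eu_ne κ y
  have hv1 := norm_eu_lt hκ y
  obtain ⟨zv, hB⟩ := s.norm_lt low
  have hm : 0 < (1 - β) / 2 := by linarith [s.hβ1]
  have hm1 : (1 - β) / 2 ≤ 1 := by linarith [s.hβ]
  have hx := Real.exp_pos (-(κ / 2))
  have hx1 : Real.exp (-(κ / 2)) < 1 := by rw [Real.exp_lt_one_iff]; linarith
  have hav : ‖(eu κ y)⁻¹‖ < ‖zf γ (eu κ y)‖⁻¹ := by
    rw [norm_inv]
    gcongr
  have hρa : Real.exp (-(κ / 2)) < ‖(eu κ y)⁻¹‖ := by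
    rw [norm_inv]
    exact hx1.trans ((one_lt_inv₀ (norm_pos_iff.2 hv)).2 hv1)
  have ha3 : ‖(eu κ y)⁻¹‖ ≤ 3 := by
    rw [norm_inv, norm_eu, Real.exp_neg, inv_inv]
    calc Real.exp κ ≤ Real.exp 1 := by gcongr; exact s.hκ1
      _ ≤ 3 := by linarith [Real.exp_one_lt_d9]
  have hsub : ∀ u : ℂ, Real.exp (-(κ / 2)) ≤ ‖u‖ → ‖u‖ ≤ ‖zf γ (eu κ y)‖⁻¹ →
      u ∈ {u : ℂ | u ≠ 0 ∧ df γ u (u * zf γ (eu κ y)) ≠ 0} := fun u h1 h2 =>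
    ⟨norm_pos_iff.1 (hx.trans_le h1), s.df_ne h1 (by rwa [← le_div_iff₀ hz, one_div])⟩
  have hdiff : DifferentiableOn ℂ (fun u => sg β t γ (eu κ y) * hst t γ (zf γ (eu κ y)) u)
      {u : ℂ | u ≠ 0 ∧ df γ u (u * zf γ (eu κ y)) ≠ 0} := fun u hu =>
    ((hst_hasDerivAt s.ne hu.1 hu.2).differentiableAt.const_mul _).differentiableWithinAt
  have hfar : ∀ u : ℂ, ‖u‖ = ‖zf γ (eu κ y)‖⁻¹ →
      ‖om (u * (eu κ y)⁻¹⁻¹)‖ ≤ 2 / ((1 - β) / 2) ^ 2 := fun u hu => by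
    rw [inv_inv]
    refine norm_om_far_le hm hm1 ?_
    rwa [norm_mul, hu]
  have hMs : ∀ u : ℂ, ‖u‖ = ‖zf γ (eu κ y)‖⁻¹ →
      ‖sg β t γ (eu κ y) * hst t γ (zf γ (eu κ y)) u‖ ≤ 16 * P / (a₀ * (1 - β ^ 2)) * (1 / κ) :=
    fun u hu => norm_sg_hst_le s ha₀ hT h0 ht hP
      (by rw [hu]; exact (hρa.trans hav).le) (by rw [hu]; exact (inv_mul_cancel₀ hz.ne').le)
      (Or.inl (by rw [norm_mul, hu]; exact inv_mul_cancel₀ hz.ne'))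
  have hMa := norm_sg_hst_le s ha₀ hT h0 ht hP hρa.le (by
    rw [← le_div_iff₀ hz, one_div]; exact hav.le) (Or.inr rfl)
  have main := norm_cint_om_le s.isOpen_string hdiff hsub hx hρa hav hfar hMs hMa
  have hder := norm_deriv_sg_hst_le s ha₀ hT h0 ht hP
  rw [← cint_const_mul hx]
  have e : (fun u => sg β t γ (eu κ y) * (om (u * eu κ y) * hst t γ (zf γ (eu κ y)) u)) =
      fun u => om (u * (eu κ y)⁻¹⁻¹) * (sg β t γ (eu κ y) * hst t γ (zf γ (eu κ y)) u) := by
    funext u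
    rw [inv_inv]
    ring
  rw [e]
  refine main.trans (add_le_add_right ?_ _)
  exact mul_le_mul ha3 hder (norm_nonneg _) (by norm_num)

end

theorem string_bound_aux {γ a₀ E B η t q e₁ e₂ : ℝ} (hγ : 0 < γ) (ha₀ : 0 < a₀) (hE : 0 < E)
    (hB : 0 < B) (hη : 0 < η) (ht : 0 < t) (hq : 1 ≤ q) (htq : t ≤ q ^ 2) (h : e₁ ≤ e₂)
    (h0 : 0 ≤ e₁) :
    B * (2 * (16 * (E * e₁) / (a₀ * η) * q)) + 3 * (E * e₁ / a₀ * (2 * (8 * (γ + 1) * q) *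
      ((8 * (γ + 1) * q) * (t / (2 * γ) + 1 / (16 * γ ^ 2))))) ≤
    (B * (2 * (16 * E / (a₀ * η))) + 3 * (E / a₀ * (2 * (8 * (γ + 1)) * ((8 * (γ + 1)) *
      (1 / (2 * γ) + 1 / (16 * γ ^ 2)))))) * (e₂ * q ^ 4) := by
  have hq4 : q ≤ q ^ 4 := le_self_pow₀ hq (by norm_num)
  have hq2 : q ^ 2 ≤ q ^ 4 := pow_le_pow_right₀ hq (by norm_num)
  have hq0 : 0 ≤ q := by linarith
  have h2 := h0.trans h
  calc _ = e₁ * (B * (2 * (16 * E / (a₀ * η))) * q +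
        3 * (E / a₀ * (2 * (8 * (γ + 1)) * ((8 * (γ + 1)) *
          (q ^ 2 * t / (2 * γ) + q ^ 2 / (16 * γ ^ 2)))))) := by ring
    _ ≤ e₂ * (B * (2 * (16 * E / (a₀ * η))) * q ^ 4 +
        3 * (E / a₀ * (2 * (8 * (γ + 1)) * ((8 * (γ + 1)) *
          (q ^ 2 * q ^ 2 / (2 * γ) + q ^ 4 / (16 * γ ^ 2)))))) := by gcongr
    _ = _ := by ring

theorem string_bound {γ : ℝ} (hγ : 0 < γ) {β : ℝ} (hβ : 0 < β) (hβ1 : β < 1) :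
    ∃ C, 0 < C ∧ ∃ κ₀, 0 < κ₀ ∧ ∀ t κ y : ℝ,
    Scl γ t κ → κ ≤ κ₀ → |y| ≤ Real.pi → ‖sg β t γ (eu κ y) * cint (Real.exp (-(κ / 2)))
      (fun u => om (u * eu κ y) * hst t γ (zf γ (eu κ y)) u)‖ ≤ C / (1 + t * y ^ 2) := by
  obtain ⟨C1, p1, B1⟩ := sg_bound hγ hβ hβ1
  obtain ⟨C2, p2, B2⟩ := absorb hγ 4
  have hη : 0 < 1 - β ^ 2 := by nlinarith
  have hβ4 : 0 < 1 - β ^ 4 := by linarith [pow_lt_one₀ hβ.le hβ1 (n := 4) (by norm_num)]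
  have ha₀ : 0 < (1 - β ^ 4) * γ / 2 := by positivity
  have hm : 0 < (1 - β) / 2 := by linarith
  obtain ⟨E, hE⟩ : ∃ E, E = 1 + C1 * (2 * γ + 4) := ⟨_, rfl⟩
  have pE : 0 < E := by rw [hE]; positivity
  obtain ⟨D, hD⟩ : ∃ D, D = 2 / ((1 - β) / 2) ^ 2 * (2 * (16 * E / ((1 - β ^ 4) * γ / 2 *
    (1 - β ^ 2)))) + 3 * (E / ((1 - β ^ 4) * γ / 2) * (2 * (8 * (γ + 1)) * ((8 * (γ + 1)) *
      (1 / (2 * γ) + 1 / (16 * γ ^ 2))))) := ⟨_, rfl⟩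
  have pD : 0 < D := by rw [hD]; positivity
  refine ⟨D * C2, by positivity, (1 - β ^ 2) / 10, by positivity, ?_⟩
  intro t κ y S hκ0 hy
  have ht := S.ht0
  have hty : 0 < 1 + t * y ^ 2 := by positivity
  by_cases h0 : sg β t γ (eu κ y) = 0
  · rw [h0, zero_mul, norm_zero]; positivity
  have hκ := S.hκ
  have s : Stg γ κ y β := ⟨hγ, hκ, S.hκ1, hβ, hβ1, by linarith, norm_zf_le_of_sg h0⟩
  have hT := (Tf_re_ge hγ (eu_ne κ y) s.hz).trans (Complex.re_le_norm _)
  have hT0 : Tf γ (eu κ y) ≠ 0 := norm_pos_iff.1 (ha₀.trans_le hT)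
  have hP := exp_Tf_le h0 hT0 (K := C1 * (2 * γ + 4)) (by
    have b1 := B1 t κ y ht hκ S.hκ1 S.up hy
    have b2 := norm_Tf_le (γ := γ) (x := y) hκ S.hκ1
    rw [abs_of_pos hγ] at b2
    have b3 : C1 / (1 + t * y ^ 2) ≤ C1 :=
      div_le_self p1.le (by nlinarith [mul_nonneg ht.le (sq_nonneg y)])
    exact mul_le_mul (b1.trans b3) b2 (norm_nonneg _) p1.le)
  rw [← hE] at hP
  have low : β + β * ((1 - β) / 2) ≤ Real.exp (-(κ / 2)) := by
    have := Real.add_one_le_exp (-(κ / 2))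
    nlinarith
  have hκi : 1 ≤ 1 / κ := by rw [le_div_iff₀ hκ]; linarith [S.hκ1]
  have hti : t ≤ (1 / κ) ^ 2 := by
    rw [div_pow, one_pow, le_div_iff₀ (by positivity)]; exact S.up
  have hexp : Real.exp (-6 * γ * t) ≤ Real.exp (-γ * t) := by
    rw [Real.exp_le_exp]; nlinarith [mul_pos hγ ht]
  refine (norm_sg_cint_hst_le s ha₀ hT h0 ht.le hP low).trans ?_
  refine (string_bound_aux hγ ha₀ pE (by positivity) hη ht hκi hti hexp (Real.exp_pos _).le).trans ?_
  rw [← hD, mul_div_assoc]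
  exact mul_le_mul_of_nonneg_left (B2 t κ y S hy) pD.le

/-- Radii of the two inner circles that are admissible uniformly on the outer circles. -/
structure Radii (γ κ r s₃ s₁ : ℝ) : Prop where
  h₃ : 0 < s₃
  h₁ : 0 < s₁
  h₁₃ : s₁ < r * s₃
  le₃ : s₃ ≤ min r (aj γ 4 * Real.exp (-κ))
  le₁ : s₁ ≤ min (r ^ 3) (aj γ 1 * Real.exp (-(κ / 2)))
  t₃ : 4 * γ < (1 - Real.exp (-κ)) * (s₃⁻¹ - 1)
  t₁ : 4 * γ < (1 - Real.exp (-(κ / 2))) * (s₁⁻¹ - 1)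

theorem exists_radii {γ κ r : ℝ} (hγ : 0 < γ) (hκ : 0 < κ) (hr : 0 < r) :
    ∃ s₃ s₁, Radii γ κ r s₃ s₁ := by
  have a4 := aj_pos hγ (j := 4) (by norm_num)
  have a1 := aj_pos hγ (le_refl 1)
  have e1 : Real.exp (-κ) < 1 := by simpa using hκ
  have e2 : Real.exp (-(κ / 2)) < 1 := by simpa using hκ
  obtain ⟨s₃, p3, l3, t3⟩ := exists_tiny (γ := γ) (q := min r (aj γ 4 * Real.exp (-κ)))
    (lt_min hr (by positivity)) e1
  obtain ⟨s₁, p1, l1, t1⟩ := exists_tiny (γ := γ)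
    (q := min (r * s₃ / 2) (min (r ^ 3) (aj γ 1 * Real.exp (-(κ / 2)))))
    (lt_min (by positivity) (lt_min (by positivity) (by positivity))) e2
  refine ⟨s₃, s₁, p3, p1, ?_, l3, l1.trans (min_le_right _ _), t3, t1⟩
  have := l1.trans (min_le_left _ _)
  have := mul_pos hr p3
  linarith

section

variable {γ κ r s₃ s₁ t : ℝ} (R : Radii γ κ r s₃ s₁) (hγ : 0 < γ) (hκ : 0 < κ)
include R hγ hκ

theorem Radii.facts₃ (y : ℝ) : s₃ ≤ aj γ 4 * √‖eu κ y‖ ∧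
    ∀ z, z ≠ 0 → ‖z‖ ≤ s₃ → df γ (eu κ y) z ≠ 0 :=
  tiny_facts hγ hκ (aj_lt_one hγ (by norm_num)).le (aj_pos hγ (by norm_num))
    (R.le₃.trans (min_le_right _ _)) R.t₃

theorem Radii.facts₁ (x : ℝ) : s₁ ≤ aj γ 1 * √‖eu (κ / 2) x‖ ∧
    ∀ z, z ≠ 0 → ‖z‖ ≤ s₁ → df γ (eu (κ / 2) x) z ≠ 0 :=
  tiny_facts hγ (by linarith) (aj_lt_one hγ (by norm_num)).le (aj_pos hγ (by norm_num))
    (R.le₁.trans (min_le_right _ _)) R.t₁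

theorem Radii.inn {x y : ℝ} (S : Scl γ t κ) (S' : Scl γ t (κ / 2)) (hr : r ≤ Real.exp (-(κ / 2)))
    (hx : |x| ≤ Real.pi) (hy : |y| ≤ Real.pi) : Inn γ t κ x y r s₃ s₁ :=
  ⟨S, S', hx, hy, R.h₃, R.h₁, R.h₁₃, hr, (R.facts₃ hγ hκ y).1, (R.facts₁ hγ hκ x).1,
    (R.facts₃ hγ hκ y).2, (R.facts₁ hγ hκ x).2⟩

omit hγ hκ in
theorem Radii.sub_ne (hr : r ≤ Real.exp (-(κ / 2))) (x : ℝ) {a c : ℂ} (ha : ‖a‖ = s₁)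
    (hc : ‖c‖ = s₃) : a - eu (κ / 2) x * c ≠ 0 := by
  intro h0
  rw [sub_eq_zero] at h0
  have := congrArg (‖·‖) h0
  simp only [norm_mul, norm_eu, ha, hc] at this
  have h1 := R.h₁₃
  have h3 := R.h₃
  have : r * s₃ ≤ s₁ := by
    rw [this]
    gcongr
  linarith

theorem Radii.continuous_jin (hr : r ≤ Real.exp (-(κ / 2))) :
    Continuous fun p : ℝ × ℝ => jin t γ s₃ s₁ (eu κ p.1) (eu (κ / 2) p.2) := by
  refine continuous_cint (X := ℝ × ℝ) (F := fun p c => cint s₁ fun a =>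
    Complex.exp (t * ef γ (eu κ p.1) c) * (1 + 2 * γ * (df γ (eu κ p.1) c)⁻¹) *
    (Complex.exp (t * ef γ (eu (κ / 2) p.2) a) *
      (0 + mf (eu (κ / 2) p.2) a c * (df γ (eu (κ / 2) p.2) a)⁻¹))) R.h₃ ?_
  refine continuous_cint (X := (ℝ × ℝ) × ℝ) (F := fun q a =>
    Complex.exp (t * ef γ (eu κ q.1.1) (circleMap 0 s₃ q.2)) *
      (1 + 2 * γ * (df γ (eu κ q.1.1) (circleMap 0 s₃ q.2))⁻¹) *
    (Complex.exp (t * ef γ (eu (κ / 2) q.1.2) a) *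
      (0 + mf (eu (κ / 2) q.1.2) a (circleMap 0 s₃ q.2) * (df γ (eu (κ / 2) q.1.2) a)⁻¹))) R.h₁ ?_
  refine continuous_iff_continuousAt.2 fun p => ?_
  have e3 := norm_circleMap_pos R.h₃ p.1.2
  have e1 := norm_circleMap_pos R.h₁ p.2
  have h3 : circleMap 0 s₃ p.1.2 ≠ 0 := norm_pos_iff.1 (by rw [e3]; exact R.h₃)
  have h1 : circleMap 0 s₁ p.2 ≠ 0 := norm_pos_iff.1 (by rw [e1]; exact R.h₁)
  have d3 := (R.facts₃ hγ hκ p.1.1.1).2 _ h3 e3.le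
  have d1 := (R.facts₁ hγ hκ p.1.1.2).2 _ h1 e1.le
  have n3 := eu_ne κ p.1.1.1
  have n1 := eu_ne (κ / 2) p.1.1.2
  have nn := R.sub_ne hr p.1.1.2 e1 e3
  have h5 : DifferentiableAt ℂ (fun q : ℂ × ℂ × ℂ × ℂ =>
      Complex.exp (t * ef γ q.1 q.2.1) * (1 + 2 * γ * (df γ q.1 q.2.1)⁻¹) *
      (Complex.exp (t * ef γ q.2.2.1 q.2.2.2) * (0 + mf q.2.2.1 q.2.2.2 q.2.1 *
        (df γ q.2.2.1 q.2.2.2)⁻¹)))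
      (eu κ p.1.1.1, circleMap 0 s₃ p.1.2, eu (κ / 2) p.1.1.2, circleMap 0 s₁ p.2) := by
    unfold mf
    fun_prop (disch := assumption)
  refine ContinuousAt.comp (f := fun p : ((ℝ × ℝ) × ℝ) × ℝ =>
    (eu κ p.1.1.1, circleMap 0 s₃ p.1.2, eu (κ / 2) p.1.1.2, circleMap 0 s₁ p.2))
    h5.continuousAt ?_
  refine Continuous.continuousAt ?_
  unfold eu circleMap
  fun_prop

omit R hγ in
theorem continuous_om_eu : Continuous fun p : ℝ × ℝ => om (eu (κ / 2) p.2 * eu κ p.1) := by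
  refine continuous_iff_continuousAt.2 fun p => ?_
  have h1 : ‖eu (κ / 2) p.2 * eu κ p.1‖ < 1 := by
    rw [norm_mul]
    have := norm_eu_lt hκ p.1
    have := norm_eu_lt (half_pos hκ) p.2
    have := norm_nonneg (eu κ p.1)
    nlinarith
  have h4 := one_sub_ne h1
  have h5 := (om_differentiableAt h4).continuousAt
  refine ContinuousAt.comp (f := fun p : ℝ × ℝ => eu (κ / 2) p.2 * eu κ p.1) h5 ?_
  refine Continuous.continuousAt ?_
  unfold eu
  fun_prop

theorem Radii.continuous_outer (hr : r ≤ Real.exp (-(κ / 2))) : Continuous fun y : ℝ =>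
    cint (Real.exp (-(κ / 2))) fun u => om (u * eu κ y) * jin t γ s₃ s₁ (eu κ y) u := by
  refine continuous_cint (X := ℝ)
    (F := fun y u => om (u * eu κ y) * jin t γ s₃ s₁ (eu κ y) u) (Real.exp_pos _) ?_
  simp only [circleMap_eu]
  exact (continuous_om_eu hκ).mul (R.continuous_jin hγ hκ hr)

end

/-- The inner double integral without the contribution of the moving pole. -/
noncomputable def jm (t γ s₃ s₁ : ℝ) (v u : ℂ) : ℂ :=
  jin t γ s₃ s₁ v u + 2 * γ * sg (aj γ 5) t γ v * hst t γ (zf γ v) u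

theorem Stg.continuous_hst {γ κ y β t : ℝ} (s : Stg γ κ y β) :
    Continuous fun x => hst t γ (zf γ (eu κ y)) (eu (κ / 2) x) := by
  refine continuous_iff_continuousAt.2 fun x => ?_
  have hu := eu_ne (κ / 2) x
  have h1 : ‖eu (κ / 2) x‖ * ‖zf γ (eu κ y)‖ ≤ 1 := by
    have h2 := s.le.trans s.hβ1.le
    have h3 := (norm_eu_lt (half_pos s.hκ) x).le
    exact mul_le_one₀ h3 (norm_nonneg _) h2
  have hd := s.df_ne (norm_eu (κ / 2) x).ge h1
  have h5 := (hst_hasDerivAt (t := t) s.ne hu hd).differentiableAt.continuousAt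
  refine ContinuousAt.comp (f := fun x : ℝ => eu (κ / 2) x) h5 ?_
  refine Continuous.continuousAt ?_
  unfold eu
  fun_prop

theorem cint_om_jin_split {γ κ r s₃ s₁ t : ℝ} (R : Radii γ κ r s₃ s₁) (hγ : 0 < γ) (hκ : 0 < κ)
    (hκ1 : κ ≤ 1) (hκβ : 10 * κ ≤ 1 - aj γ 5 ^ 2) (hr : r ≤ Real.exp (-(κ / 2))) (y : ℝ) :
    (cint (Real.exp (-(κ / 2))) fun u => om (u * eu κ y) * jin t γ s₃ s₁ (eu κ y) u) =
      (cint (Real.exp (-(κ / 2))) fun u => om (u * eu κ y) * jm t γ s₃ s₁ (eu κ y) u) -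
      2 * γ * (sg (aj γ 5) t γ (eu κ y) * cint (Real.exp (-(κ / 2)))
        fun u => om (u * eu κ y) * hst t γ (zf γ (eu κ y)) u) := by
  by_cases h0 : sg (aj γ 5) t γ (eu κ y) = 0
  · simp only [jm, h0, mul_zero, zero_mul, add_zero, sub_zero]
  have s : Stg γ κ y (aj γ 5) := ⟨hγ, hκ, hκ1, aj_pos hγ (by norm_num), aj_lt_one hγ (by norm_num),
    hκβ, norm_zf_le_of_sg h0⟩
  have c1 : Continuous fun x => om (eu (κ / 2) x * eu κ y) :=
    (continuous_om_eu hκ).comp (f := fun x : ℝ => (y, x)) (by fun_prop)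
  have c2 : Continuous fun x => jin t γ s₃ s₁ (eu κ y) (eu (κ / 2) x) :=
    (R.continuous_jin hγ hκ hr).comp (f := fun x : ℝ => (y, x)) (by fun_prop)
  have c3 := s.continuous_hst (t := t)
  rw [← mul_assoc, ← cint_const_mul (Real.exp_pos _), ← cint_sub (Real.exp_pos _)]
  · congr 1
    funext u
    simp only [jm]
    ring
  · simp only [circleMap_eu, jm]
    exact c1.mul (c2.add (continuous_const.mul c3))
  · simp only [circleMap_eu]
    exact continuous_const.mul (c1.mul c3)

theorem norm_jin_outer_le {γ : ℝ} (hγ : 0 < γ) : ∃ C, 0 < C ∧ ∃ κ₀, 0 < κ₀ ∧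
    ∀ t r s₃ s₁ y : ℝ, Scl γ t (1 / √t) → Scl γ t (1 / √t / 2) → r ≤ Real.exp (-(1 / √t / 2)) →
    Radii γ (1 / √t) r s₃ s₁ → 1 / √t ≤ κ₀ → |y| ≤ Real.pi →
    ‖(cint (Real.exp (-(1 / √t / 2))) fun u => om (u * eu (1 / √t) y) *
      jm t γ s₃ s₁ (eu (1 / √t) y) u)‖ ≤ t * (C / (1 + t * y ^ 2)) ∧
    ‖2 * γ * (sg (aj γ 5) t γ (eu (1 / √t) y) * cint (Real.exp (-(1 / √t / 2)))
        fun u => om (u * eu (1 / √t) y) * hst t γ (zf γ (eu (1 / √t) y)) u)‖ ≤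
      C / (1 + t * y ^ 2) := by
  obtain ⟨C1, p1, k1, q1, B1⟩ := J_main hγ
  obtain ⟨C2, p2, k2, q2, B2⟩ := string_bound hγ (aj_pos hγ (j := 5) (by norm_num))
    (aj_lt_one hγ (by norm_num))
  refine ⟨16 * C1 + 2 * γ * C2, by positivity, min k1 k2, lt_min q1 q2, ?_⟩
  intro t r s₃ s₁ y S S' hr R hk hy
  have ht := S.ht0
  have hs := Real.sqrt_pos.2 ht
  have hy0 : 0 < 1 + t * y ^ 2 := by positivity
  constructor
  · have b := norm_cint_eu_le (κ := 1 / √t / 2) (f := fun u => om (u * eu (1 / √t) y) *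
      jm t γ s₃ s₁ (eu (1 / √t) y) u) (C := 16 * t * (C1 * √t / (1 + t * y ^ 2))) ht
      (by positivity) (fun x hx => by
        have b1 := B1 t (1 / √t) x y r s₃ s₁ (R.inn hγ S.hκ S S' hr hx hy) (hk.trans (min_le_left _ _))
        have b2 := norm_om_le S (w := eu (1 / √t / 2) x * eu (1 / √t) y) (by
          rw [norm_mul, norm_eu (1 / √t)]
          have := norm_eu_lt S'.hκ x
          exact mul_le_of_le_one_left (Real.exp_pos _).le this.le)
        rw [norm_mul]
        rw [one_div_one_div] at b1
        calc _ ≤ 16 * t * (C1 * √t / (1 + t * x ^ 2) / (1 + t * y ^ 2)) := by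
              gcongr
              exact b1
          _ = _ := by ring)
    refine b.trans ?_
    calc _ = t * (16 * C1 / (1 + t * y ^ 2)) := by field_simp
      _ ≤ _ := by
        gcongr
        have := mul_pos hγ p2
        linarith
  · have b := B2 t (1 / √t) y S (hk.trans (min_le_right _ _)) hy
    rw [norm_mul, norm_mul, Complex.norm_ofNat, Complex.norm_real, Real.norm_of_nonneg hγ.le]
    calc _ ≤ 2 * γ * (C2 / (1 + t * y ^ 2)) := by gcongr
      _ = 2 * γ * C2 / (1 + t * y ^ 2) := by ring
      _ ≤ _ := by
        gcongr
        linarith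

theorem eventually_abs_div_le (X : ℝ) : ∀ᶠ t : ℝ in atTop, |X / √t| ≤ Real.pi := by
  have h0 : Tendsto (fun t : ℝ => |X / √t|) atTop (nhds 0) := by
    simpa using (Real.tendsto_sqrt_atTop.const_div_atTop X).abs
  exact h0.eventually_le_const Real.pi_pos

theorem tendsto_mf {γ : ℝ} (hγ : 0 < γ) {w₁ w₂ : ℂ} (h : w₂ - w₁ ≠ 0) :
    Tendsto (fun t : ℝ => (√t : ℂ)⁻¹ * mf (Complex.exp (w₁ / (√t : ℂ)))
      (zf γ (Complex.exp (w₁ / (√t : ℂ)))) (zf γ (Complex.exp (w₂ / (√t : ℂ))))) atTop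
      (nhds (4 * γ / (w₂ - w₁))) := by
  have hγ' : (γ : ℂ) ≠ 0 := Complex.ofReal_ne_zero.2 hγ.ne'
  have n := (tendsto_exp_div w₁).sub ((tendsto_zf hγ w₁).mul (tendsto_zf hγ w₂))
  have d := (tendsto_zf_scaled hγ w₁).sub ((tendsto_exp_div w₁).mul (tendsto_zf_scaled hγ w₂))
  have e : -w₁ / (4 * γ) - 1 * (-w₂ / (4 * γ)) = (w₂ - w₁) / (4 * γ) := by ring
  rw [e] at d
  have q := n.div d (div_ne_zero h (by simpa using hγ'))
  have e2 : (1 - 0 * 0) / ((w₂ - w₁) / (4 * γ)) = 4 * γ / (w₂ - w₁) := by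
    rw [mul_zero, sub_zero, one_div_div]
  rw [e2] at q
  refine q.congr' ?_
  filter_upwards [eventually_gt_atTop 0] with t ht
  have hst : (√t : ℂ) ≠ 0 := Complex.ofReal_ne_zero.2 (Real.sqrt_pos.2 ht).ne'
  simp only [mf, Pi.div_apply]
  rw [inv_mul_eq_div, div_div]
  congr 1
  ring

theorem tendsto_jm {γ : ℝ} (hγ : 0 < γ) {r : ℝ} {s₃ s₁ : ℝ → ℝ}
    (hR : ∀ᶠ t : ℝ in atTop, Scl γ t (1 / √t) ∧ Scl γ t (1 / √t / 2) ∧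
      r ≤ Real.exp (-(1 / √t / 2)) ∧ Radii γ (1 / √t) r (s₃ t) (s₁ t)) (X Y : ℝ) :
    Tendsto (fun t : ℝ => (√t : ℂ)⁻¹ * jm t γ (s₃ t) (s₁ t) (eu (1 / √t) (Y / √t))
      (eu (1 / √t / 2) (X / √t))) atTop
      (nhds (2 * Complex.exp (((-(1 / 2) + X * Complex.I) ^ 2 + (-1 + Y * Complex.I) ^ 2) /
        (2 * γ)) / ((-1 + Y * Complex.I) - (-(1 / 2) + X * Complex.I)))) := by
  have hγ' : (γ : ℂ) ≠ 0 := Complex.ofReal_ne_zero.2 hγ.ne'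
  obtain ⟨C, pC, κ₀, pκ, B⟩ := J_split hγ
  have eX : ∀ t : ℝ, eu (1 / √t / 2) (X / √t) =
      Complex.exp ((-(1 / 2) + X * Complex.I) / (√t : ℂ)) := fun t => by
    rw [div_right_comm, eu_div]; push_cast; rfl
  have eY : ∀ t : ℝ, eu (1 / √t) (Y / √t) = Complex.exp ((-1 + Y * Complex.I) / (√t : ℂ)) :=
    fun t => by rw [eu_div]; push_cast; rfl
  have hw : (-1 + Y * Complex.I) - (-(1 / 2) + X * Complex.I) ≠ 0 := by
    intro h0
    have := congrArg Complex.re h0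
    norm_num at this
  have hκ : ∀ᶠ t : ℝ in atTop, 1 / √t ≤ κ₀ :=
    (Real.tendsto_sqrt_atTop.const_div_atTop 1).eventually_le_const pκ
  set m : ℝ → ℂ := fun t => 2 * γ * sg (aj γ 5) t γ (eu (1 / √t) (Y / √t)) *
    (sg (aj γ 8) t γ (eu (1 / √t / 2) (X / √t)) * mf (eu (1 / √t / 2) (X / √t))
      (zf γ (eu (1 / √t / 2) (X / √t))) (zf γ (eu (1 / √t) (Y / √t)))) with hm
  have L0 : Tendsto (fun t : ℝ => (√t : ℂ)⁻¹ * (jm t γ (s₃ t) (s₁ t) (eu (1 / √t) (Y / √t))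
      (eu (1 / √t / 2) (X / √t)) - m t)) atTop (nhds 0) := by
    have hz : Tendsto (fun t : ℝ => Real.exp (-γ * t) * C) atTop (nhds 0) := by
      have : Tendsto (fun t : ℝ => γ * t) atTop atTop := tendsto_id.const_mul_atTop hγ
      have := (Real.tendsto_exp_neg_atTop_nhds_zero.comp this).mul_const C
      simpa [Function.comp_def] using this
    refine squeeze_zero_norm' ?_ hz
    filter_upwards [hR, hκ, eventually_abs_div_le X, eventually_abs_div_le Y] with
      t ⟨S, S', hr, R⟩ hk hx hy
    have ht := S.ht0
    have b := B t (1 / √t) _ _ r _ _ (R.inn hγ S.hκ S S' hr hx hy) hk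
    have hs : ‖(√t : ℂ)⁻¹‖ ≤ 1 := by
      rw [norm_inv, Complex.norm_real, Real.norm_of_nonneg (Real.sqrt_nonneg t)]
      exact inv_le_one_of_one_le₀ (Real.one_le_sqrt.2 S.ht)
    rw [norm_mul]
    refine (mul_le_of_le_one_left (norm_nonneg _) hs).trans (b.trans ?_)
    have h1 : ∀ x : ℝ, 1 ≤ 1 + t * x ^ 2 := fun x => by
      have : 0 ≤ t * x ^ 2 := by positivity
      linarith
    gcongr
    exact (div_le_self (by have := h1 (X / √t); positivity) (h1 _)).trans (div_le_self pC.le (h1 _))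
  have L1 := ((tendsto_sg (β := aj γ 5) hγ (aj_pos hγ (by norm_num)) (-1 + Y * Complex.I)).const_mul
    (2 * γ : ℂ)).mul ((tendsto_sg (β := aj γ 8) hγ (aj_pos hγ (by norm_num))
      (-(1 / 2) + X * Complex.I)).mul (tendsto_mf hγ hw))
  refine ((L1.add L0).congr fun t => ?_).trans_eq ?_
  · simp only [hm, eX, eY]
    ring
  · congr 1
    rw [add_div, Complex.exp_add]
    field_simp
    ring

/-- The limiting kernel of the double contour integral. -/
noncomputable def kerJ (γ X Y : ℝ) : ℂ :=
  1 / ((-(1 / 2) + X * Complex.I) + (-1 + Y * Complex.I)) ^ 2 *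
    (2 * Complex.exp (((-(1 / 2) + X * Complex.I) ^ 2 + (-1 + Y * Complex.I) ^ 2) /
        (2 * γ)) / ((-1 + Y * Complex.I) - (-(1 / 2) + X * Complex.I)))

theorem tendsto_inner {γ : ℝ} (hγ : 0 < γ) {r : ℝ} {s₃ s₁ : ℝ → ℝ}
    (hR : ∀ᶠ t : ℝ in atTop, Scl γ t (1 / √t) ∧ Scl γ t (1 / √t / 2) ∧
      r ≤ Real.exp (-(1 / √t / 2)) ∧ Radii γ (1 / √t) r (s₃ t) (s₁ t)) (Y : ℝ) :
    Tendsto (fun t : ℝ => (t : ℂ)⁻¹ * cint (Real.exp (-(1 / √t / 2)))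
      fun u => om (u * eu (1 / √t) (Y / √t)) *
        jm t γ (s₃ t) (s₁ t) (eu (1 / √t) (Y / √t)) u) atTop
      (nhds ((2 * Real.pi : ℂ)⁻¹ * ∫ X, kerJ γ X Y)) := by
  obtain ⟨C, pC, κ₀, pκ, B⟩ := J_main hγ
  have hκ : ∀ᶠ t : ℝ in atTop, 1 / √t ≤ κ₀ ∧ 10 * (1 / √t) ≤ 1 - aj γ 5 ^ 2 := by
    have h0 := Real.tendsto_sqrt_atTop.const_div_atTop 1
    have h1 := h0.const_mul 10
    rw [mul_zero] at h1
    have a1 := aj_lt_one hγ (j := 5) (by norm_num)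
    have a0 := aj_pos hγ (j := 5) (by norm_num)
    exact (h0.eventually_le_const pκ).and (h1.eventually_le_const (by nlinarith))
  have main := tendsto_cint_eu (κ := fun t => 1 / √t / 2)
    (F := fun t u => (t : ℂ)⁻¹ * (√t : ℂ)⁻¹ * (om (u * eu (1 / √t) (Y / √t)) *
        jm t γ (s₃ t) (s₁ t) (eu (1 / √t) (Y / √t)) u))
    (G := fun X => kerJ γ X Y) (C := 16 * C) (by positivity) ?_ ?_ ?_
  · refine main.congr' ?_
    filter_upwards [eventually_gt_atTop 0] with t ht
    have hst : (√t : ℂ) ≠ 0 := Complex.ofReal_ne_zero.2 (Real.sqrt_pos.2 ht).ne'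
    rw [cint_const_mul (Real.exp_pos _)]
    generalize cint _ _ = Z
    field_simp
  · filter_upwards [hR, hκ] with t ⟨S, S', hr, R⟩ hk
    have c1 : Continuous fun x => om (eu (1 / √t / 2) x * eu (1 / √t) (Y / √t)) :=
      (continuous_om_eu S.hκ).comp (f := fun x : ℝ => (Y / √t, x)) (by fun_prop)
    have c2 : Continuous fun x => jin t γ (s₃ t) (s₁ t) (eu (1 / √t) (Y / √t)) (eu (1 / √t / 2) x) :=
      (R.continuous_jin hγ S.hκ hr).comp (f := fun x : ℝ => (Y / √t, x)) (by fun_prop)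
    refine continuous_const.mul (c1.mul (c2.add ?_))
    by_cases h0 : sg (aj γ 5) t γ (eu (1 / √t) (Y / √t)) = 0
    · simp only [h0, mul_zero, zero_mul]
      exact continuous_const
    have s : Stg γ (1 / √t) (Y / √t) (aj γ 5) := ⟨hγ, S.hκ, S.hκ1, aj_pos hγ (by norm_num),
      aj_lt_one hγ (by norm_num), hk.2, norm_zf_le_of_sg h0⟩
    exact continuous_const.mul s.continuous_hst
  · filter_upwards [hR, hκ, eventually_abs_div_le Y] with t ⟨S, S', hr, R⟩ hk hy x hx
    have ht := S.ht0
    have hs := Real.sqrt_pos.2 ht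
    have b1 := B t (1 / √t) x _ r _ _ (R.inn hγ S.hκ S S' hr hx hy) hk.1
    have b2 := norm_om_le S (w := eu (1 / √t / 2) x * eu (1 / √t) (Y / √t)) (by
      rw [norm_mul, norm_eu (1 / √t)]
      have := norm_eu_lt S'.hκ x
      exact mul_le_of_le_one_left (Real.exp_pos _).le this.le)
    have b3 : C * (1 / (1 / √t)) / (1 + t * x ^ 2) / (1 + t * (Y / √t) ^ 2) ≤
        C * √t / (1 + t * x ^ 2) := by
      rw [one_div_one_div]
      refine div_le_self (by positivity) ?_
      have : 0 ≤ t * (Y / √t) ^ 2 := by positivity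
      linarith
    rw [norm_mul, norm_mul, norm_mul, norm_inv, norm_inv, Complex.norm_real, Complex.norm_real,
      Real.norm_of_nonneg ht.le, Real.norm_of_nonneg hs.le]
    calc _ ≤ t⁻¹ * (√t)⁻¹ * (16 * t * (C * √t / (1 + t * x ^ 2))) := by
          gcongr
          exact b1.trans b3
      _ = _ := by field_simp
  · intro X
    have hw : (-(1 / 2) + X * Complex.I) + (-1 + Y * Complex.I) ≠ 0 := by
      intro h0
      have := congrArg Complex.re h0
      norm_num at this
    refine ((tendsto_om_div hw).mul (tendsto_jm hγ hR X Y)).congr fun t => ?_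
    have e : Complex.exp (((-(1 / 2) + X * Complex.I) + (-1 + Y * Complex.I)) / (√t : ℂ)) =
        eu (1 / √t / 2) (X / √t) * eu (1 / √t) (Y / √t) := by
      rw [div_right_comm, eu_div, eu_div, ← Complex.exp_add]
      congr 1
      push_cast
      ring
    rw [e]
    ring

theorem tendsto_J {γ r : ℝ} (h : SmallRad γ r) :
    Tendsto (fun t : ℝ => cint4 (r ^ 3) r 1 (r ^ 2)⁻¹ (fun a c d b => GJ t γ a b c d) / (√t : ℂ))
      atTop (nhds ((2 * Real.pi : ℂ)⁻¹ * ∫ Y : ℝ, (2 * Real.pi : ℂ)⁻¹ * ∫ X : ℝ, kerJ γ X Y)) := by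
  have hγ := h.1
  have hr0 := h.2.1
  have hs : ∀ t : ℝ, ∃ s : ℝ × ℝ, 0 < t → Radii γ (1 / √t) r s.1 s.2 := by
    intro t
    by_cases ht : 0 < t
    · obtain ⟨a, b, R⟩ := exists_radii (κ := 1 / √t) hγ (by positivity) hr0
      exact ⟨(a, b), fun _ => R⟩
    · exact ⟨0, fun h => absurd h ht⟩
  choose s hs using hs
  have hR : ∀ᶠ t : ℝ in atTop, Scl γ t (1 / √t) ∧ Scl γ t (1 / √t / 2) ∧
      r ≤ Real.exp (-(1 / √t / 2)) ∧ Radii γ (1 / √t) r (s t).1 (s t).2 := by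
    filter_upwards [eventually_scl hγ (k := 1) (by norm_num) le_rfl,
      eventually_scl hγ (k := 1 / 2) le_rfl (by norm_num),
      eventually_le_exp (k := 1 / 2) h.lt_one] with t S S' hr
    rw [div_right_comm]
    exact ⟨S, S', hr, hs t S.ht0⟩
  obtain ⟨C, pC, κ₀, pκ, B⟩ := norm_jin_outer_le hγ
  have hκ : ∀ᶠ t : ℝ in atTop, 1 / √t ≤ κ₀ ∧ 10 * (1 / √t) ≤ 1 - aj γ 5 ^ 2 := by
    have h0 := Real.tendsto_sqrt_atTop.const_div_atTop 1
    have h1 := h0.const_mul 10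
    rw [mul_zero] at h1
    have a1 := aj_lt_one hγ (j := 5) (by norm_num)
    have a0 := aj_pos hγ (j := 5) (by norm_num)
    exact (h0.eventually_le_const pκ).and (h1.eventually_le_const (by nlinarith))
  have main := tendsto_cint_eu (κ := fun t => 1 / √t)
    (F := fun t v => (t : ℂ)⁻¹ * cint (Real.exp (-(1 / √t / 2))) fun u =>
      om (u * v) * jin t γ (s t).1 (s t).2 v u)
    (G := fun Y => (2 * Real.pi : ℂ)⁻¹ * ∫ X : ℝ, kerJ γ X Y) (C := 2 * C) (by positivity) ?_ ?_ ?_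
  · refine main.congr' ?_
    filter_upwards [hR, eventually_le_exp (k := 1) h.lt_one] with t ⟨S, S', hr, R⟩ hr'
    have ht := S.ht0
    have hst : (√t : ℂ) ≠ 0 := Complex.ofReal_ne_zero.2 (Real.sqrt_pos.2 ht).ne'
    have e1 : Real.exp (-(1 / √t)) < 1 := by simpa using ht
    have e2 : Real.exp (-(1 / √t / 2)) < 1 := by simpa using ht
    have key : cint4 (r ^ 3) r 1 (r ^ 2)⁻¹ (fun a c d b => GJ t γ a b c d) =
        cint (Real.exp (-(1 / √t))) fun v => cint (Real.exp (-(1 / √t / 2))) fun u =>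
          om (u * v) * jin t γ (s t).1 (s t).2 v u := by
      rw [cint4_PJ h t hr' e1 hr e2 R.h₃ (R.le₃.trans (min_le_left _ _)) R.h₁ R.h₁₃
        (R.le₁.trans (min_le_left _ _)) R.t₃ R.t₁]
      unfold cint4
      congr 1
      funext v
      congr 1
      funext u
      exact cint_PJ R.h₃ R.h₁ v u
    rw [key, cint_const_mul (Real.exp_pos _), ← sq_sqrt_ofReal ht]
    generalize cint _ _ = Z
    field_simp
  · filter_upwards [hR] with t ⟨S, S', hr, R⟩
    exact continuous_const.mul (R.continuous_outer hγ S.hκ hr)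
  · filter_upwards [hR, hκ] with t ⟨S, S', hr, R⟩ hk y hy
    have ht := S.ht0
    have hy0 : 0 < 1 + t * y ^ 2 := by positivity
    obtain ⟨b1, b2⟩ := B t r _ _ y S S' hr R hk.1 hy
    rw [cint_om_jin_split R hγ S.hκ S.hκ1 hk.2 hr, norm_mul, norm_inv, Complex.norm_real,
      Real.norm_of_nonneg ht.le]
    have b3 : C / (1 + t * y ^ 2) ≤ t * (C / (1 + t * y ^ 2)) :=
      le_mul_of_one_le_left (by positivity) S.ht
    calc _ ≤ t⁻¹ * (t * (C / (1 + t * y ^ 2)) + t * (C / (1 + t * y ^ 2))) := by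
          gcongr
          exact (norm_sub_le _ _).trans (add_le_add b1 (b2.trans b3))
      _ = _ := by field_simp; ring
  · intro Y
    have L1 := tendsto_inner hγ hR Y
    have L2 : Tendsto (fun t : ℝ => (t : ℂ)⁻¹ * (2 * γ * (sg (aj γ 5) t γ (eu (1 / √t) (Y / √t)) *
        cint (Real.exp (-(1 / √t / 2))) fun u => om (u * eu (1 / √t) (Y / √t)) *
          hst t γ (zf γ (eu (1 / √t) (Y / √t))) u))) atTop (nhds 0) := by
      have hz : Tendsto (fun t : ℝ => t⁻¹ * C) atTop (nhds 0) := by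
        simpa using tendsto_inv_atTop_zero.mul_const C
      refine squeeze_zero_norm' ?_ hz
      filter_upwards [hR, hκ, eventually_abs_div_le Y] with t ⟨S, S', hr, R⟩ hk hy
      have ht := S.ht0
      rw [norm_mul, norm_inv, Complex.norm_real, Real.norm_of_nonneg ht.le]
      gcongr
      refine (B t r _ _ _ S S' hr R hk.1 hy).2.trans (div_le_self pC.le ?_)
      have : 0 ≤ t * (Y / √t) ^ 2 := by positivity
      linarith
    have L3 := L1.sub L2
    rw [sub_zero] at L3
    refine L3.congr' ?_
    filter_upwards [hR, hκ] with t ⟨S, S', hr, R⟩ hk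
    rw [cint_om_jin_split R hγ S.hκ S.hκ1 hk.2 hr]
    ring

open MeasureTheory in
theorem integral_gauss_shift {c : ℝ} (hc : 0 < c) (α r : ℝ) :
    Integrable (fun x : ℝ => Complex.exp (-c * (x + α * Complex.I) ^ 2 -
      r * Complex.I * (x + α * Complex.I))) ∧
    ∫ x : ℝ, Complex.exp (-c * (x + α * Complex.I) ^ 2 - r * Complex.I * (x + α * Complex.I)) =
      (√(Real.pi / c) * Real.exp (-(1 / (4 * c)) * r ^ 2) : ℝ) := by
  have hc' : (c : ℂ) ≠ 0 := Complex.ofReal_ne_zero.2 hc.ne'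
  have hb : (-(c : ℂ)).re < 0 := by simpa using hc
  have e : ∀ x : ℝ, -c * (x + α * Complex.I) ^ 2 - r * Complex.I * (x + α * Complex.I) =
      -(c : ℂ) * x ^ 2 + (-(2 * c * α + r) * Complex.I) * x + (c * α ^ 2 + r * α) := fun x => by
    linear_combination (-c * α ^ 2 - r * α : ℂ) * Complex.I_sq
  simp only [e]
  refine ⟨integrable_cexp_quadratic' hb _ _, ?_⟩
  rw [integral_cexp_quadratic hb, neg_neg]
  push_cast
  congr 1
  · rw [Real.sqrt_eq_rpow, Complex.ofReal_cpow (by positivity)]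
    push_cast
    rfl
  · congr 1
    rw [mul_pow, Complex.I_sq]
    field_simp
    ring

theorem shift_ne {α : ℝ} (hα : α ≠ 0) (x : ℝ) : (x + α * Complex.I : ℂ) ≠ 0 := by
  intro h0
  have := congrArg Complex.im h0
  simp [hα] at this

theorem abs_le_norm_shift (α x : ℝ) : |α| ≤ ‖(x + α * Complex.I : ℂ)‖ := by
  have := Complex.abs_im_le_norm (x + α * Complex.I : ℂ)
  simpa using this

section

open MeasureTheory

variable {c : ℝ} (hc : 0 < c) {α : ℝ} (hα : α ≠ 0)
include hc hα

theorem integrable_gauss_div (k : ℕ) : Integrable fun x : ℝ =>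
    Complex.exp (-c * (x + α * Complex.I) ^ 2) / (x + α * Complex.I) ^ k := by
  have h0 := (integral_gauss_shift hc α 0).1
  simp only [Complex.ofReal_zero, zero_mul, sub_zero] at h0
  have hk : 0 < |α| ^ k := pow_pos (abs_pos.2 hα) k
  refine Integrable.mono' (h0.norm.const_mul ((|α| ^ k)⁻¹)) ?_ (ae_of_all _ fun x => ?_)
  · refine Continuous.aestronglyMeasurable ?_
    have := shift_ne hα
    fun_prop (disch := exact fun x => pow_ne_zero k (this x))
  · rw [norm_div, norm_pow, div_eq_inv_mul]
    gcongr
    exact abs_le_norm_shift α x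

theorem integral_gauss_div_sq : ∫ x : ℝ, Complex.exp (-c * (x + α * Complex.I) ^ 2) /
    (x + α * Complex.I) ^ 2 = -(2 * c * √(Real.pi / c) : ℝ) := by
  obtain ⟨h0, v0⟩ := integral_gauss_shift hc α 0
  simp only [Complex.ofReal_zero, zero_mul, sub_zero, ne_eq, OfNat.ofNat_ne_zero, not_false_eq_true,
    zero_pow, mul_zero, Real.exp_zero, mul_one] at h0 v0
  have h1 := integrable_gauss_div hc hα 1
  have h2 := integrable_gauss_div hc hα 2
  have hd : ∀ x : ℝ, HasDerivAt (fun x : ℝ => -(Complex.exp (-c * (x + α * Complex.I) ^ 2) /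
      (x + α * Complex.I) ^ 1)) (2 * c * Complex.exp (-c * (x + α * Complex.I) ^ 2) +
        Complex.exp (-c * (x + α * Complex.I) ^ 2) / (x + α * Complex.I) ^ 2) x := by
    intro x
    have hx := shift_ne hα x
    have d0 : HasDerivAt (fun z : ℂ => -(Complex.exp (-c * (z + α * Complex.I) ^ 2) /
      (z + α * Complex.I) ^ 1)) (2 * c * Complex.exp (-c * (x + α * Complex.I) ^ 2) +
        Complex.exp (-c * (x + α * Complex.I) ^ 2) / (x + α * Complex.I) ^ 2) (x : ℂ) := by
      have d1 := ((hasDerivAt_id (x : ℂ)).add_const (α * Complex.I))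
      have d2 := ((((d1.pow 2).const_mul (-c : ℂ)).cexp).div (d1.pow 1) (by simpa using hx)).neg
      refine d2.congr_deriv ?_
      simp only [id_eq, Pi.pow_apply]
      field_simp
      ring
    exact d0.comp_ofReal
  have := integral_eq_zero_of_hasDerivAt_of_integrable hd ((h0.const_mul _).add h2) h1.neg
  rw [integral_add (h0.const_mul _) h2, integral_const_mul, v0] at this
  push_cast
  linear_combination this

end

open MeasureTheory in
theorem integral_gauss_div_shift {c : ℝ} (hc : 0 < c) {β : ℝ} (hβ : 0 < β) :
    ∫ x : ℝ, Complex.exp (-c * (x + (-β : ℝ) * Complex.I) ^ 2) / (x + (-β : ℝ) * Complex.I) =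
      Real.pi * Complex.I := by
  obtain ⟨h0, -⟩ := integral_gauss_shift hc (-β) 0
  simp only [Complex.ofReal_zero, zero_mul, sub_zero] at h0
  have e1 : ∀ x : ℝ, Complex.exp (-c * (x + (-β : ℝ) * Complex.I) ^ 2) /
      (x + (-β : ℝ) * Complex.I) = Complex.I * ∫ r in Set.Ioi (0 : ℝ),
        Complex.exp (-c * (x + (-β : ℝ) * Complex.I) ^ 2 -
          r * Complex.I * (x + (-β : ℝ) * Complex.I)) := by
    intro x
    have hx := shift_ne (neg_ne_zero.2 hβ.ne') x
    have hre : (-(Complex.I * (x + (-β : ℝ) * Complex.I))).re < 0 := by simpa using hβ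
    have := integral_exp_mul_complex_Ioi hre 0
    have e : ∀ r : ℝ, Complex.exp (-c * (x + (-β : ℝ) * Complex.I) ^ 2 -
          r * Complex.I * (x + (-β : ℝ) * Complex.I)) =
        Complex.exp (-c * (x + (-β : ℝ) * Complex.I) ^ 2) *
          Complex.exp (-(Complex.I * (x + (-β : ℝ) * Complex.I)) * r) := fun r => by
      rw [← Complex.exp_add]; ring_nf
    simp only [e]
    rw [integral_const_mul, this, Complex.ofReal_zero, mul_zero, Complex.exp_zero]
    field_simp
  simp only [e1]
  rw [integral_const_mul, integral_integral_swap]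
  · simp only [(integral_gauss_shift hc (-β) _).2]
    rw [integral_complex_ofReal, integral_const_mul, integral_gaussian_Ioi, mul_comm]
    congr 2
    rw [mul_div_assoc', ← Real.sqrt_mul (by positivity)]
    rw [show Real.pi / c * (Real.pi / (1 / (4 * c))) = (2 * Real.pi) ^ 2 by field_simp; ring,
      Real.sqrt_sq (by positivity)]
    ring
  · have hp : IntegrableOn (fun r : ℝ => Real.exp (-β * r)) (Set.Ioi 0) :=
      integrableOn_exp_mul_Ioi (by linarith) 0
    refine Integrable.mono' (h0.norm.mul_prod hp) ?_ (ae_of_all _ fun p => ?_)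
    · refine Continuous.aestronglyMeasurable ?_
      unfold Function.uncurry
      fun_prop
    · rw [Function.uncurry_def]
      beta_reduce
      rw [Complex.exp_sub, norm_div, div_eq_mul_inv,
        Complex.norm_exp (p.2 * Complex.I * (p.1 + (-β : ℝ) * Complex.I)), ← Real.exp_neg]
      gcongr
      simp [mul_comm]

open MeasureTheory in
theorem integral_integral_shear {f g : ℝ → ℂ} (cf : Continuous f) (cg : Continuous g)
    (hf : Integrable f) (hg : Integrable g) :
    ∫ Y : ℝ, ∫ X : ℝ, g (X + Y) * f (X - Y) = (1 / 2) * ((∫ x, g x) * ∫ x, f x) := by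
  have i1 : ∀ m : ℝ, Integrable (fun Y : ℝ => g (2 * Y + m)) := fun m =>
    (hg.comp_add_right m).comp_mul_left' two_ne_zero
  have v1 : ∀ (h : ℝ → ℂ) (m : ℝ), ∫ Y : ℝ, h (2 * Y + m) = (1 / 2) * ∫ x, h x := by
    intro h m
    rw [Measure.integral_comp_mul_left (fun x => h (x + m)) 2, integral_add_right_eq_self]
    rw [abs_of_pos (by norm_num), Complex.real_smul]
    push_cast
    ring
  have v2 : ∀ m : ℝ, ∫ Y : ℝ, ‖g (2 * Y + m)‖ = (1 / 2) * ∫ x, ‖g x‖ := by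
    intro m
    rw [Measure.integral_comp_mul_left (fun x => ‖g (x + m)‖) 2,
      integral_add_right_eq_self (fun x => ‖g x‖)]
    rw [abs_of_pos (by norm_num), smul_eq_mul]
    ring
  have e1 : ∀ Y : ℝ, ∫ X : ℝ, g (X + Y) * f (X - Y) = ∫ m : ℝ, g (2 * Y + m) * f m := by
    intro Y
    rw [← integral_add_right_eq_self (fun X => g (X + Y) * f (X - Y)) Y]
    congr 1
    funext X
    rw [add_sub_cancel_right, add_assoc, add_comm X, two_mul]
  simp only [e1]
  rw [integral_integral_swap]
  · simp only [integral_mul_const, v1]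
    rw [integral_const_mul]
    ring
  · rw [integrable_prod_iff']
    · refine ⟨ae_of_all _ fun m => (i1 m).mul_const (f m), ?_⟩
      simp only [Function.uncurry_apply_pair, norm_mul, integral_mul_const, v2]
      exact hf.norm.const_mul _
    · refine Continuous.aestronglyMeasurable ?_
      unfold Function.uncurry
      fun_prop

theorem kerJ_eq (γ X Y : ℝ) : kerJ γ X Y = -2 * Complex.I *
    ((Complex.exp (-(1 / (4 * γ) : ℝ) * ((X + Y : ℝ) + (3 / 2 : ℝ) * Complex.I) ^ 2) /
      ((X + Y : ℝ) + (3 / 2 : ℝ) * Complex.I) ^ 2) *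
    (Complex.exp (-(1 / (4 * γ) : ℝ) * ((X - Y : ℝ) + (-(1 / 2) : ℝ) * Complex.I) ^ 2) /
      ((X - Y : ℝ) + (-(1 / 2) : ℝ) * Complex.I))) := by
  have hP := shift_ne (show (3 / 2 : ℝ) ≠ 0 by norm_num) (X + Y)
  have hM := shift_ne (show (-(1 / 2) : ℝ) ≠ 0 by norm_num) (X - Y)
  have a1 : (-(1 / 2) + X * Complex.I) + (-1 + Y * Complex.I) =
      Complex.I * ((X + Y : ℝ) + (3 / 2 : ℝ) * Complex.I) := by
    push_cast; linear_combination (-3 / 2 : ℂ) * Complex.I_sq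
  have a2 : (-1 + Y * Complex.I) - (-(1 / 2) + X * Complex.I) =
      -Complex.I * ((X - Y : ℝ) + (-(1 / 2) : ℝ) * Complex.I) := by
    push_cast; linear_combination (-1 / 2 : ℂ) * Complex.I_sq
  have a3 : ((-(1 / 2) + X * Complex.I) ^ 2 + (-1 + Y * Complex.I) ^ 2) / (2 * γ) =
      -(1 / (4 * γ) : ℝ) * ((X + Y : ℝ) + (3 / 2 : ℝ) * Complex.I) ^ 2 +
      -(1 / (4 * γ) : ℝ) * ((X - Y : ℝ) + (-(1 / 2) : ℝ) * Complex.I) ^ 2 := by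
    have : (-(1 / 2) + X * Complex.I) ^ 2 + (-1 + Y * Complex.I) ^ 2 =
      -(1 / 2) * (((X + Y : ℝ) + (3 / 2 : ℝ) * Complex.I) ^ 2 +
        ((X - Y : ℝ) + (-(1 / 2) : ℝ) * Complex.I) ^ 2) := by
      push_cast
      linear_combination (X ^ 2 + Y ^ 2 + 5 / 4 : ℂ) * Complex.I_sq
    rw [this]
    push_cast
    ring
  rw [kerJ, a1, a2, a3, Complex.exp_add]
  generalize Complex.exp _ = E1
  generalize Complex.exp _ = E2
  generalize ((X + Y : ℝ) + (3 / 2 : ℝ) * Complex.I : ℂ) = P at *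
  generalize ((X - Y : ℝ) + (-(1 / 2) : ℝ) * Complex.I : ℂ) = M at *
  have hI := Complex.I_ne_zero
  field_simp
  linear_combination (E1 * E2 * (Complex.I ^ 2 - 1) : ℂ) * Complex.I_sq

theorem integral_kerJ {γ : ℝ} (hγ : 0 < γ) :
    (2 * Real.pi : ℂ)⁻¹ * ∫ Y : ℝ, (2 * Real.pi : ℂ)⁻¹ * ∫ X : ℝ, kerJ γ X Y =
      (-(1 / (4 * √(Real.pi * γ))) : ℝ) := by
  have hc : 0 < 1 / (4 * γ) := by positivity
  have nP : (3 / 2 : ℝ) ≠ 0 := by norm_num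
  have nM : (-(1 / 2) : ℝ) ≠ 0 := by norm_num
  have iP := integrable_gauss_div hc nP 2
  have iM := integrable_gauss_div hc nM 1
  simp only [pow_one] at iM
  have sh := integral_integral_shear
    (f := fun x : ℝ => Complex.exp (-(1 / (4 * γ) : ℝ) * (x + (-(1 / 2) : ℝ) * Complex.I) ^ 2) /
      (x + (-(1 / 2) : ℝ) * Complex.I))
    (g := fun x : ℝ => Complex.exp (-(1 / (4 * γ) : ℝ) * (x + (3 / 2 : ℝ) * Complex.I) ^ 2) /
      (x + (3 / 2 : ℝ) * Complex.I) ^ 2)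
    (by
      have := shift_ne nM
      fun_prop (disch := exact this))
    (by
      have := shift_ne nP
      fun_prop (disch := exact fun x => pow_ne_zero 2 (this x))) iM iP
  rw [integral_gauss_div_sq hc nP, integral_gauss_div_shift hc (by norm_num : (0 : ℝ) < 1 / 2)] at sh
  simp only [kerJ_eq, MeasureTheory.integral_const_mul]
  rw [sh]
  have hs : √(Real.pi / (1 / (4 * γ))) = 2 * √(Real.pi * γ) := by
    rw [show Real.pi / (1 / (4 * γ)) = 2 ^ 2 * (Real.pi * γ) by field_simp; ring,
      Real.sqrt_mul (by norm_num), Real.sqrt_sq (by norm_num)]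
  rw [hs]
  have hq : 0 < √(Real.pi * γ) := Real.sqrt_pos.2 (by positivity)
  have h2 : √(Real.pi * γ) ^ 2 = Real.pi * γ := Real.sq_sqrt (by positivity)
  have h2' : (√(Real.pi * γ) : ℂ) ^ 2 = Real.pi * γ := by exact_mod_cast h2
  have hq' : (√(Real.pi * γ) : ℂ) ≠ 0 := Complex.ofReal_ne_zero.2 hq.ne'
  have hγ' : (γ : ℂ) ≠ 0 := Complex.ofReal_ne_zero.2 hγ.ne'
  have hpi : (Real.pi : ℂ) ≠ 0 := Complex.ofReal_ne_zero.2 Real.pi_ne_zero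
  push_cast
  field_simp
  rw [Complex.I_sq, h2']
  ring

theorem integral_kerY {γ : ℝ} (hγ : 0 < γ) :
    ((2 * Real.pi : ℂ)⁻¹ * ∫ X : ℝ, -(Complex.exp (-((X + Complex.I) ^ 2) / (4 * γ)) /
        (X + Complex.I) ^ 2)) = (1 / (2 * √(Real.pi * γ)) : ℝ) := by
  have hc : 0 < 1 / (4 * γ) := by positivity
  have h := integral_gauss_div_sq hc one_ne_zero
  simp only [Complex.ofReal_one, one_mul] at h
  have e : ∀ X : ℝ, -((X + Complex.I) ^ 2) / (4 * γ) =
      -(1 / (4 * γ) : ℝ) * (X + Complex.I) ^ 2 := fun X => by push_cast; ring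
  simp only [e]
  rw [MeasureTheory.integral_neg, h, neg_neg]
  have hs : √(Real.pi / (1 / (4 * γ))) = 2 * √(Real.pi * γ) := by
    rw [show Real.pi / (1 / (4 * γ)) = 2 ^ 2 * (Real.pi * γ) by field_simp; ring,
      Real.sqrt_mul (by norm_num), Real.sqrt_sq (by norm_num)]
  have hq : 0 < √(Real.pi * γ) := Real.sqrt_pos.2 (by positivity)
  have h2 : √(Real.pi * γ) ^ 2 = Real.pi * γ := Real.sq_sqrt (by positivity)
  have : (2 * Real.pi)⁻¹ * (2 * (1 / (4 * γ)) * (2 * √(Real.pi * γ))) = 1 / (2 * √(Real.pi * γ)) := by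
    have hpi := Real.pi_ne_zero
    field_simp
    rw [h2]
    ring
  rw [hs, ← this]
  push_cast
  ring

theorem tendsto_N {γ r : ℝ} (h : SmallRad γ r) :
    Tendsto (fun t : ℝ => cint4 (r ^ 3) (r ^ 2) (r ^ 1) (r ^ 0) (GN t γ) / (√t : ℂ)) atTop
      (nhds 0) := by
  obtain ⟨C, -, B⟩ := N_bound h.1
  have hb : ∀ᶠ t : ℝ in atTop, ‖cint4 (r ^ 3) (r ^ 2) (r ^ 1) (r ^ 0) (GN t γ)‖ ≤ C := by
    filter_upwards [eventually_scl h.1 (k := 1) (by norm_num) le_rfl,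
      eventually_le_exp (k := 1) h.lt_one] with t h1 h2
    exact B t _ r h1 h h2
  have := tendsto_inv_sqrt.zero_mul_isBoundedUnder_le (isBoundedUnder_of_eventually_le hb)
  simpa only [div_eq_mul_inv, mul_comm] using this

/-- For `γ > 0`, `lim_{t→∞} (2q2(t) - q1(t)²)/√t = -1/(2√(πγ))`. -/
theorem q2_tilde_asymptotics (γ : ℝ) (hγ : 0 < γ) :
    ∃ r0 ∈ Set.Ioo (0 : ℝ) 1, ∀ r ∈ Set.Ioo (0 : ℝ) r0,
      Tendsto (fun t : ℝ => (2 * q2 γ r t - (q1 γ r t) ^ 2) / (Real.sqrt t : ℂ)) atTop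
        (nhds ((-(1 / (2 * Real.sqrt (Real.pi * γ))) : ℝ) : ℂ)) := by
  have hp : 0 < 8 * γ + 5 := by positivity
  refine ⟨1 / (8 * γ + 5), ⟨by positivity, (div_lt_one hp).2 (by linarith)⟩, fun r hr => ?_⟩
  have hr1 : r * (8 * γ + 5) < 1 := (lt_div_iff₀ hp).1 hr.2
  have hrγ : 0 < r * γ := mul_pos hr.1 hγ
  have h : SmallRad γ r := ⟨hγ, hr.1, by nlinarith [hr.1]⟩
  have h2 : SmallRad (2 * γ) r := ⟨by linarith, hr.1, by nlinarith [hr.1]⟩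
  have hJ := tendsto_J h
  have hY := tendsto_Y h h2
  rw [integral_kerJ hγ] at hJ
  rw [integral_kerY hγ] at hY
  have := ((tendsto_N h).neg).sub ((hJ.add hY).const_mul 2)
  convert this using 1
  · funext t
    rw [two_q2_sub_q1_sq h t, cint4_GJ h t h2]
    ring
  · congr 1
    push_cast
    ring
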